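/- (Comparison.) Let F : [0,T] × 𝒫₂ → ℝ satisfy (A1), let ψ : 𝒫₂ → ℝ satisfy (A2), let t₁ ∈ [0,T], and set φ(t,m) = ψ(p^{t,m}_{t₁}) + ∫_t^{t₁} F(r, p^{t,m}_r) dr. Let U be a bounded, continuous subsolution of the equation ∂_t U + (1/2) ∫ div[D_m U](t,m,x) dm(x) + F(t,m) = 0 on [0,t₁) × 𝒫₂ such that U(t₁, m) ≤ ψ(m) for all m ∈ 𝒫₂. Then U ≤ φ on [0,t₁] × 𝒫₂. -/

import Mathlib

open MeasureTheory Filter Set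
open scoped Topology ENNReal NNReal BoundedContinuousFunction

noncomputable section

/-- Euclidean space `ℝ^d`. -/
abbrev Ed (d : ℕ) : Type := EuclideanSpace ℝ (Fin d)

/-- `m ∈ 𝒫_p` : Borel probability measure on `ℝ^d` with finite `p`-th moment. -/
def MemP (d : ℕ) (p : ℝ) (m : Measure (Ed d)) : Prop :=
  IsProbabilityMeasure m ∧ Integrable (fun x => ‖x‖ ^ p) m

/-- `γ` is a coupling of `m` and `m'`. -/
def IsCoupling (d : ℕ) (γ : Measure (Ed d × Ed d)) (m m' : Measure (Ed d)) : Prop :=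
  γ.map Prod.fst = m ∧ γ.map Prod.snd = m'

/-- The `p`-Wasserstein distance. -/
def wdist (d : ℕ) (p : ℝ) (m m' : Measure (Ed d)) : ℝ :=
  sInf { c : ℝ | ∃ γ : Measure (Ed d × Ed d), IsProbabilityMeasure γ ∧ IsCoupling d γ m m' ∧
      c = (∫ q, ‖q.1 - q.2‖ ^ p ∂γ) ^ (1 / p) }

/-- The Gaussian kernel `ρ_δ`. -/
def gaussDensity (d : ℕ) (δ : ℝ) (x : Ed d) : ℝ :=
  (2 * Real.pi * δ) ^ (-(d : ℝ) / 2) * Real.exp (-‖x‖ ^ 2 / (2 * δ))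

/-- The centered Gaussian measure with variance `δ` on `ℝ^d`. -/
def gaussMeasure (d : ℕ) (δ : ℝ) : Measure (Ed d) :=
  volume.withDensity fun x => ENNReal.ofReal (gaussDensity d δ x)

/-- The heat flow `p^{t,m}_s` : the law at time `s` of a Brownian motion started
at time `t` with initial law `m`. -/
def heatFlow (d : ℕ) (t s : ℝ) (m : Measure (Ed d)) : Measure (Ed d) :=
  if s ≤ t then m
  else Measure.map (fun q : Ed d × Ed d => q.1 + q.2) (m.prod (gaussMeasure d (s - t)))

/-- The Laplacian of a function on `ℝ^d` (the spatial divergence of its gradient),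
`div[∇g](x) = Σ_i ∂²g/∂x_i²(x)`. -/
def lapl (d : ℕ) (g : Ed d → ℝ) (x : Ed d) : ℝ :=
  ∑ i : Fin d, iteratedFDeriv ℝ 2 g x (fun _ => EuclideanSpace.single i (1:ℝ))

/-- A test function satisfying condition (A3): `φ` is lower semicontinuous (for `d₁`) and
`d₂`-continuous, the derivatives `∂φ/∂t`, `δφ/δm`, `∇_x(δφ/δm)`, `∇²_x(δφ/δm)` exist and
are `d₂`-continuous on `[0,T) × 𝒫₂ × ℝ^d`, and `δφ/δm` and its first and second spatial
derivatives have at most quadratic growth in `x`, uniformly in `(t,m)`. -/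
structure TestFn (d : ℕ) (T : ℝ) where
  /-- the test function `φ(t,m)` -/
  φ : ℝ → Measure (Ed d) → ℝ
  /-- the time derivative `∂φ/∂t` -/
  φt : ℝ → Measure (Ed d) → ℝ
  /-- the linear functional derivative `δφ/δm (t,m,x)` -/
  δφ : ℝ → Measure (Ed d) → Ed d → ℝ
  lsc : ∀ t ∈ Set.Icc 0 T, ∀ m : Measure (Ed d), MemP d 2 m → ∀ ε > (0:ℝ), ∃ η > (0:ℝ),
    ∀ t' ∈ Set.Icc 0 T, ∀ m' : Measure (Ed d), MemP d 2 m' →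
      |t' - t| < η → wdist d 1 m m' < η → φ t m - ε < φ t' m'
  d2cont : ∀ t ∈ Set.Icc 0 T, ∀ m : Measure (Ed d), MemP d 2 m → ∀ ε > (0:ℝ), ∃ η > (0:ℝ),
    ∀ t' ∈ Set.Icc 0 T, ∀ m' : Measure (Ed d), MemP d 2 m' →
      |t' - t| < η → wdist d 2 m m' < η → |φ t' m' - φ t m| < ε
  timeDeriv : ∀ m : Measure (Ed d), MemP d 2 m → ∀ t ∈ Set.Ico 0 T,
    HasDerivWithinAt (fun s => φ s m) (φt t m) (Set.Icc 0 T) t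
  measDeriv : ∀ t ∈ Set.Ico 0 T, ∀ m : Measure (Ed d), MemP d 2 m →
    ∀ m' : Measure (Ed d), MemP d 2 m' →
      Tendsto (fun r : ℝ =>
          (φ t ((1 - ENNReal.ofReal r) • m + ENNReal.ofReal r • m') - φ t m) / r)
        (𝓝[>] 0) (𝓝 (∫ x, δφ t m x ∂m'))
  normalized : ∀ t ∈ Set.Ico 0 T, ∀ m : Measure (Ed d), MemP d 2 m →
    ∫ x, δφ t m x ∂m = 0
  smoothX : ∀ t ∈ Set.Ico 0 T, ∀ m : Measure (Ed d), MemP d 2 m → ContDiff ℝ 2 (δφ t m)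
  quadGrowth : ∃ c : ℝ, ∀ t ∈ Set.Ico 0 T, ∀ m : Measure (Ed d), MemP d 2 m → ∀ x : Ed d,
    |δφ t m x| ≤ c * (1 + ‖x‖ ^ 2) ∧ ‖fderiv ℝ (δφ t m) x‖ ≤ c * (1 + ‖x‖ ^ 2) ∧
      ‖iteratedFDeriv ℝ 2 (δφ t m) x‖ ≤ c * (1 + ‖x‖ ^ 2)
  d2contDeriv : ∀ t ∈ Set.Ico 0 T, ∀ m : Measure (Ed d), MemP d 2 m → ∀ x : Ed d,
    ∀ ε > (0:ℝ), ∃ η > (0:ℝ), ∀ t' ∈ Set.Ico 0 T, ∀ m' : Measure (Ed d), MemP d 2 m' →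
      ∀ x' : Ed d, |t' - t| < η → wdist d 2 m m' < η → ‖x' - x‖ < η →
        |φt t' m' - φt t m| < ε ∧ |δφ t' m' x' - δφ t m x| < ε ∧
          ‖fderiv ℝ (δφ t' m') x' - fderiv ℝ (δφ t m) x‖ < ε ∧
          ‖iteratedFDeriv ℝ 2 (δφ t' m') x' - iteratedFDeriv ℝ 2 (δφ t m) x‖ < ε

/-- `φ − u` has a local minimum at `(t,m)` (locality for `|·|` in time and `d₁` in measure). -/
def LocalMinAt (d : ℕ) (T : ℝ) (g : ℝ → Measure (Ed d) → ℝ)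
    (t : ℝ) (m : Measure (Ed d)) : Prop :=
  ∃ η > (0:ℝ), ∀ t' ∈ Set.Icc 0 T, ∀ m' : Measure (Ed d), MemP d 2 m' →
    |t' - t| ≤ η → wdist d 1 m m' ≤ η → g t m ≤ g t' m'

/-- `u` is a (viscosity) subsolution on `[0,T) × 𝒫₂` of the Hamilton-Jacobi equation
`∂_t U(t,m) + ½ ∫ div[D_m U](t,m,x) dm(x) + F(t,m) = 0` : for every `(t,m) ∈ [0,T) × 𝒫₂`
and every test function `φ` satisfying (A3) such that `φ − u` has a local minimum at
`(t,m)`, one has `∂_t φ(t,m) + ½ ∫ div[D_m φ](t,m,x) dm(x) + F(t,m) ≥ 0`. -/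
def IsSubsolution (d : ℕ) (T : ℝ) (F : ℝ → Measure (Ed d) → ℝ)
    (u : ℝ → Measure (Ed d) → ℝ) : Prop :=
  ∀ t ∈ Set.Ico 0 T, ∀ m : Measure (Ed d), MemP d 2 m → ∀ ψ : TestFn d T,
    LocalMinAt d T (fun s μ => ψ.φ s μ - u s μ) t m →
      ψ.φt t m + (1 / 2) * (∫ x, lapl d (ψ.δφ t m) x ∂m) + F t m ≥ 0

/-- `u : [0,T] × 𝒫₂ → ℝ` is (jointly) continuous for the distance `|·| + d₁`. -/
def ContD1 (d : ℕ) (T : ℝ) (u : ℝ → Measure (Ed d) → ℝ) : Prop :=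
  ∀ t ∈ Set.Icc 0 T, ∀ m : Measure (Ed d), MemP d 2 m → ∀ ε > (0:ℝ), ∃ η > (0:ℝ),
    ∀ t' ∈ Set.Icc 0 T, ∀ m' : Measure (Ed d), MemP d 2 m' →
      |t' - t| < η → wdist d 1 m m' < η → |u t' m' - u t m| < ε

/-- `u : [0,T] × 𝒫₂ → ℝ` is bounded. -/
def BddD1 (d : ℕ) (T : ℝ) (u : ℝ → Measure (Ed d) → ℝ) : Prop :=
  ∃ c : ℝ, ∀ t ∈ Set.Icc 0 T, ∀ m : Measure (Ed d), MemP d 2 m → |u t m| ≤ c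

/-- The data of condition (A1) for a source term `F` : `F` is bounded and continuous, and
`δF/δm`, `∇_x(δF/δm)`, `∇²_x(δF/δm)` exist and are bounded and continuous. -/
structure A1Data (d : ℕ) (T : ℝ) where
  /-- the source term `F(t,m)` -/
  F : ℝ → Measure (Ed d) → ℝ
  /-- the linear functional derivative `δF/δm (t,m,x)` -/
  δF : ℝ → Measure (Ed d) → Ed d → ℝ
  bddF : BddD1 d T F
  contF : ContD1 d T F
  measDeriv : ∀ t ∈ Set.Icc 0 T, ∀ m : Measure (Ed d), MemP d 2 m →
    ∀ m' : Measure (Ed d), MemP d 2 m' →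
      Tendsto (fun r : ℝ =>
          (F t ((1 - ENNReal.ofReal r) • m + ENNReal.ofReal r • m') - F t m) / r)
        (𝓝[>] 0) (𝓝 (∫ x, δF t m x ∂m'))
  normalized : ∀ t ∈ Set.Icc 0 T, ∀ m : Measure (Ed d), MemP d 2 m →
    ∫ x, δF t m x ∂m = 0
  smoothX : ∀ t ∈ Set.Icc 0 T, ∀ m : Measure (Ed d), MemP d 2 m → ContDiff ℝ 2 (δF t m)
  bddDeriv : ∃ c : ℝ, ∀ t ∈ Set.Icc 0 T, ∀ m : Measure (Ed d), MemP d 2 m → ∀ x : Ed d,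
    |δF t m x| ≤ c ∧ ‖fderiv ℝ (δF t m) x‖ ≤ c ∧ ‖iteratedFDeriv ℝ 2 (δF t m) x‖ ≤ c
  contDeriv : ∀ t ∈ Set.Icc 0 T, ∀ m : Measure (Ed d), MemP d 2 m → ∀ x : Ed d,
    ∀ ε > (0:ℝ), ∃ η > (0:ℝ), ∀ t' ∈ Set.Icc 0 T, ∀ m' : Measure (Ed d), MemP d 2 m' →
      ∀ x' : Ed d, |t' - t| < η → wdist d 1 m m' < η → ‖x' - x‖ < η →
        |δF t' m' x' - δF t m x| < ε ∧
          ‖fderiv ℝ (δF t' m') x' - fderiv ℝ (δF t m) x‖ < ε ∧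
          ‖iteratedFDeriv ℝ 2 (δF t' m') x' - iteratedFDeriv ℝ 2 (δF t m) x‖ < ε

/-- The data of condition (A2) for a terminal condition `ψ` : `ψ` is continuous with at
most linear growth, and `δψ/δm`, `∇_x(δψ/δm)`, `∇²_x(δψ/δm)` exist, are continuous, and
have linear growth in `x` uniformly in `m`. -/
structure A2Data (d : ℕ) where
  /-- the terminal condition `ψ(m)` -/
  ψ : Measure (Ed d) → ℝ
  /-- the linear functional derivative `δψ/δm (m,x)` -/
  δψ : Measure (Ed d) → Ed d → ℝ
  growth : ∃ c : ℝ, ∀ m : Measure (Ed d), MemP d 2 m → |ψ m| ≤ c * (1 + ∫ x, ‖x‖ ∂m)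
  contψ : ∀ m : Measure (Ed d), MemP d 2 m → ∀ ε > (0:ℝ), ∃ η > (0:ℝ),
    ∀ m' : Measure (Ed d), MemP d 2 m' → wdist d 1 m m' < η → |ψ m' - ψ m| < ε
  measDeriv : ∀ m : Measure (Ed d), MemP d 2 m → ∀ m' : Measure (Ed d), MemP d 2 m' →
    Tendsto (fun r : ℝ =>
        (ψ ((1 - ENNReal.ofReal r) • m + ENNReal.ofReal r • m') - ψ m) / r)
      (𝓝[>] 0) (𝓝 (∫ x, δψ m x ∂m'))
  normalized : ∀ m : Measure (Ed d), MemP d 2 m → ∫ x, δψ m x ∂m = 0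
  smoothX : ∀ m : Measure (Ed d), MemP d 2 m → ContDiff ℝ 2 (δψ m)
  derivGrowth : ∃ c : ℝ, ∀ m : Measure (Ed d), MemP d 2 m → ∀ x : Ed d,
    |δψ m x| ≤ c * (1 + ‖x‖) ∧ ‖fderiv ℝ (δψ m) x‖ ≤ c * (1 + ‖x‖) ∧
      ‖iteratedFDeriv ℝ 2 (δψ m) x‖ ≤ c * (1 + ‖x‖)
  contDeriv : ∀ m : Measure (Ed d), MemP d 2 m → ∀ x : Ed d, ∀ ε > (0:ℝ), ∃ η > (0:ℝ),
    ∀ m' : Measure (Ed d), MemP d 2 m' → ∀ x' : Ed d,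
      wdist d 1 m m' < η → ‖x' - x‖ < η →
        |δψ m' x' - δψ m x| < ε ∧ ‖fderiv ℝ (δψ m') x' - fderiv ℝ (δψ m) x‖ < ε ∧
          ‖iteratedFDeriv ℝ 2 (δψ m') x' - iteratedFDeriv ℝ 2 (δψ m) x‖ < ε

section Wasserstein

variable {d : ℕ} {m m' : Measure (Ed d)}

lemma memP_two_iff : MemP d 2 m ↔ IsProbabilityMeasure m ∧ Integrable (fun x => ‖x‖ ^ 2) m := by
  simp [MemP]

lemma MemP.integrable_norm_sq (hm : MemP d 2 m) : Integrable (fun x => ‖x‖ ^ 2) m :=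
  (memP_two_iff.1 hm).2

lemma MemP.integrable_norm (hm : MemP d 2 m) : Integrable (fun x => ‖x‖) m := by
  have := hm.1
  refine ((integrable_const (1 : ℝ)).add hm.integrable_norm_sq).mono' (by fun_prop) ?_
  refine ae_of_all _ fun x => ?_
  simp only [Pi.add_apply, norm_norm]
  nlinarith [sq_nonneg (‖x‖ - 1), norm_nonneg x]

lemma MemP.integrable_of_linear_growth (hm : MemP d 2 m) {f : Ed d → ℝ}
    (hf : Continuous f) {c : ℝ} (hc : ∀ x, |f x| ≤ c * (1 + ‖x‖)) : Integrable f m := by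
  have := hm.1
  exact (((integrable_const (1 : ℝ)).add hm.integrable_norm).const_mul c).mono'
    hf.aestronglyMeasurable (ae_of_all _ hc)

lemma IsCoupling.integrable_fst {π : Measure (Ed d × Ed d)} (h : IsCoupling d π m m')
    {f : Ed d → ℝ} (hf : Integrable f m) : Integrable (fun q => f q.1) π := by
  rw [← h.1] at hf
  exact hf.comp_measurable measurable_fst

lemma IsCoupling.integrable_snd {π : Measure (Ed d × Ed d)} (h : IsCoupling d π m m')
    {f : Ed d → ℝ} (hf : Integrable f m') : Integrable (fun q => f q.2) π := by
  rw [← h.2] at hf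
  exact hf.comp_measurable measurable_snd

lemma IsCoupling.integral_fst {π : Measure (Ed d × Ed d)} (h : IsCoupling d π m m')
    {f : Ed d → ℝ} (hf : Integrable f m) : ∫ q, f q.1 ∂π = ∫ x, f x ∂m := by
  have := hf.aestronglyMeasurable
  rw [← h.1] at this ⊢
  exact (integral_map measurable_fst.aemeasurable this).symm

lemma IsCoupling.integral_snd {π : Measure (Ed d × Ed d)} (h : IsCoupling d π m m')
    {f : Ed d → ℝ} (hf : Integrable f m') : ∫ q, f q.2 ∂π = ∫ x, f x ∂m' := by
  have := hf.aestronglyMeasurable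
  rw [← h.2] at this ⊢
  exact (integral_map measurable_snd.aemeasurable this).symm

lemma IsCoupling.integrable_dist {π : Measure (Ed d × Ed d)} (h : IsCoupling d π m m')
    (hm : MemP d 2 m) (hm' : MemP d 2 m') : Integrable (fun q => ‖q.1 - q.2‖) π :=
  ((h.integrable_fst hm.integrable_norm).add (h.integrable_snd hm'.integrable_norm)).mono'
    (by fun_prop) (ae_of_all _ fun q => by simpa using norm_sub_le q.1 q.2)

lemma IsCoupling.integrable_dist_sq {π : Measure (Ed d × Ed d)} (h : IsCoupling d π m m')
    (hm : MemP d 2 m) (hm' : MemP d 2 m') : Integrable (fun q => ‖q.1 - q.2‖ ^ 2) π := by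
  refine (((h.integrable_fst hm.integrable_norm_sq).add
    (h.integrable_snd hm'.integrable_norm_sq)).const_mul 2).mono'
    (by fun_prop) (ae_of_all _ fun q => ?_)
  have h1 := norm_sub_le q.1 q.2
  simp only [Pi.add_apply, norm_pow, norm_norm]
  nlinarith [sq_nonneg (‖q.1‖ - ‖q.2‖), norm_nonneg (q.1 - q.2), norm_nonneg q.1, norm_nonneg q.2]

lemma isCoupling_prod [IsProbabilityMeasure m] [IsProbabilityMeasure m'] :
    IsCoupling d (m.prod m') m m' :=
  ⟨by simp [Measure.map_fst_prod], by simp [Measure.map_snd_prod]⟩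

lemma wdist_nonneg (p : ℝ) : 0 ≤ wdist d p m m' := by
  refine Real.sInf_nonneg ?_
  rintro c ⟨π, -, -, rfl⟩
  exact Real.rpow_nonneg (integral_nonneg fun q => Real.rpow_nonneg (norm_nonneg _) _) _

lemma wdist_one_le {π : Measure (Ed d × Ed d)} [hπ : IsProbabilityMeasure π]
    (h : IsCoupling d π m m') : wdist d 1 m m' ≤ ∫ q, ‖q.1 - q.2‖ ∂π := by
  refine csInf_le ⟨0, ?_⟩ ⟨π, hπ, h, by simp⟩
  rintro c ⟨π, -, -, rfl⟩
  exact Real.rpow_nonneg (integral_nonneg fun q => Real.rpow_nonneg (norm_nonneg _) _) _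

lemma exists_coupling_of_wdist_one_lt (hm : IsProbabilityMeasure m)
    (hm' : IsProbabilityMeasure m') {η : ℝ} (h : wdist d 1 m m' < η) :
    ∃ π : Measure (Ed d × Ed d), IsProbabilityMeasure π ∧ IsCoupling d π m m' ∧
      ∫ q, ‖q.1 - q.2‖ ∂π < η := by
  obtain ⟨c, ⟨π, h1, h2, rfl⟩, h3⟩ := exists_lt_of_csInf_lt
    (by exact ⟨_, m.prod m', inferInstance, isCoupling_prod, rfl⟩) h
  exact ⟨π, h1, h2, by simpa using h3⟩

lemma exists_coupling_of_wdist_two_lt (hm : IsProbabilityMeasure m)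
    (hm' : IsProbabilityMeasure m') {η : ℝ} (h : wdist d 2 m m' < η) :
    ∃ π : Measure (Ed d × Ed d), IsProbabilityMeasure π ∧ IsCoupling d π m m' ∧
      √(∫ q, ‖q.1 - q.2‖ ^ 2 ∂π) < η := by
  obtain ⟨c, ⟨π, h1, h2, rfl⟩, h3⟩ := exists_lt_of_csInf_lt
    (by exact ⟨_, m.prod m', inferInstance, isCoupling_prod, rfl⟩) h
  refine ⟨π, h1, h2, ?_⟩
  rw [Real.sqrt_eq_rpow]
  simpa using h3

lemma IsCoupling.integral_dist_le_sqrt {π : Measure (Ed d × Ed d)} [IsProbabilityMeasure π]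
    (h : IsCoupling d π m m') (hm : MemP d 2 m) (hm' : MemP d 2 m') :
    ∫ q, ‖q.1 - q.2‖ ∂π ≤ √(∫ q, ‖q.1 - q.2‖ ^ 2 ∂π) := by
  refine Real.le_sqrt_of_sq_le ?_
  set a := ∫ q, ‖q.1 - q.2‖ ∂π
  have h1 := h.integrable_dist hm hm'
  have h2 := h.integrable_dist_sq hm hm'
  have h3 : 0 ≤ ∫ q, (‖q.1 - q.2‖ - a) ^ 2 ∂π := integral_nonneg fun q => sq_nonneg _
  have h4 : ∫ q, (‖q.1 - q.2‖ - a) ^ 2 ∂π = ∫ q, ‖q.1 - q.2‖ ^ 2 ∂π - 2 * a * a + a ^ 2 := by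
    have : ∀ q : Ed d × Ed d, (‖q.1 - q.2‖ - a) ^ 2 =
        ‖q.1 - q.2‖ ^ 2 - 2 * a * ‖q.1 - q.2‖ + a ^ 2 := fun q => by ring
    simp_rw [this]
    rw [integral_add (by exact h2.sub (h1.const_mul _)) (integrable_const _),
      integral_sub h2 (h1.const_mul _), integral_const_mul]
    simp [a]
  nlinarith

lemma wdist_one_le_two (hm : MemP d 2 m) (hm' : MemP d 2 m') :
    wdist d 1 m m' ≤ wdist d 2 m m' := by
  have := hm.1
  have := hm'.1
  refine le_of_forall_gt fun η hη => ?_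
  obtain ⟨π, hπ, h, hlt⟩ := exists_coupling_of_wdist_two_lt hm.1 hm'.1 hη
  exact (wdist_one_le h).trans_lt ((h.integral_dist_le_sqrt hm hm').trans_lt hlt)

/-- Convergence in `𝒫₂` for the distance `d₁` along a filter. -/
def MTendsto {ι : Type*} (l : Filter ι) (μ : ι → Measure (Ed d)) (m : Measure (Ed d)) : Prop :=
  (∀ᶠ i in l, MemP d 2 (μ i)) ∧ Tendsto (fun i => wdist d 1 m (μ i)) l (𝓝 0)

lemma MTendsto.comp {ι κ : Type*} {l : Filter ι} {k : Filter κ} {μ : ι → Measure (Ed d)}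
    (h : MTendsto l μ m) {f : κ → ι} (hf : Tendsto f k l) : MTendsto k (fun j => μ (f j)) m :=
  ⟨hf.eventually h.1, h.2.comp hf⟩

lemma wdist_one_self (hm : IsProbabilityMeasure m) : wdist d 1 m m = 0 := by
  refine le_antisymm ?_ (wdist_nonneg 1)
  have hmeas : Measurable fun x : Ed d => (x, x) := by fun_prop
  have : IsProbabilityMeasure (m.map fun x => (x, x)) :=
    Measure.isProbabilityMeasure_map hmeas.aemeasurable
  refine (wdist_one_le (π := m.map fun x => (x, x)) ⟨?_, ?_⟩).trans_eq ?_
  · rw [Measure.map_map (by fun_prop) hmeas]; exact Measure.map_id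
  · rw [Measure.map_map (by fun_prop) hmeas]; exact Measure.map_id
  · rw [integral_map hmeas.aemeasurable (by fun_prop)]; simp

lemma mtendsto_const {ι : Type*} {l : Filter ι} (hm : MemP d 2 m) :
    MTendsto l (fun _ => m) m :=
  ⟨Eventually.of_forall fun _ => hm, by simpa [wdist_one_self hm.1] using tendsto_const_nhds⟩

/-- Locally uniform form of continuous convergence. -/
lemma exists_uniform_of_tendsto_prod {ι : Type*} {l : Filter ι} {f : ι → Ed d → ℝ}
    {g : Ed d → ℝ} (hg : Continuous g)
    (hlim : ∀ x, Tendsto (fun q : ι × Ed d => f q.1 q.2) (l ×ˢ 𝓝 x) (𝓝 (g x)))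
    {K : Set (Ed d)} (hK : IsCompact K) {ε : ℝ} (hε : 0 < ε) :
    ∃ δ > 0, ∀ᶠ i in l, ∀ x ∈ K, ∀ y, ‖x - y‖ < δ → |f i y - g x| ≤ ε := by
  refine hK.induction_on (p := fun K => ∃ δ > 0, ∀ᶠ i in l, ∀ x ∈ K, ∀ y,
    ‖x - y‖ < δ → |f i y - g x| ≤ ε) ?_ ?_ ?_ ?_
  · exact ⟨1, one_pos, by simp⟩
  · rintro s t hst h
    obtain ⟨δ, hδ, h⟩ := h
    exact ⟨δ, hδ, h.mono fun i hi x hx => hi x (hst hx)⟩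
  · rintro s t hs ht
    obtain ⟨δ, hδ, h⟩ := hs
    obtain ⟨δ', hδ', h'⟩ := ht
    refine ⟨min δ δ', lt_min hδ hδ', ?_⟩
    filter_upwards [h, h'] with i hi hi' x hx y hxy
    rcases hx with hx | hx
    · exact hi x hx y (hxy.trans_le (min_le_left _ _))
    · exact hi' x hx y (hxy.trans_le (min_le_right _ _))
  · rintro x hx
    have h1 := (Metric.tendsto_nhds.1 (hlim x)) (ε / 2) (by positivity)
    obtain ⟨p, hp, q, hq, hpq⟩ := eventually_prod_iff.1 h1
    obtain ⟨δ, hδ, hball⟩ := Metric.eventually_nhds_iff.1 hq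
    have h2 := Metric.tendsto_nhds.1 (hg.tendsto x) (ε / 2) (by positivity)
    refine ⟨{x' | dist (g x') (g x) < ε / 2} ∩ Metric.ball x (δ / 2),
      mem_nhdsWithin_of_mem_nhds (inter_mem h2 (Metric.ball_mem_nhds _ (by positivity))),
      δ / 2, by positivity, ?_⟩
    filter_upwards [hp] with i hi x' hx' y hy
    have h3 : dist y x < δ := by
      have h4 : dist x' x < δ / 2 := hx'.2
      have h5 : dist y x' < δ / 2 := by rwa [dist_comm, dist_eq_norm]
      linarith [dist_triangle y x' x]
    have h6 := hpq hi (hball h3)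
    have h7 : dist (g x') (g x) < ε / 2 := hx'.1
    rw [← Real.dist_eq]
    linarith [dist_triangle_right (f i y) (g x') (g x)]

lemma MTendsto.tendsto_integral {ι : Type*} {l : Filter ι} {μ : ι → Measure (Ed d)}
    (h : MTendsto l μ m) (hm : MemP d 2 m) {f : ι → Ed d → ℝ} {g : Ed d → ℝ} {c : ℝ}
    (hf : ∀ᶠ i in l, Continuous (f i)) (hg : Continuous g)
    (hfc : ∀ᶠ i in l, ∀ x, |f i x| ≤ c * (1 + ‖x‖)) (hgc : ∀ x, |g x| ≤ c * (1 + ‖x‖))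
    (hlim : ∀ x, Tendsto (fun q : ι × Ed d => f q.1 q.2) (l ×ˢ 𝓝 x) (𝓝 (g x))) :
    Tendsto (fun i => ∫ x, f i x ∂(μ i)) l (𝓝 (∫ x, g x ∂m)) := by
  have := hm.1
  have hc : 0 ≤ c := by simpa using (abs_nonneg _).trans (hgc 0)
  rw [Metric.tendsto_nhds]
  intro ε hε
  obtain ⟨R, hR0, hR⟩ : ∃ R : ℝ, 0 ≤ R ∧
      ∫ x, (Metric.closedBall (0 : Ed d) R)ᶜ.indicator (fun x => c * (2 + 2 * ‖x‖)) x ∂m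
        < ε / 4 := by
    have h0 : Tendsto (fun R : ℝ => ∫ x, (Metric.closedBall (0 : Ed d) R)ᶜ.indicator
        (fun x => c * (2 + 2 * ‖x‖)) x ∂m) atTop (𝓝 (∫ _, (0 : ℝ) ∂m)) := by
      refine tendsto_integral_filter_of_dominated_convergence (fun x => c * (2 + 2 * ‖x‖))
        ?_ ?_ ?_ ?_
      · refine Eventually.of_forall fun R => ?_
        exact (Continuous.aestronglyMeasurable (by fun_prop)).indicator
          Metric.isClosed_closedBall.measurableSet.compl
      · refine Eventually.of_forall fun R => ae_of_all _ fun x => ?_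
        refine (norm_indicator_le_norm_self _ _).trans_eq ?_
        rw [Real.norm_of_nonneg (by positivity)]
      · exact ((integrable_const _).add (hm.integrable_norm.const_mul 2)).const_mul c
      · refine ae_of_all _ fun x => ?_
        refine tendsto_const_nhds.congr' ?_
        filter_upwards [eventually_ge_atTop ‖x‖] with R hR
        rw [indicator_of_notMem]
        simpa using hR
    have h1 := (h0.eventually_lt_const (u := ε / 4) (by simpa using hε)).and
      (eventually_ge_atTop 0)
    obtain ⟨R, h1, h2⟩ := h1.exists
    exact ⟨R, h2, h1⟩
  obtain ⟨δ, hδ, hunif⟩ := exists_uniform_of_tendsto_prod hg hlim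
    (isCompact_closedBall (0 : Ed d) R) (show 0 < ε / 4 by positivity)
  set C := c + c * (2 + 2 * R) / δ with hC
  have hC0 : 0 ≤ C := by positivity
  have hsmall : ∀ᶠ i in l, wdist d 1 m (μ i) < ε / (4 * (C + 1)) :=
    h.2.eventually_lt_const (by positivity)
  filter_upwards [h.1, hf, hfc, hunif, hsmall] with i hi hfi hfci hui hsi
  have := hi.1
  obtain ⟨π, hπ, hcoup, hcost⟩ := exists_coupling_of_wdist_one_lt hm.1 hi.1 hsi
  have hfint := hi.integrable_of_linear_growth hfi hfci
  have hgint := hm.integrable_of_linear_growth hg hgc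
  rw [Real.dist_eq, ← hcoup.integral_fst hgint, ← hcoup.integral_snd hfint,
    ← integral_sub (hcoup.integrable_snd hfint) (hcoup.integrable_fst hgint)]
  have hind : Integrable ((Metric.closedBall (0 : Ed d) R)ᶜ.indicator
      (fun x => c * (2 + 2 * ‖x‖))) m :=
    (((integrable_const _).add (hm.integrable_norm.const_mul 2)).const_mul c).indicator
      Metric.isClosed_closedBall.measurableSet.compl
  have hbound : ∀ q : Ed d × Ed d, ‖f i q.2 - g q.1‖ ≤ ε / 4 +
      (Metric.closedBall (0 : Ed d) R)ᶜ.indicator (fun x => c * (2 + 2 * ‖x‖)) q.1 +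
      C * ‖q.1 - q.2‖ := by
    intro q
    have h1 : |f i q.2 - g q.1| ≤ c * (2 + 2 * ‖q.1‖) + c * ‖q.1 - q.2‖ := by
      have h2 := abs_sub (f i q.2) (g q.1)
      have h3 : ‖q.2‖ ≤ ‖q.1‖ + ‖q.1 - q.2‖ := norm_le_norm_add_norm_sub _ _
      nlinarith [hfci q.2, hgc q.1]
    have h0 : 0 ≤ ‖q.1 - q.2‖ := norm_nonneg _
    have h00 : 0 ≤ c * (2 + 2 * R) / δ := by positivity
    rw [Real.norm_eq_abs]
    by_cases hq : q.1 ∈ Metric.closedBall (0 : Ed d) R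
    · rw [indicator_of_notMem (by simpa using hq)]
      by_cases hd : ‖q.1 - q.2‖ < δ
      · have := hui q.1 hq q.2 hd
        have := mul_nonneg hC0 h0
        linarith
      · push Not at hd
        have hq' : ‖q.1‖ ≤ R := by simpa using hq
        have h5 : c * (2 + 2 * ‖q.1‖) ≤ c * (2 + 2 * R) / δ * ‖q.1 - q.2‖ := by
          calc c * (2 + 2 * ‖q.1‖) ≤ c * (2 + 2 * R) := by gcongr
            _ = c * (2 + 2 * R) / δ * δ := by field_simp
            _ ≤ _ := by gcongr
        rw [hC]
        nlinarith
    · rw [indicator_of_mem (by exact hq)]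
      have := mul_nonneg h00 h0
      rw [hC]
      nlinarith
  have hint2 : Integrable (fun q : Ed d × Ed d => ε / 4 +
      (Metric.closedBall (0 : Ed d) R)ᶜ.indicator (fun x => c * (2 + 2 * ‖x‖)) q.1) π :=
    (integrable_const _).add (hcoup.integrable_fst hind)
  have hint3 := (hcoup.integrable_dist hm hi).const_mul C
  have hle := norm_integral_le_of_norm_le (hint2.add hint3) (ae_of_all _ hbound)
  rw [Real.norm_eq_abs] at hle
  refine hle.trans_lt ?_
  have e1 : ∫ q : Ed d × Ed d, ((fun q : Ed d × Ed d => ε / 4 +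
      (Metric.closedBall (0 : Ed d) R)ᶜ.indicator (fun x => c * (2 + 2 * ‖x‖)) q.1) +
      fun q : Ed d × Ed d => C * ‖q.1 - q.2‖) q ∂π = ε / 4 +
      ∫ x, (Metric.closedBall (0 : Ed d) R)ᶜ.indicator (fun x => c * (2 + 2 * ‖x‖)) x ∂m +
      C * ∫ q, ‖q.1 - q.2‖ ∂π := by
    rw [integral_add' hint2 hint3, integral_add (integrable_const _) (hcoup.integrable_fst hind),
      hcoup.integral_fst hind, integral_const_mul]
    simp
  rw [e1]
  have h6 : C * ∫ q, ‖q.1 - q.2‖ ∂π ≤ ε / 4 := by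
    calc C * ∫ q, ‖q.1 - q.2‖ ∂π ≤ C * (ε / (4 * (C + 1))) := by gcongr
      _ = ε / 4 * (C / (C + 1)) := by field_simp
      _ ≤ ε / 4 * 1 := by
        gcongr
        exact (div_le_one (by positivity)).2 (by linarith)
      _ = ε / 4 := mul_one _
  linarith

end Wasserstein

section HeatFlow

open ProbabilityTheory Complex

variable {d : ℕ} {m m' : Measure (Ed d)}

lemma isProbabilityMeasure_gaussMeasure {δ : ℝ} (hδ : 0 < δ) :
    IsProbabilityMeasure (gaussMeasure d δ) := by
  have hb : 0 < 1 / (2 * δ) := by positivity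
  have hrew : ∀ x : Ed d, gaussDensity d δ x =
      (2 * Real.pi * δ) ^ (-(d : ℝ) / 2) * Real.exp (-(1 / (2 * δ)) * ‖x‖ ^ 2) := by
    intro x
    rw [gaussDensity]
    congr 2
    ring
  have hI := GaussianFourier.integral_rexp_neg_mul_sq_norm (V := Ed d) hb
  have hint : Integrable (gaussDensity d δ) := by
    simp_rw [funext hrew]
    refine Integrable.const_mul ?_ _
    refine Integrable.of_integral_ne_zero ?_
    rw [hI]
    positivity
  constructor
  rw [gaussMeasure, withDensity_apply _ MeasurableSet.univ, Measure.restrict_univ,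
    ← ofReal_integral_eq_lintegral_ofReal hint
      (ae_of_all _ fun x => by rw [hrew]; positivity)]
  simp_rw [hrew]
  rw [integral_const_mul, hI]
  have h1 : Real.pi / (1 / (2 * δ)) = 2 * Real.pi * δ := by field_simp
  have h2 : (Module.finrank ℝ (Ed d) : ℝ) = d := by simp
  rw [h1, h2, ← Real.rpow_add (by positivity)]
  simp [neg_div]

lemma charFun_gaussMeasure {δ : ℝ} (hδ : 0 < δ) (t : Ed d) :
    charFun (gaussMeasure d δ) t = cexp (-(δ * ‖t‖ ^ 2) / 2) := by
  have hb : 0 < (1 / (2 * δ) : ℂ).re := by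
    have : (1 / (2 * δ) : ℂ) = ((1 / (2 * δ) : ℝ) : ℂ) := by push_cast; rfl
    rw [this, ofReal_re]
    positivity
  have hmeas : Measurable (gaussDensity d δ) := by
    unfold gaussDensity
    fun_prop
  have hI := GaussianFourier.integral_cexp_neg_mul_sq_norm_add (V := Ed d) hb I t
  rw [charFun_apply, gaussMeasure, integral_withDensity_eq_integral_toReal_smul
    hmeas.ennreal_ofReal (by simp)]
  have hrew : ∀ x : Ed d, (ENNReal.ofReal (gaussDensity d δ x)).toReal •
      cexp (inner ℝ x t * I) = (((2 * Real.pi * δ) ^ (-(d : ℝ) / 2) : ℝ) : ℂ) *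
        cexp (-(1 / (2 * δ)) * ‖x‖ ^ 2 + I * inner ℝ t x) := by
    intro x
    rw [ENNReal.toReal_ofReal (by unfold gaussDensity; positivity), gaussDensity, real_smul,
      ofReal_mul, mul_assoc, ofReal_exp, ← Complex.exp_add, real_inner_comm]
    congr 2
    push_cast
    ring
  simp_rw [hrew]
  rw [integral_const_mul, hI]
  have h1 : (Real.pi : ℂ) / (1 / (2 * δ)) = ((2 * Real.pi * δ : ℝ) : ℂ) := by
    push_cast
    field_simp
  have h2 : (Module.finrank ℝ (Ed d) / 2 : ℂ) = ((d / 2 : ℝ) : ℂ) := by simp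
  have hδ' : (δ : ℂ) ≠ 0 := by exact_mod_cast hδ.ne'
  rw [h1, h2, ← ofReal_cpow (by positivity), ← mul_assoc, ← ofReal_mul,
    ← Real.rpow_add (by positivity)]
  have h3 : -(d : ℝ) / 2 + d / 2 = 0 := by ring
  rw [h3, Real.rpow_zero, ofReal_one, one_mul]
  congr 1
  rw [I_sq]
  field_simp
  ring

lemma gaussMeasure_eq_map {δ : ℝ} (hδ : 0 < δ) :
    gaussMeasure d δ = (stdGaussian (Ed d)).map (fun z => √δ • z) := by
  have := isProbabilityMeasure_gaussMeasure (d := d) hδ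
  have : IsProbabilityMeasure ((stdGaussian (Ed d)).map (fun z => √δ • z)) :=
    Measure.isProbabilityMeasure_map (by fun_prop)
  refine Measure.ext_of_charFun ?_
  ext t
  rw [charFun_gaussMeasure hδ, charFun_map_smul, charFun_stdGaussian, norm_smul,
    Real.norm_of_nonneg (Real.sqrt_nonneg _)]
  congr 1
  push_cast
  rw [mul_pow, ← ofReal_pow, ← ofReal_pow, Real.sq_sqrt hδ.le]

lemma heatFlow_eq_map [IsProbabilityMeasure m] (t s : ℝ) :
    heatFlow d t s m =
      (m.prod (stdGaussian (Ed d))).map (fun q => q.1 + √(s - t) • q.2) := by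
  rw [heatFlow]
  split_ifs with h
  · have h0 : √(s - t) = 0 := Real.sqrt_eq_zero_of_nonpos (by linarith)
    have : (fun q : Ed d × Ed d => q.1 + √(s - t) • q.2) = Prod.fst := by
      ext q : 1
      simp [h0]
    rw [this, Measure.map_fst_prod]
    simp
  · rw [gaussMeasure_eq_map (by linarith)]
    have := Measure.map_prod_map m (stdGaussian (Ed d)) (measurable_id (α := Ed d))
      (show Measurable fun z : Ed d => √(s - t) • z by fun_prop)
    rw [Measure.map_id] at this
    rw [this, Measure.map_map (by fun_prop) (by fun_prop)]
    rfl

instance isProbabilityMeasure_heatFlow [IsProbabilityMeasure m] (t s : ℝ) :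
    IsProbabilityMeasure (heatFlow d t s m) := by
  rw [heatFlow_eq_map]
  exact Measure.isProbabilityMeasure_map (by fun_prop)

lemma charFun_heatFlow [IsProbabilityMeasure m] {t s : ℝ} (hts : t ≤ s) (ξ : Ed d) :
    charFun (heatFlow d t s m) ξ = charFun m ξ * cexp (-((s - t) * ‖ξ‖ ^ 2) / 2) := by
  rw [heatFlow_eq_map, charFun_apply, integral_map (by fun_prop) (by fun_prop)]
  have : ∀ q : Ed d × Ed d, cexp (inner ℝ (q.1 + √(s - t) • q.2) ξ * I) =
      cexp (inner ℝ q.1 ξ * I) * cexp (inner ℝ q.2 (√(s - t) • ξ) * I) := by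
    intro q
    rw [← Complex.exp_add, inner_add_left, inner_smul_left, inner_smul_right]
    push_cast
    simp
    ring_nf
  simp_rw [this]
  rw [integral_prod_mul (fun x : Ed d => cexp (inner ℝ x ξ * I))
    (fun z : Ed d => cexp (inner ℝ z (√(s - t) • ξ) * I)), ← charFun_apply, ← charFun_apply,
    charFun_stdGaussian, norm_smul, Real.norm_of_nonneg (Real.sqrt_nonneg _)]
  congr 2
  push_cast
  rw [mul_pow, ← ofReal_pow, ← ofReal_pow, Real.sq_sqrt (by linarith)]
  push_cast
  ring

lemma heatFlow_heatFlow [IsProbabilityMeasure m] {t s r : ℝ} (hts : t ≤ s) (hsr : s ≤ r) :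
    heatFlow d s r (heatFlow d t s m) = heatFlow d t r m := by
  refine Measure.ext_of_charFun ?_
  ext ξ
  rw [charFun_heatFlow hsr, charFun_heatFlow hts, charFun_heatFlow (hts.trans hsr), mul_assoc,
    ← Complex.exp_add]
  congr 2
  ring

lemma heatFlow_self : heatFlow d t t m = m := by simp [heatFlow]

lemma heatFlow_congr {t s t' s' : ℝ} (h : s - t = s' - t') [IsProbabilityMeasure m] :
    heatFlow d t s m = heatFlow d t' s' m := by
  rw [heatFlow_eq_map, heatFlow_eq_map, h]

lemma integrable_norm_pow_stdGaussian (n : ℕ) :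
    Integrable (fun z : Ed d => ‖z‖ ^ n) (stdGaussian (Ed d)) := by
  rcases Nat.eq_zero_or_pos n with rfl | hn
  · simp
  have := (IsGaussian.memLp_id (stdGaussian (Ed d)) n (by simp)).integrable_norm_pow hn.ne'
  simpa using this

lemma MemP.heatFlow (hm : MemP d 2 m) (t s : ℝ) : MemP d 2 (heatFlow d t s m) := by
  have := hm.1
  refine memP_two_iff.2 ⟨inferInstance, ?_⟩
  rw [heatFlow_eq_map, integrable_map_measure (by fun_prop) (by fun_prop)]
  refine ((hm.integrable_norm_sq.comp_fst (stdGaussian (Ed d))).const_mul 2 |>.add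
    (((integrable_norm_pow_stdGaussian 2).comp_snd m).const_mul (2 * √(s - t) ^ 2))).mono'
    (by fun_prop) (ae_of_all _ fun q => ?_)
  have h1 := norm_add_le q.1 (√(s - t) • q.2)
  rw [norm_smul, Real.norm_of_nonneg (Real.sqrt_nonneg _)] at h1
  simp only [Function.comp, norm_pow, norm_norm, Pi.add_apply]
  have h2 : 0 ≤ √(s - t) * ‖q.2‖ := by positivity
  calc ‖q.1 + √(s - t) • q.2‖ ^ 2 ≤ (‖q.1‖ + √(s - t) * ‖q.2‖) ^ 2 := by gcongr
    _ ≤ _ := by nlinarith [sq_nonneg (‖q.1‖ - √(s - t) * ‖q.2‖)]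

lemma integral_heatFlow [IsProbabilityMeasure m] {t s : ℝ} {f : Ed d → ℝ} (hf : Continuous f) :
    ∫ x, f x ∂(heatFlow d t s m) =
      ∫ q, f (q.1 + √(s - t) • q.2) ∂(m.prod (stdGaussian (Ed d))) := by
  rw [heatFlow_eq_map, integral_map (by fun_prop) hf.aestronglyMeasurable]

lemma wdist_heatFlow_le (hm : MemP d 2 m) (hm' : MemP d 2 m') (t s t' s' : ℝ) :
    wdist d 1 (heatFlow d t s m) (heatFlow d t' s' m') ≤ wdist d 1 m m' +
      |√(s - t) - √(s' - t')| * ∫ z, ‖z‖ ∂(stdGaussian (Ed d)) := by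
  have := hm.1
  have := hm'.1
  rw [← sub_le_iff_le_add]
  refine le_of_forall_gt fun η hη => ?_
  obtain ⟨π, hπ, h, hlt⟩ := exists_coupling_of_wdist_one_lt hm.1 hm'.1 hη
  rw [sub_lt_iff_lt_add]
  set γ := stdGaussian (Ed d)
  let S : (Ed d × Ed d) × Ed d → Ed d × Ed d :=
    fun w => (w.1.1 + √(s - t) • w.2, w.1.2 + √(s' - t') • w.2)
  have hS : Measurable S := by fun_prop
  have hP : IsProbabilityMeasure ((π.prod γ).map S) :=
    Measure.isProbabilityMeasure_map hS.aemeasurable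
  have hc : IsCoupling d ((π.prod γ).map S) (heatFlow d t s m) (heatFlow d t' s' m') := by
    constructor
    · rw [Measure.map_map measurable_fst hS, heatFlow_eq_map, ← h.1]
      have := Measure.map_prod_map π γ measurable_fst (measurable_id (α := Ed d))
      rw [Measure.map_id] at this
      rw [this, Measure.map_map (by fun_prop) (by fun_prop)]
      rfl
    · rw [Measure.map_map measurable_snd hS, heatFlow_eq_map, ← h.2]
      have := Measure.map_prod_map π γ measurable_snd (measurable_id (α := Ed d))
      rw [Measure.map_id] at this
      rw [this, Measure.map_map (by fun_prop) (by fun_prop)]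
      rfl
  refine (wdist_one_le hc).trans_lt ?_
  rw [integral_map hS.aemeasurable (by fun_prop)]
  have h1 : Integrable (fun w : (Ed d × Ed d) × Ed d => ‖w.1.1 - w.1.2‖) (π.prod γ) :=
    (h.integrable_dist hm hm').comp_fst γ
  have h2 : Integrable (fun w : (Ed d × Ed d) × Ed d =>
      |√(s - t) - √(s' - t')| * ‖w.2‖) (π.prod γ) := by
    have := (integrable_norm_pow_stdGaussian (d := d) 1).comp_snd π
    simp only [pow_one] at this
    exact this.const_mul _
  refine (integral_mono_of_nonneg (ae_of_all _ fun w => norm_nonneg _) (h1.add h2)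
    (ae_of_all _ fun w => ?_)).trans_lt ?_
  · have e : (S w).1 - (S w).2 = (w.1.1 - w.1.2) + (√(s - t) - √(s' - t')) • w.2 := by
      simp only [S, sub_smul]
      abel
    show ‖(S w).1 - (S w).2‖ ≤ ‖w.1.1 - w.1.2‖ + |√(s - t) - √(s' - t')| * ‖w.2‖
    rw [e]
    refine (norm_add_le _ _).trans_eq ?_
    rw [norm_smul, Real.norm_eq_abs]
  · rw [integral_add' h1 h2, integral_const_mul, integral_fun_fst (fun q : Ed d × Ed d =>
      ‖q.1 - q.2‖), integral_fun_snd (fun z : Ed d => ‖z‖)]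
    simpa [γ] using hlt

lemma MTendsto.heatFlow {ι : Type*} {l : Filter ι} {μ : ι → Measure (Ed d)}
    (h : MTendsto l μ m) (hm : MemP d 2 m) {t s : ι → ℝ} {t₀ s₀ : ℝ}
    (ht : Tendsto t l (𝓝 t₀)) (hs : Tendsto s l (𝓝 s₀)) :
    MTendsto l (fun i => heatFlow d (t i) (s i) (μ i)) (heatFlow d t₀ s₀ m) := by
  refine ⟨h.1.mono fun i hi => hi.heatFlow _ _, ?_⟩
  have h1 : Tendsto (fun i => |√(s₀ - t₀) - √(s i - t i)|) l (𝓝 |√(s₀ - t₀) - √(s₀ - t₀)|) :=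
    (tendsto_const_nhds.sub ((hs.sub ht).sqrt)).abs
  rw [sub_self, abs_zero] at h1
  have h2 := h.2.add (h1.mul_const (∫ z, ‖z‖ ∂(stdGaussian (Ed d))))
  rw [zero_mul, add_zero] at h2
  refine squeeze_zero' (Eventually.of_forall fun i => wdist_nonneg 1) ?_ h2
  filter_upwards [h.1] with i hi
  exact wdist_heatFlow_le hm hi _ _ _ _

end HeatFlow

section Mix

variable {d : ℕ} {m m' : Measure (Ed d)}

/-- The convex combination `(1 - r) m + r m'`. -/
def mix (r : ℝ) (m m' : Measure (Ed d)) : Measure (Ed d) :=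
  (1 - ENNReal.ofReal r) • m + ENNReal.ofReal r • m'

lemma isProbabilityMeasure_mix [IsProbabilityMeasure m] [IsProbabilityMeasure m'] {r : ℝ}
    (hr : r ≤ 1) : IsProbabilityMeasure (mix r m m') := by
  constructor
  have : ENNReal.ofReal r ≤ 1 := by simpa using hr
  simp [mix, tsub_add_cancel_of_le this]

lemma integrable_mix {f : Ed d → ℝ} (hf : Integrable f m) (hf' : Integrable f m') (r : ℝ) :
    Integrable f (mix r m m') :=
  (hf.smul_measure (by simp)).add_measure (hf'.smul_measure (by simp))

lemma integral_mix {f : Ed d → ℝ} (hf : Integrable f m) (hf' : Integrable f m') {r : ℝ}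
    (hr : r ∈ Icc (0 : ℝ) 1) :
    ∫ x, f x ∂(mix r m m') = (1 - r) * ∫ x, f x ∂m + r * ∫ x, f x ∂m' := by
  rw [mix, integral_add_measure (hf.smul_measure (by simp)) (hf'.smul_measure (by simp)),
    integral_smul_measure, integral_smul_measure, ENNReal.toReal_sub_of_le (by simpa using hr.2)
    (by simp), ENNReal.toReal_ofReal hr.1]
  simp

lemma MemP.mix (hm : MemP d 2 m) (hm' : MemP d 2 m') {r : ℝ} (hr : r ≤ 1) :
    MemP d 2 (mix r m m') := by
  have := hm.1
  have := hm'.1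
  exact memP_two_iff.2 ⟨isProbabilityMeasure_mix hr,
    integrable_mix hm.integrable_norm_sq hm'.integrable_norm_sq r⟩

lemma mix_zero : mix 0 m m' = m := by simp [mix]

lemma mix_one : mix 1 m m' = m' := by simp [mix]

lemma one_sub_ofReal {r : ℝ} (hr : 0 ≤ r) :
    (1 - ENNReal.ofReal r) = ENNReal.ofReal (1 - r) := by
  rw [ENNReal.ofReal_sub _ hr, ENNReal.ofReal_one]

lemma mix_comm {r : ℝ} (hr : r ∈ Icc (0 : ℝ) 1) : mix r m m' = mix (1 - r) m' m := by
  rw [mix, mix, one_sub_ofReal hr.1, one_sub_ofReal (by linarith [hr.2]), add_comm]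
  simp

/-- Moving further towards `m'` from a point of the segment `[m, m']`. -/
lemma mix_mix_left {r s : ℝ} (hr : r ∈ Icc (0 : ℝ) 1) (hs : s ∈ Icc (0 : ℝ) 1) :
    mix s (mix r m m') m' = mix (r + s * (1 - r)) m m' := by
  have h1 : 0 ≤ s * (1 - r) := mul_nonneg hs.1 (by linarith [hr.2])
  have h3 : 0 ≤ 1 - s := by linarith [hs.2]
  rw [mix, mix, mix, one_sub_ofReal hr.1, one_sub_ofReal hs.1,
    one_sub_ofReal (by linarith [hr.1]), smul_add, smul_smul, smul_smul, add_assoc, ← add_smul,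
    ← ENNReal.ofReal_mul h3, ← ENNReal.ofReal_mul h3,
    ← ENNReal.ofReal_add (mul_nonneg h3 hr.1) hs.1]
  congr 3 <;> ring

lemma wdist_mix_le (hm : MemP d 2 m) (hm' : MemP d 2 m') {r : ℝ} (hr : r ∈ Icc (0 : ℝ) 1) :
    wdist d 1 m (mix r m m') ≤ r * wdist d 1 m m' := by
  have := hm.1
  have := hm'.1
  have key : ∀ η, wdist d 1 m m' < η → wdist d 1 m (mix r m m') ≤ r * η := by
    intro η hη
    obtain ⟨π, hπ, h, hlt⟩ := exists_coupling_of_wdist_one_lt hm.1 hm'.1 hη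
    have hD : Measurable fun x : Ed d => (x, x) := by fun_prop
    have h1 : ENNReal.ofReal r ≤ 1 := by simpa using hr.2
    have hP1 : IsProbabilityMeasure (m.map fun x => (x, x)) :=
      Measure.isProbabilityMeasure_map hD.aemeasurable
    let ρ := (1 - ENNReal.ofReal r) • (m.map fun x => (x, x)) + ENNReal.ofReal r • π
    have hρ : IsProbabilityMeasure ρ := by
      constructor
      simp [ρ, tsub_add_cancel_of_le h1]
    have hc : IsCoupling d ρ m (mix r m m') := by
      constructor
      · rw [Measure.map_add _ _ measurable_fst, Measure.map_smul, Measure.map_smul,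
          Measure.map_map measurable_fst hD, h.1]
        have : m.map (Prod.fst ∘ fun x : Ed d => (x, x)) = m := Measure.map_id
        rw [this, ← add_smul, tsub_add_cancel_of_le h1, one_smul]
      · rw [Measure.map_add _ _ measurable_snd, Measure.map_smul, Measure.map_smul,
          Measure.map_map measurable_snd hD, h.2]
        have : m.map (Prod.snd ∘ fun x : Ed d => (x, x)) = m := Measure.map_id
        rw [this, mix]
    refine (wdist_one_le hc).trans ?_
    have h2 : Integrable (fun q : Ed d × Ed d => ‖q.1 - q.2‖) (m.map fun x => (x, x)) := by
      rw [integrable_map_measure (by fun_prop) hD.aemeasurable]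
      simp [Function.comp_def]
    rw [integral_add_measure (h2.smul_measure (by simp))
      ((h.integrable_dist hm hm').smul_measure (by simp)), integral_smul_measure,
      integral_smul_measure, integral_map hD.aemeasurable (by fun_prop),
      ENNReal.toReal_ofReal hr.1]
    simpa using mul_le_mul_of_nonneg_left hlt.le hr.1
  have hlim : Tendsto (fun η => r * η) (𝓝[>] (wdist d 1 m m')) (𝓝 (r * wdist d 1 m m')) :=
    (tendsto_id.const_mul r).mono_left nhdsWithin_le_nhds
  exact ge_of_tendsto hlim (eventually_nhdsWithin_of_forall fun η hη => key η hη)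

/-- The segment `r ↦ (1 - r) m + r m'` is continuous for `d₁`. -/
lemma mtendsto_mix (hm : MemP d 2 m) (hm' : MemP d 2 m') {r : ℝ} (hr : r ∈ Icc (0 : ℝ) 1) :
    MTendsto (𝓝[Icc 0 1] r) (fun s => mix s m m') (mix r m m') := by
  refine ⟨eventually_nhdsWithin_of_forall fun s hs => hm.mix hm' hs.2, ?_⟩
  set M := mix r m m'
  have hM : MemP d 2 M := hm.mix hm' hr.2
  have hside : ∀ {n n' : Measure (Ed d)}, MemP d 2 n → MemP d 2 n' → ∀ a s : ℝ, 0 ≤ a → a ≤ s →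
      s ≤ 1 → (1 - a) * wdist d 1 (mix a n n') (mix s n n') ≤
        (s - a) * wdist d 1 (mix a n n') n' := by
    intro n n' hn hn' a s ha has hs
    rcases eq_or_lt_of_le (has.trans hs) with h1 | h1
    · obtain rfl : s = a := by linarith
      simp [h1]
    · have h2 : 0 < 1 - a := by linarith
      have h3 : (s - a) / (1 - a) ∈ Icc (0 : ℝ) 1 :=
        ⟨div_nonneg (by linarith) h2.le, (div_le_one h2).2 (by linarith)⟩
      have h4 := wdist_mix_le (hn.mix hn' (has.trans hs)) hn' h3
      rw [mix_mix_left ⟨ha, has.trans hs⟩ h3, div_mul_cancel₀ _ h2.ne',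
        add_sub_cancel] at h4
      calc _ ≤ (1 - a) * ((s - a) / (1 - a) * wdist d 1 (mix a n n') n') := by gcongr
        _ = _ := by field_simp
  set C := wdist d 1 M m' / (1 - r) + wdist d 1 M m / r with hC
  have hb : ∀ s ∈ Icc (0 : ℝ) 1, wdist d 1 M (mix s m m') ≤ |s - r| * C := by
    intro s hs
    have hC1 : 0 ≤ wdist d 1 M m' / (1 - r) :=
      div_nonneg (wdist_nonneg 1) (by linarith [hr.2])
    have hC2 : 0 ≤ wdist d 1 M m / r := div_nonneg (wdist_nonneg 1) hr.1
    rcases lt_trichotomy s r with h | h | h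
    · have h1 := hside hm' hm (1 - r) (1 - s) (by linarith [hr.2]) (by linarith)
        (by linarith [hs.1])
      rw [← mix_comm hr, ← mix_comm hs] at h1
      have hr0 : 0 < r := by linarith [hs.1]
      have h2 : wdist d 1 M (mix s m m') ≤ (r - s) * (wdist d 1 M m / r) := by
        rw [← mul_div_assoc, le_div_iff₀ hr0]
        linarith
      rw [abs_of_neg (by linarith)]
      nlinarith
    · rw [h, wdist_one_self hM.1, sub_self, abs_zero, zero_mul]
    · have h1 := hside hm hm' r s hr.1 h.le hs.2
      have hr0 : 0 < 1 - r := by linarith [hs.2]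
      have h2 : wdist d 1 M (mix s m m') ≤ (s - r) * (wdist d 1 M m' / (1 - r)) := by
        rw [← mul_div_assoc, le_div_iff₀ hr0]
        linarith
      rw [abs_of_pos (by linarith)]
      nlinarith
  have hlim : Tendsto (fun s => |s - r| * C) (𝓝[Icc 0 1] r) (𝓝 0) := by
    have : Continuous fun s => |s - r| * C := by fun_prop
    have h := this.tendsto r
    simp only [sub_self, abs_zero, zero_mul] at h
    exact h.mono_left nhdsWithin_le_nhds
  exact squeeze_zero' (Eventually.of_forall fun i => wdist_nonneg 1)
    (eventually_nhdsWithin_of_forall hb) hlim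

lemma heatFlow_mix [IsProbabilityMeasure m] [IsProbabilityMeasure m'] {r : ℝ}
    (hr : r ≤ 1) (t s : ℝ) :
    heatFlow d t s (mix r m m') = mix r (heatFlow d t s m) (heatFlow d t s m') := by
  have := isProbabilityMeasure_mix (m := m) (m' := m') hr
  rw [heatFlow_eq_map, heatFlow_eq_map, heatFlow_eq_map, mix, mix, Measure.add_prod,
    Measure.prod_smul_left, Measure.prod_smul_left, Measure.map_add _ _ (by fun_prop),
    Measure.map_smul, Measure.map_smul]

end Mix

section Jets

variable {d : ℕ}

/-- Identification of bilinear forms, in curried form, with 2-multilinear forms. -/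
def hessIso (d : ℕ) :
    (Ed d →L[ℝ] Ed d →L[ℝ] ℝ) ≃ₗᵢ[ℝ] ContinuousMultilinearMap ℝ (fun _ : Fin 2 => Ed d) ℝ :=
  ((continuousMultilinearCurryFin0 ℝ (Ed d) (Ed d →L[ℝ] Ed d →L[ℝ] ℝ)).symm.trans
    (continuousMultilinearCurryRightEquiv' ℝ 0 (Ed d) (Ed d →L[ℝ] ℝ)).symm).trans
    (continuousMultilinearCurryRightEquiv' ℝ 1 (Ed d) ℝ).symm

lemma iteratedFDeriv_two_eq (f : Ed d → ℝ) (x : Ed d) :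
    iteratedFDeriv ℝ 2 f x = hessIso d (fderiv ℝ (fderiv ℝ f) x) := by
  rw [iteratedFDeriv_succ_eq_comp_right, Function.comp_apply, iteratedFDeriv_succ_eq_comp_right,
    Function.comp_apply, iteratedFDeriv_zero_eq_comp]
  rfl

/-- Bilinear forms on `ℝ^d`. -/
abbrev Hess (d : ℕ) : Type := Ed d →L[ℝ] Ed d →L[ℝ] ℝ

instance : NormedAddCommGroup (Hess d) := ContinuousLinearMap.toNormedAddCommGroup
instance : NormedSpace ℝ (Hess d) := ContinuousLinearMap.toNormedSpace
instance : AddCommGroup (Hess d) := NormedAddCommGroup.toAddCommGroup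
instance : AddCommMonoid (Hess d) := AddCommGroup.toAddCommMonoid
instance : CompleteSpace (Hess d) := inferInstance

/-- Values of a function together with its first two derivatives. -/
abbrev Jet (d : ℕ) : Type := ℝ × (Ed d →L[ℝ] ℝ) × Hess d

instance : NormedAddCommGroup (Jet d) := Prod.normedAddCommGroup
instance : NormedSpace ℝ (Jet d) := Prod.normedSpace
instance : CompleteSpace (Jet d) := inferInstance

/-- The second order jet of a function. -/
def jet (f : Ed d → ℝ) (x : Ed d) : Jet d := (f x, fderiv ℝ f x, fderiv ℝ (fderiv ℝ f) x)

lemma norm_jet_le_iff {f : Ed d → ℝ} {x : Ed d} {c : ℝ} :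
    ‖jet f x‖ ≤ c ↔ |f x| ≤ c ∧ ‖fderiv ℝ f x‖ ≤ c ∧ ‖iteratedFDeriv ℝ 2 f x‖ ≤ c := by
  rw [iteratedFDeriv_two_eq, LinearIsometryEquiv.norm_map]
  simp [jet, Prod.norm_def, Real.norm_eq_abs]

lemma dist_jet_lt_iff {f g : Ed d → ℝ} {x y : Ed d} {ε : ℝ} :
    dist (jet f x) (jet g y) < ε ↔ |f x - g y| < ε ∧ ‖fderiv ℝ f x - fderiv ℝ g y‖ < ε ∧
      ‖iteratedFDeriv ℝ 2 f x - iteratedFDeriv ℝ 2 g y‖ < ε := by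
  rw [iteratedFDeriv_two_eq, iteratedFDeriv_two_eq, ← map_sub, LinearIsometryEquiv.norm_map]
  simp [jet, dist_eq_norm]

lemma ContDiff.differentiable_fderiv {f : Ed d → ℝ} (hf : ContDiff ℝ 2 f) :
    Differentiable ℝ (fderiv ℝ f) :=
  (hf.fderiv_right (m := 1) (by norm_num)).differentiable (by norm_num)

lemma ContDiff.continuous_jet {f : Ed d → ℝ} (hf : ContDiff ℝ 2 f) : Continuous (jet f) := by
  have h1 : ContDiff ℝ 1 (fderiv ℝ f) := hf.fderiv_right (by norm_num)
  exact hf.continuous.prodMk (h1.continuous.prodMk (h1.continuous_fderiv (by norm_num)))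

lemma jet_add {f g : Ed d → ℝ} (hf : ContDiff ℝ 2 f) (hg : ContDiff ℝ 2 g) (x : Ed d) :
    jet (fun y => f y + g y) x = jet f x + jet g x := by
  have hf1 := hf.differentiable (by norm_num)
  have hg1 := hg.differentiable (by norm_num)
  have e : fderiv ℝ (fun y => f y + g y) = fun y => fderiv ℝ f y + fderiv ℝ g y := by
    ext1 y
    exact fderiv_fun_add (hf1 y) (hg1 y)
  simp only [jet, e, Prod.mk_add_mk]
  rw [fderiv_fun_add (hf.differentiable_fderiv x) (hg.differentiable_fderiv x)]

lemma jet_const_mul {f : Ed d → ℝ} (hf : ContDiff ℝ 2 f) (c : ℝ) (x : Ed d) :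
    jet (fun y => c * f y) x = c • jet f x := by
  have hf1 := hf.differentiable (by norm_num)
  have e : fderiv ℝ (fun y => c * f y) = fun y => c • fderiv ℝ f y := by
    ext1 y
    exact fderiv_const_mul (hf1 y) c
  simp only [jet, e, Prod.smul_mk, smul_eq_mul]
  rw [fderiv_fun_const_smul (hf.differentiable_fderiv x)]

lemma jet_comp_add_right (f : Ed d → ℝ) (a x : Ed d) :
    jet (fun y => f (y + a)) x = jet f (x + a) := by
  have e : fderiv ℝ (fun y => f (y + a)) = fun y => fderiv ℝ f (y + a) := by
    ext1 y
    exact fderiv_comp_add_right a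
  simp only [jet, e]
  rw [fderiv_comp_add_right a]

/-- Trace of a bilinear form. -/
def lap (d : ℕ) (A : Ed d →L[ℝ] Ed d →L[ℝ] ℝ) : ℝ :=
  ∑ i : Fin d, A (EuclideanSpace.single i (1:ℝ)) (EuclideanSpace.single i (1:ℝ))

lemma lapl_eq (f : Ed d → ℝ) (x : Ed d) : lapl d f x = lap d (jet f x).2.2 := by
  simp [lapl, lap, jet, iteratedFDeriv_two_apply]

lemma continuous_lap : Continuous (lap d) := by
  unfold lap
  fun_prop

lemma abs_lap_le (A : Ed d →L[ℝ] Ed d →L[ℝ] ℝ) : |lap d A| ≤ d * ‖A‖ := by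
  calc |lap d A| ≤ ∑ i : Fin d,
        |A (EuclideanSpace.single i (1:ℝ)) (EuclideanSpace.single i (1:ℝ))| :=
        Finset.abs_sum_le_sum_abs _ _
    _ ≤ ∑ _i : Fin d, ‖A‖ := by
        refine Finset.sum_le_sum fun i _ => ?_
        simpa using A.le_opNorm₂ (EuclideanSpace.single i (1:ℝ)) (EuclideanSpace.single i (1:ℝ))
    _ = d * ‖A‖ := by simp

lemma norm_hess_le_jet (f : Ed d → ℝ) (x : Ed d) : ‖(jet f x).2.2‖ ≤ ‖jet f x‖ :=
  (norm_snd_le _).trans (norm_snd_le _)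

section Parametric

variable {Ω : Type*} [MeasurableSpace Ω] {ν : Measure Ω}

lemma hasFDerivAt_integral_of_linear_growth {H : Type*} [NormedAddCommGroup H] [NormedSpace ℝ H]
    {G : Ω → Ed d → H} {g : Ω → ℝ} (hG : ∀ ω, Differentiable ℝ (G ω))
    (hm : ∀ x, AEStronglyMeasurable (fun ω => G ω x) ν)
    (hm' : ∀ x, AEStronglyMeasurable (fun ω => fderiv ℝ (G ω) x) ν) (hg : Integrable g ν)
    (hb : ∀ ω x, ‖G ω x‖ ≤ g ω * (1 + ‖x‖)) (hb' : ∀ ω x, ‖fderiv ℝ (G ω) x‖ ≤ g ω * (1 + ‖x‖))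
    (x : Ed d) : HasFDerivAt (fun y => ∫ ω, G ω y ∂ν) (∫ ω, fderiv ℝ (G ω) x ∂ν) x := by
  have hg0 : ∀ ω, 0 ≤ g ω := fun ω => by simpa using (norm_nonneg _).trans (hb ω 0)
  refine hasFDerivAt_integral_of_dominated_of_fderiv_le (bound := fun ω => g ω * (2 + ‖x‖))
    (F' := fun x ω => fderiv ℝ (G ω) x)
    (Metric.ball_mem_nhds x one_pos) (Eventually.of_forall hm) ?_ (hm' x) ?_ ?_ ?_
  · exact (hg.mul_const (1 + ‖x‖)).mono' (hm x) (ae_of_all _ fun ω => hb ω x)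
  · refine ae_of_all _ fun ω y hy => (hb' ω y).trans ?_
    have : ‖y‖ ≤ 1 + ‖x‖ := by
      have := norm_le_norm_add_norm_sub x y
      have h2 := mem_ball_iff_norm'.1 hy
      linarith
    exact mul_le_mul_of_nonneg_left (by linarith) (hg0 ω)
  · exact hg.mul_const _
  · exact ae_of_all _ fun ω y _ => (hG ω y).hasFDerivAt

lemma contDiff_two_integral {K : Ω → Ed d → ℝ} {g : Ω → ℝ} (hK : ∀ ω, ContDiff ℝ 2 (K ω))
    (hm : ∀ x, AEStronglyMeasurable (fun ω => jet (K ω) x) ν) (hg : Integrable g ν)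
    (hb : ∀ ω x, ‖jet (K ω) x‖ ≤ g ω * (1 + ‖x‖)) :
    ContDiff ℝ 2 (fun x => ∫ ω, K ω x ∂ν) ∧
      ∀ x, jet (fun y => ∫ ω, K ω y ∂ν) x = ∫ ω, jet (K ω) x ∂ν := by
  have hg0 : ∀ ω, 0 ≤ g ω := fun ω => by simpa using (norm_nonneg _).trans (hb ω 0)
  have hi : ∀ x, Integrable (fun ω => jet (K ω) x) ν := fun x =>
    (hg.mul_const (1 + ‖x‖)).mono' (hm x) (ae_of_all _ fun ω => hb ω x)
  have d1 := hasFDerivAt_integral_of_linear_growth (G := K)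
    (fun ω => (hK ω).differentiable (by norm_num)) (fun x => (hm x).fst)
    (fun x => (hm x).snd.fst) hg
    (fun ω x => (norm_fst_le _).trans (hb ω x))
    (fun ω x => ((norm_fst_le _).trans (norm_snd_le _)).trans (hb ω x))
  have d2 := hasFDerivAt_integral_of_linear_growth (G := fun ω => fderiv ℝ (K ω))
    (fun ω => (hK ω).differentiable_fderiv) (fun x => (hm x).snd.fst)
    (fun x => (hm x).snd.snd) hg
    (fun ω x => ((norm_fst_le _).trans (norm_snd_le _)).trans (hb ω x))
    (fun ω x => ((norm_snd_le _).trans (norm_snd_le _)).trans (hb ω x))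
  have e1 : fderiv ℝ (fun y => ∫ ω, K ω y ∂ν) = fun x => ∫ ω, fderiv ℝ (K ω) x ∂ν := by
    ext1 x
    exact (d1 x).fderiv
  have e2 : fderiv ℝ (fun x => ∫ ω, fderiv ℝ (K ω) x ∂ν)
      = fun x => ∫ ω, fderiv ℝ (fderiv ℝ (K ω)) x ∂ν := by
    ext1 x
    exact (d2 x).fderiv
  refine ⟨?_, fun x => ?_⟩
  · rw [show (2 : WithTop ℕ∞) = 1 + 1 by norm_num, contDiff_succ_iff_fderiv, e1]
    refine ⟨fun x => (d1 x).differentiableAt, by simp, ?_⟩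
    rw [contDiff_one_iff_fderiv, e2]
    refine ⟨fun x => (d2 x).differentiableAt, continuous_iff_continuousAt.2 fun x => ?_⟩
    refine continuousAt_of_dominated (bound := fun ω => g ω * (2 + ‖x‖))
      (Eventually.of_forall fun y => (hm y).snd.snd) ?_ (hg.mul_const _) ?_
    · filter_upwards [Metric.ball_mem_nhds x one_pos] with y hy
      refine ae_of_all _ fun ω => ?_
      refine (((norm_snd_le _).trans (norm_snd_le _)).trans (hb ω y)).trans ?_
      have : ‖y‖ ≤ 1 + ‖x‖ := by
        have := norm_le_norm_add_norm_sub x y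
        have h2 := mem_ball_iff_norm'.1 hy
        linarith
      exact mul_le_mul_of_nonneg_left (by linarith) (hg0 ω)
    · exact ae_of_all _ fun ω => ((hK ω).continuous_jet.snd.snd).continuousAt
  · refine Prod.ext ?_ (Prod.ext ?_ ?_)
    · exact (fst_integral (hi x)).symm
    · rw [snd_integral (hi x), fst_integral (hi x).snd]
      exact (d1 x).fderiv
    · rw [snd_integral (hi x), snd_integral (hi x).snd]
      simp only [jet, e1, e2]

end Parametric

end Jets

section ValueFunction

open ProbabilityTheory

variable {d : ℕ} {T t₁ : ℝ} {m : Measure (Ed d)} {ι : Type*} {l : Filter ι}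
  {t : ι → ℝ} {t₀ : ℝ} {μ : ι → Measure (Ed d)} {x : ι → Ed d} {x₀ : Ed d}

lemma ContD1.tendsto {u : ℝ → Measure (Ed d) → ℝ} (hu : ContD1 d T u) (ht₀ : t₀ ∈ Icc 0 T)
    (hm : MemP d 2 m) (ht : Tendsto t l (𝓝 t₀)) (htm : ∀ᶠ i in l, t i ∈ Icc 0 T)
    (hμ : MTendsto l μ m) : Tendsto (fun i => u (t i) (μ i)) l (𝓝 (u t₀ m)) := by
  refine Metric.tendsto_nhds.2 fun ε hε => ?_
  obtain ⟨η, hη, h⟩ := hu t₀ ht₀ m hm ε hε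
  filter_upwards [Metric.tendsto_nhds.1 ht η hη, htm, hμ.1, hμ.2.eventually_lt_const hη]
    with i h1 h2 h3 h4
  exact h _ h2 _ h3 h1 h4

lemma A1Data.tendsto_jet (FD : A1Data d T) (ht₀ : t₀ ∈ Icc 0 T)
    (hm : MemP d 2 m) (ht : Tendsto t l (𝓝 t₀)) (htm : ∀ᶠ i in l, t i ∈ Icc 0 T)
    (hμ : MTendsto l μ m) (hx : Tendsto x l (𝓝 x₀)) :
    Tendsto (fun i => jet (FD.δF (t i) (μ i)) (x i)) l (𝓝 (jet (FD.δF t₀ m) x₀)) := by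
  refine Metric.tendsto_nhds.2 fun ε hε => ?_
  obtain ⟨η, hη, h⟩ := FD.contDeriv t₀ ht₀ m hm x₀ ε hε
  filter_upwards [Metric.tendsto_nhds.1 ht η hη, htm, hμ.1, hμ.2.eventually_lt_const hη,
    Metric.tendsto_nhds.1 hx η hη] with i h1 h2 h3 h4 h5
  exact dist_jet_lt_iff.2 (h _ h2 _ h3 _ h1 h4 (by rwa [← dist_eq_norm]))

lemma A2Data.tendsto_ψ (ΨD : A2Data d) (hm : MemP d 2 m) (hμ : MTendsto l μ m) :
    Tendsto (fun i => ΨD.ψ (μ i)) l (𝓝 (ΨD.ψ m)) := by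
  refine Metric.tendsto_nhds.2 fun ε hε => ?_
  obtain ⟨η, hη, h⟩ := ΨD.contψ m hm ε hε
  filter_upwards [hμ.1, hμ.2.eventually_lt_const hη] with i h3 h4
  exact h _ h3 h4

lemma A2Data.tendsto_jet (ΨD : A2Data d) (hm : MemP d 2 m)
    (hμ : MTendsto l μ m) (hx : Tendsto x l (𝓝 x₀)) :
    Tendsto (fun i => jet (ΨD.δψ (μ i)) (x i)) l (𝓝 (jet (ΨD.δψ m) x₀)) := by
  refine Metric.tendsto_nhds.2 fun ε hε => ?_
  obtain ⟨η, hη, h⟩ := ΨD.contDeriv m hm x₀ ε hε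
  filter_upwards [hμ.1, hμ.2.eventually_lt_const hη,
    Metric.tendsto_nhds.1 hx η hη] with i h3 h4 h5
  exact dist_jet_lt_iff.2 (h _ h3 _ h4 (by rwa [← dist_eq_norm]))

/-- Affine parametrisation of `[t, t₁]` by the unit interval. -/
def interp (t₁ t : ℝ) (θ : unitInterval) : ℝ := t + θ * (t₁ - t)

lemma interp_mem (ht₀ : t₀ ∈ Icc 0 t₁) (θ : unitInterval) : interp t₁ t₀ θ ∈ Icc t₀ t₁ := by
  have h1 : 0 ≤ t₁ - t₀ := by linarith [ht₀.2]
  constructor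
  · have := mul_nonneg θ.2.1 h1
    simp only [interp]; linarith
  · have := mul_le_mul_of_nonneg_right θ.2.2 h1
    simp only [interp]; linarith

lemma interp_mem' (ht₁ : t₁ ∈ Icc 0 T) (ht₀ : t₀ ∈ Icc 0 t₁) (θ : unitInterval) :
    interp t₁ t₀ θ ∈ Icc 0 T :=
  ⟨ht₀.1.trans (interp_mem ht₀ θ).1, (interp_mem ht₀ θ).2.trans ht₁.2⟩

lemma tendsto_interp {θ : ι → unitInterval} {θ₀ : unitInterval} (ht : Tendsto t l (𝓝 t₀))
    (hθ : Tendsto θ l (𝓝 θ₀)) :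
    Tendsto (fun i => interp t₁ (t i) (θ i)) l (𝓝 (interp t₁ t₀ θ₀)) :=
  ht.add (((continuous_subtype_val.tendsto _).comp hθ).mul (tendsto_const_nhds.sub ht))

/-- The probability space carrying the uniform time and the Gaussian increment. -/
def kernMeasure (d : ℕ) : Measure (unitInterval × Ed d) :=
  (volume : Measure unitInterval).prod (stdGaussian (Ed d))

instance : IsProbabilityMeasure (kernMeasure d) := by unfold kernMeasure; infer_instance

variable (FD : A1Data d T) (ΨD : A2Data d)

/-- The integrand in the representation of the linear derivative of `valueFn`. -/
def kern (t₁ t : ℝ) (m : Measure (Ed d)) (ω : unitInterval × Ed d) (x : Ed d) : ℝ :=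
  ΨD.δψ (heatFlow d t t₁ m) (x + √(t₁ - t) • ω.2) +
    (t₁ - t) * FD.δF (interp t₁ t ω.1) (heatFlow d t (interp t₁ t ω.1) m)
      (x + √(interp t₁ t ω.1 - t) • ω.2)

/-- The candidate solution `φ(t,m) = ψ(p^{t,m}_{t₁}) + ∫_t^{t₁} F(r, p^{t,m}_r) dr`, with the
integral parametrised by the unit interval. -/
def valueFn (t₁ t : ℝ) (m : Measure (Ed d)) : ℝ :=
  ΨD.ψ (heatFlow d t t₁ m) +
    (t₁ - t) * ∫ θ, FD.F (interp t₁ t θ) (heatFlow d t (interp t₁ t θ) m) ∂volume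

/-- The linear derivative of `valueFn`. -/
def valueDeriv (t₁ t : ℝ) (m : Measure (Ed d)) (x : Ed d) : ℝ :=
  ∫ ω, kern FD ΨD t₁ t m ω x ∂(kernMeasure d)

variable {FD ΨD}

lemma contDiff_kern (ht₁ : t₁ ∈ Icc 0 T) (ht₀ : t₀ ∈ Icc 0 t₁) (hm : MemP d 2 m)
    (ω : unitInterval × Ed d) : ContDiff ℝ 2 (kern FD ΨD t₁ t₀ m ω) := by
  have h1 := ΨD.smoothX _ (hm.heatFlow t₀ t₁)
  have h2 := FD.smoothX _ (interp_mem' ht₁ ht₀ ω.1) _ (hm.heatFlow t₀ (interp t₁ t₀ ω.1))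
  unfold kern
  fun_prop

lemma jet_kern (ht₁ : t₁ ∈ Icc 0 T) (ht₀ : t₀ ∈ Icc 0 t₁) (hm : MemP d 2 m)
    (ω : unitInterval × Ed d) (x : Ed d) : jet (kern FD ΨD t₁ t₀ m ω) x =
    jet (ΨD.δψ (heatFlow d t₀ t₁ m)) (x + √(t₁ - t₀) • ω.2) +
    (t₁ - t₀) • jet (FD.δF (interp t₁ t₀ ω.1) (heatFlow d t₀ (interp t₁ t₀ ω.1) m))
      (x + √(interp t₁ t₀ ω.1 - t₀) • ω.2) := by
  have h1 := ΨD.smoothX _ (hm.heatFlow t₀ t₁)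
  have h2 := FD.smoothX _ (interp_mem' ht₁ ht₀ ω.1) _ (hm.heatFlow t₀ (interp t₁ t₀ ω.1))
  unfold kern
  rw [jet_add (by fun_prop) (by fun_prop), jet_const_mul (by fun_prop), jet_comp_add_right,
    jet_comp_add_right]

lemma tendsto_jet_kern (ht₁ : t₁ ∈ Icc 0 T) (ht₀ : t₀ ∈ Icc 0 t₁) (hm : MemP d 2 m)
    {ω : ι → unitInterval × Ed d} {ω₀ : unitInterval × Ed d}
    (ht : Tendsto t l (𝓝 t₀)) (htm : ∀ᶠ i in l, t i ∈ Icc 0 t₁)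
    (hμ : MTendsto l μ m) (hx : Tendsto x l (𝓝 x₀)) (hω : Tendsto ω l (𝓝 ω₀)) :
    Tendsto (fun i => jet (kern FD ΨD t₁ (t i) (μ i) (ω i)) (x i)) l
      (𝓝 (jet (kern FD ΨD t₁ t₀ m ω₀) x₀)) := by
  have hω1 := (continuous_fst.tendsto _).comp hω
  have hω2 := (continuous_snd.tendsto _).comp hω
  have hs := tendsto_interp (t₁ := t₁) ht hω1
  have e : (fun i => jet (kern FD ΨD t₁ (t i) (μ i) (ω i)) (x i)) =ᶠ[l] fun i =>
      jet (ΨD.δψ (heatFlow d (t i) t₁ (μ i))) (x i + √(t₁ - t i) • (ω i).2) +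
      (t₁ - t i) • jet (FD.δF (interp t₁ (t i) (ω i).1)
        (heatFlow d (t i) (interp t₁ (t i) (ω i).1) (μ i)))
      (x i + √(interp t₁ (t i) (ω i).1 - t i) • (ω i).2) := by
    filter_upwards [htm, hμ.1] with i h1 h2
    exact jet_kern ht₁ h1 h2 _ _
  rw [tendsto_congr' e, jet_kern ht₁ ht₀ hm]
  refine (ΨD.tendsto_jet (hm.heatFlow _ _) (hμ.heatFlow hm ht tendsto_const_nhds)
    (hx.add (((Real.continuous_sqrt.tendsto _).comp (tendsto_const_nhds.sub ht)).smul hω2))).add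
    ((tendsto_const_nhds.sub ht).smul ?_)
  refine FD.tendsto_jet (interp_mem' ht₁ ht₀ _) (hm.heatFlow _ _) hs
    (htm.mono fun i hi => interp_mem' ht₁ hi _) (hμ.heatFlow hm ht hs)
    (hx.add (((Real.continuous_sqrt.tendsto _).comp (hs.sub ht)).smul hω2))

lemma continuous_jet_kern (ht₁ : t₁ ∈ Icc 0 T) (ht₀ : t₀ ∈ Icc 0 t₁) (hm : MemP d 2 m)
    (x : Ed d) :
    Continuous fun ω => jet (kern FD ΨD t₁ t₀ m ω) x :=
  continuous_iff_continuousAt.2 fun _ => tendsto_jet_kern ht₁ ht₀ hm tendsto_const_nhds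
    (Eventually.of_forall fun _ => ht₀) (mtendsto_const hm) tendsto_const_nhds tendsto_id

lemma continuous_source (ht₁ : t₁ ∈ Icc 0 T) (ht₀ : t₀ ∈ Icc 0 t₁) (hm : MemP d 2 m) :
    Continuous fun θ : unitInterval =>
    FD.F (interp t₁ t₀ θ) (heatFlow d t₀ (interp t₁ t₀ θ) m) :=
  continuous_iff_continuousAt.2 fun θ => by
    have hs := tendsto_interp (t₁ := t₁) (l := 𝓝 θ) (tendsto_const_nhds (x := t₀)) tendsto_id
    exact FD.contF.tendsto (interp_mem' ht₁ ht₀ _) (hm.heatFlow _ _) hs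
      (Eventually.of_forall fun _ => interp_mem' ht₁ ht₀ _)
      ((mtendsto_const hm).heatFlow hm tendsto_const_nhds hs)

variable (FD ΨD) in
lemma exists_kern_bound (ht₁ : t₁ ∈ Icc 0 T) : ∃ C, 0 ≤ C ∧ ∀ t ∈ Icc 0 t₁,
    ∀ m : Measure (Ed d), MemP d 2 m → ∀ (ω : unitInterval × Ed d) (x : Ed d),
      ‖jet (kern FD ΨD t₁ t m ω) x‖ ≤ C * (1 + ‖ω.2‖) * (1 + ‖x‖) := by
  obtain ⟨a, ha⟩ := FD.bddDeriv
  obtain ⟨b, hb⟩ := ΨD.derivGrowth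
  refine ⟨|b| * (1 + √T) + T * |a|, by have := ht₁.1.trans ht₁.2; positivity,
    fun t ht m hm ω x => ?_⟩
  rw [jet_kern ht₁ ht hm]
  set r := interp t₁ t ω.1
  set y := x + √(t₁ - t) • ω.2
  have h1 : ‖jet (ΨD.δψ (heatFlow d t t₁ m)) y‖ ≤ b * (1 + ‖y‖) :=
    norm_jet_le_iff.2 (hb _ (hm.heatFlow _ _) _)
  have h2 : ‖jet (FD.δF r (heatFlow d t r m)) (x + √(r - t) • ω.2)‖ ≤ a :=
    norm_jet_le_iff.2 (ha _ (interp_mem' ht₁ ht _) _ (hm.heatFlow _ _) _)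
  have hy : ‖y‖ ≤ ‖x‖ + √T * ‖ω.2‖ := by
    refine (norm_add_le _ _).trans (add_le_add le_rfl ?_)
    rw [norm_smul, Real.norm_of_nonneg (Real.sqrt_nonneg _)]
    gcongr
    linarith [ht.1, ht₁.2]
  have hs := Real.sqrt_nonneg T
  have hT : 0 ≤ T := ht₁.1.trans ht₁.2
  have ht' : 0 ≤ t₁ - t := by linarith [ht.2]
  have ht'' : t₁ - t ≤ T := by linarith [ht.1, ht₁.2]
  have hz := norm_nonneg ω.2
  have hx := norm_nonneg x
  calc _ ≤ |b| * (1 + ‖y‖) + (t₁ - t) * |a| := by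
        refine (norm_add_le _ _).trans (add_le_add (h1.trans ?_) ?_)
        · gcongr; exact le_abs_self b
        · rw [norm_smul, Real.norm_of_nonneg ht']
          gcongr
          exact h2.trans (le_abs_self a)
    _ ≤ |b| * ((1 + √T) * ((1 + ‖ω.2‖) * (1 + ‖x‖))) + T * (|a| * ((1 + ‖ω.2‖) * (1 + ‖x‖))) := by
        gcongr
        · refine (add_le_add le_rfl hy).trans ?_
          nlinarith [mul_nonneg hz hx, mul_nonneg hs hz, mul_nonneg hs hx,
            mul_nonneg hs (mul_nonneg hz hx)]
        · refine le_mul_of_one_le_right (abs_nonneg a) ?_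
          nlinarith [mul_nonneg hz hx]
    _ = _ := by ring

lemma integrable_kernMeasure (C : ℝ) :
    Integrable (fun ω : unitInterval × Ed d => C * (1 + ‖ω.2‖)) (kernMeasure d) := by
  refine Integrable.const_mul ((integrable_const _).add ?_) C
  have := integrable_norm_pow_stdGaussian (d := d) 1
  simp only [pow_one] at this
  exact this.comp_snd _

lemma contDiff_valueDeriv (ht₁ : t₁ ∈ Icc 0 T) (ht₀ : t₀ ∈ Icc 0 t₁) (hm : MemP d 2 m) :
    ContDiff ℝ 2 (valueDeriv FD ΨD t₁ t₀ m) ∧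
    ∀ x, jet (valueDeriv FD ΨD t₁ t₀ m) x =
      ∫ ω, jet (kern FD ΨD t₁ t₀ m ω) x ∂(kernMeasure d) := by
  obtain ⟨C, -, hC⟩ := exists_kern_bound FD ΨD ht₁
  exact contDiff_two_integral (fun ω => contDiff_kern ht₁ ht₀ hm ω)
    (fun x => (continuous_jet_kern ht₁ ht₀ hm x).aestronglyMeasurable)
    (integrable_kernMeasure C) (hC t₀ ht₀ m hm)

lemma tendsto_jet_valueDeriv (ht₁ : t₁ ∈ Icc 0 T) (ht₀ : t₀ ∈ Icc 0 t₁) (hm : MemP d 2 m)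
    [l.IsCountablyGenerated]
    (ht : Tendsto t l (𝓝 t₀)) (htm : ∀ᶠ i in l, t i ∈ Icc 0 t₁)
    (hμ : MTendsto l μ m) (hx : Tendsto x l (𝓝 x₀)) :
    Tendsto (fun i => jet (valueDeriv FD ΨD t₁ (t i) (μ i)) (x i)) l
      (𝓝 (jet (valueDeriv FD ΨD t₁ t₀ m) x₀)) := by
  obtain ⟨C, hC0, hC⟩ := exists_kern_bound FD ΨD ht₁
  have e : (fun i => jet (valueDeriv FD ΨD t₁ (t i) (μ i)) (x i)) =ᶠ[l] fun i =>
      ∫ ω, jet (kern FD ΨD t₁ (t i) (μ i) ω) (x i) ∂(kernMeasure d) := by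
    filter_upwards [htm, hμ.1] with i h1 h2
    exact (contDiff_valueDeriv ht₁ h1 h2).2 _
  rw [tendsto_congr' e, (contDiff_valueDeriv ht₁ ht₀ hm).2]
  refine tendsto_integral_filter_of_dominated_convergence
    (fun ω => C * (1 + ‖ω.2‖) * (2 + ‖x₀‖)) ?_ ?_
    ((integrable_kernMeasure C).mul_const _) (ae_of_all _ fun ω =>
      tendsto_jet_kern ht₁ ht₀ hm ht htm hμ hx tendsto_const_nhds)
  · filter_upwards [htm, hμ.1] with i h1 h2
    exact (continuous_jet_kern ht₁ h1 h2 _).aestronglyMeasurable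
  · filter_upwards [htm, hμ.1, hx.norm.eventually_le_const (u := 1 + ‖x₀‖) (by linarith)]
      with i h1 h2 h3
    exact ae_of_all _ fun ω => (hC _ h1 _ h2 _ _).trans
      (mul_le_mul_of_nonneg_left (by linarith) (by positivity))

lemma tendsto_valueFn (ht₁ : t₁ ∈ Icc 0 T) (ht₀ : t₀ ∈ Icc 0 t₁) (hm : MemP d 2 m)
    [l.IsCountablyGenerated]
    (ht : Tendsto t l (𝓝 t₀)) (htm : ∀ᶠ i in l, t i ∈ Icc 0 t₁) (hμ : MTendsto l μ m) :
    Tendsto (fun i => valueFn FD ΨD t₁ (t i) (μ i)) l (𝓝 (valueFn FD ΨD t₁ t₀ m)) := by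
  obtain ⟨c, hc⟩ := FD.bddF
  refine (ΨD.tendsto_ψ (hm.heatFlow _ _) (hμ.heatFlow hm ht tendsto_const_nhds)).add
    ((tendsto_const_nhds.sub ht).mul ?_)
  refine tendsto_integral_filter_of_dominated_convergence (fun _ => c) ?_ ?_
    (integrable_const _) (ae_of_all _ fun θ => ?_)
  · filter_upwards [htm, hμ.1] with i h1 h2
    exact (continuous_source ht₁ h1 h2).aestronglyMeasurable
  · filter_upwards [htm, hμ.1] with i h1 h2
    exact ae_of_all _ fun θ => hc _ (interp_mem' ht₁ h1 θ) _ (h2.heatFlow _ _)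
  · have hs := tendsto_interp (t₁ := t₁) ht (tendsto_const_nhds (x := θ))
    exact FD.contF.tendsto (interp_mem' ht₁ ht₀ _) (hm.heatFlow _ _) hs
      (htm.mono fun i hi => interp_mem' ht₁ hi _) (hμ.heatFlow hm ht hs)

variable (FD ΨD) in
lemma exists_valueDeriv_bound (ht₁ : t₁ ∈ Icc 0 T) : ∃ C, 0 ≤ C ∧ ∀ t ∈ Icc 0 t₁,
    ∀ m : Measure (Ed d), MemP d 2 m → ∀ x : Ed d,
      ‖jet (valueDeriv FD ΨD t₁ t m) x‖ ≤ C * (1 + ‖x‖) := by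
  obtain ⟨C, hC0, hC⟩ := exists_kern_bound FD ΨD ht₁
  refine ⟨∫ ω : unitInterval × Ed d, C * (1 + ‖ω.2‖) ∂(kernMeasure d),
    integral_nonneg fun _ => by positivity, fun t ht m hm x => ?_⟩
  rw [(contDiff_valueDeriv ht₁ ht hm).2, ← integral_mul_const]
  exact norm_integral_le_of_norm_le ((integrable_kernMeasure C).mul_const _)
    (ae_of_all _ fun ω => hC t ht m hm ω x)

end ValueFunction

section Segment

open ProbabilityTheory

variable {d : ℕ} {m m' : Measure (Ed d)}

/-- Mean value inequality along the segment `[m, m']` for a function with a linear derivative. -/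
lemma abs_sub_sub_le_of_segment {g : Measure (Ed d) → ℝ} {δg : Measure (Ed d) → Ed d → ℝ}
    (hc : ∀ M, MemP d 2 M → ∀ (l : Filter ℝ) (μ : ℝ → Measure (Ed d)), l.IsCountablyGenerated →
      MTendsto l μ M → Tendsto (fun i => g (μ i)) l (𝓝 (g M)))
    (hd : ∀ M, MemP d 2 M → ∀ M', MemP d 2 M' →
      Tendsto (fun r => (g (mix r M M') - g M) / r) (𝓝[>] 0) (𝓝 (∫ x, δg M x ∂M')))
    (hn : ∀ M, MemP d 2 M → ∫ x, δg M x ∂M = 0)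
    (hi : ∀ M, MemP d 2 M → ∀ M', MemP d 2 M' → Integrable (δg M) M')
    (hm : MemP d 2 m) (hm' : MemP d 2 m') {c B : ℝ}
    (h : ∀ r ∈ Ico (0 : ℝ) 1,
      |∫ x, δg (mix r m m') x ∂m' - ∫ x, δg (mix r m m') x ∂m - c| ≤ B) :
    |g m' - g m - c| ≤ B := by
  have hmem : ∀ r ∈ Icc (0 : ℝ) 1, MemP d 2 (mix r m m') := fun r hr => hm.mix hm' hr.2
  have key := norm_image_sub_le_of_norm_deriv_right_le_segment
    (f := fun r => g (mix r m m') - r * c) (a := 0) (b := 1) (C := B)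
    (f' := fun r => ∫ x, δg (mix r m m') x ∂m' - ∫ x, δg (mix r m m') x ∂m - c) ?_ ?_
    (fun r hr => h r hr) 1 (right_mem_Icc.2 zero_le_one)
  · simp only [mix_one, mix_zero, Real.norm_eq_abs] at key
    calc _ = |g m' - 1 * c - (g m - 0 * c)| := by ring_nf
      _ ≤ _ := key
      _ = B := by ring
  · intro r hr
    exact (hc _ (hmem r hr) _ _ inferInstance (mtendsto_mix hm hm' hr)).sub
      ((continuous_id.mul continuous_const).continuousWithinAt (s := Icc 0 1))
  · intro r hr
    have hr' : r ∈ Icc (0 : ℝ) 1 := Ico_subset_Icc_self hr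
    have hr1 : 0 < 1 - r := by linarith [hr.2]
    set M := mix r m m'
    have hM : MemP d 2 M := hmem r hr'
    have e0 : (1 - r) * ∫ x, δg M x ∂m + r * ∫ x, δg M x ∂m' = 0 := by
      rw [← integral_mix (hi M hM m hm) (hi M hM m' hm') hr']
      exact hn M hM
    have e1 : ∫ x, δg M x ∂m' - ∫ x, δg M x ∂m = (∫ x, δg M x ∂m') * (1 - r)⁻¹ := by
      field_simp
      linarith
    rw [e1]
    refine HasDerivWithinAt.sub ?_ ?_
    · rw [← hasDerivWithinAt_Ioi_iff_Ici, hasDerivWithinAt_iff_tendsto_slope' (by simp)]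
      have ht : Tendsto (fun y => (y - r) * (1 - r)⁻¹) (𝓝[>] r) (𝓝[>] 0) := by
        refine tendsto_nhdsWithin_iff.2 ⟨?_, ?_⟩
        · have : Continuous fun y => (y - r) * (1 - r)⁻¹ := by fun_prop
          simpa using (this.tendsto r).mono_left nhdsWithin_le_nhds
        · filter_upwards [self_mem_nhdsWithin] with y hy
          exact mul_pos (sub_pos.2 hy) (inv_pos.2 hr1)
      have := ((hd M hM m' hm').comp ht).mul_const (1 - r)⁻¹
      refine this.congr' ?_
      filter_upwards [Ioo_mem_nhdsGT hr.2] with y hy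
      have hy0 : 0 < y - r := sub_pos.2 hy.1
      have hs : (y - r) * (1 - r)⁻¹ ∈ Icc (0 : ℝ) 1 := by
        refine ⟨by positivity, ?_⟩
        rw [← div_eq_mul_inv, div_le_one hr1]
        linarith [hy.2]
      have e2 : r + (y - r) * (1 - r)⁻¹ * (1 - r) = y := by field_simp; ring
      simp only [Function.comp_apply, slope_def_field, M]
      rw [mix_mix_left hr' hs, e2]
      field_simp
    · simpa using (hasDerivAt_id r).hasDerivWithinAt.mul_const c

end Segment

section MeasureDerivative

open ProbabilityTheory

variable {d : ℕ} {T t₁ t : ℝ} {m m' : Measure (Ed d)} {FD : A1Data d T} {ΨD : A2Data d}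

lemma A1Data.integrable_δF (FD : A1Data d T) {t : ℝ} (ht : t ∈ Icc 0 T) (hm : MemP d 2 m)
    (hm' : MemP d 2 m') : Integrable (FD.δF t m) m' := by
  obtain ⟨c, hc⟩ := FD.bddDeriv
  have := hm'.1
  exact (integrable_const c).mono' (FD.smoothX t ht m hm).continuous.aestronglyMeasurable
    (ae_of_all _ fun x => (hc t ht m hm x).1)

lemma A1Data.abs_sub_mix_le (FD : A1Data d T) : ∃ c, ∀ t ∈ Icc 0 T, ∀ m m' : Measure (Ed d),
    MemP d 2 m → MemP d 2 m' → ∀ r ∈ Icc (0 : ℝ) 1,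
      |FD.F t (mix r m m') - FD.F t m| ≤ r * c := by
  obtain ⟨c, hc⟩ := FD.bddDeriv
  refine ⟨2 * c, fun t ht m m' hm hm' r hr => ?_⟩
  have := hm.1
  have := hm'.1
  have hM : MemP d 2 (mix r m m') := hm.mix hm' hr.2
  have bound : ∀ M, MemP d 2 M → ∀ M', MemP d 2 M' → |∫ x, FD.δF t M x ∂M'| ≤ c := by
    intro M hM M' hM'
    have := hM'.1
    simpa using norm_integral_le_of_norm_le_const (μ := M') (f := FD.δF t M) (C := c)
      (ae_of_all _ fun x => (hc t ht M hM x).1)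
  have := abs_sub_sub_le_of_segment (g := FD.F t) (δg := FD.δF t) (c := 0) (B := r * (2 * c))
    (fun M hM l μ _ h => FD.contF.tendsto ht hM tendsto_const_nhds
      (Eventually.of_forall fun _ => ht) h) (FD.measDeriv t ht) (FD.normalized t ht)
    (fun M hM M' hM' => FD.integrable_δF ht hM hM') hm hM ?_
  · simpa using this
  · intro s hs
    set N := mix s m (mix r m m')
    have hN : MemP d 2 N := hm.mix hM hs.2.le
    rw [integral_mix (FD.integrable_δF ht hN hm) (FD.integrable_δF ht hN hm') hr,
      show (1 - r) * ∫ x, FD.δF t N x ∂m + r * ∫ x, FD.δF t N x ∂m' - ∫ x, FD.δF t N x ∂m - 0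
        = r * (∫ x, FD.δF t N x ∂m' - ∫ x, FD.δF t N x ∂m) by ring, abs_mul, abs_of_nonneg hr.1]
    refine mul_le_mul_of_nonneg_left ?_ hr.1
    have h1 := abs_le.1 (bound N hN m hm)
    have h2 := abs_le.1 (bound N hN m' hm')
    rw [abs_le]
    constructor <;> linarith

lemma integral_heatFlow_param {G : unitInterval → Ed d → ℝ} {s : unitInterval → ℝ} {c R : ℝ}
    (hm : MemP d 2 m) (hG : Continuous fun q : unitInterval × Ed d => G q.1 q.2)
    (hs : Continuous s) (hGc : ∀ θ x, |G θ x| ≤ c * (1 + ‖x‖)) (hR : ∀ θ, √(s θ - t) ≤ R) :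
    Integrable (fun q : Ed d × (unitInterval × Ed d) => G q.2.1 (q.1 + √(s q.2.1 - t) • q.2.2))
      (m.prod (kernMeasure d)) ∧
    ∫ x, ∫ ω : unitInterval × Ed d, G ω.1 (x + √(s ω.1 - t) • ω.2) ∂(kernMeasure d) ∂m =
      ∫ θ, ∫ x, G θ x ∂(heatFlow d t (s θ) m) := by
  have := hm.1
  have hcont : Continuous fun q : Ed d × (unitInterval × Ed d) =>
      G q.2.1 (q.1 + √(s q.2.1 - t) • q.2.2) :=
    hG.comp ((continuous_fst.comp continuous_snd).prodMk
      (show Continuous fun q : Ed d × (unitInterval × Ed d) => q.1 + √(s q.2.1 - t) • q.2.2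
        by fun_prop))
  have hint : Integrable (fun q : Ed d × (unitInterval × Ed d) =>
      G q.2.1 (q.1 + √(s q.2.1 - t) • q.2.2)) (m.prod (kernMeasure d)) := by
    have h1 : Integrable (fun q : Ed d × (unitInterval × Ed d) => ‖q.1‖)
      (m.prod (kernMeasure d)) := hm.integrable_norm.comp_fst _
    have h2 : Integrable (fun q : Ed d × (unitInterval × Ed d) => R * (1 + ‖q.2.2‖))
      (m.prod (kernMeasure d)) := (integrable_kernMeasure R).comp_snd _
    refine (((integrable_const (1 : ℝ)).add (h1.add h2)).const_mul |c|).mono'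
      hcont.aestronglyMeasurable (ae_of_all _ fun q => ?_)
    refine (hGc _ _).trans ?_
    have hR' := hR q.2.1
    have hs0 := Real.sqrt_nonneg (s q.2.1 - t)
    simp only [Pi.add_apply]
    refine mul_le_mul (le_abs_self c) ?_ (by positivity) (abs_nonneg c)
    refine add_le_add le_rfl ((norm_add_le _ _).trans (add_le_add le_rfl ?_))
    rw [norm_smul, Real.norm_of_nonneg hs0]
    nlinarith [norm_nonneg q.2.2, mul_le_mul_of_nonneg_right hR' (norm_nonneg q.2.2)]
  refine ⟨hint, ?_⟩
  rw [integral_integral_swap hint]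
  unfold kernMeasure
  rw [integral_prod _ hint.integral_prod_right]
  refine integral_congr_ae ?_
  have h3 := (Integrable.prod_right_ae hint.swap)
  refine ae_of_all _ fun θ => ?_
  have hGθ : Continuous (G θ) := hG.comp (continuous_const.prodMk continuous_id)
  have hint' : Integrable (fun q : Ed d × Ed d => G θ (q.1 + √(s θ - t) • q.2))
      (m.prod (stdGaussian (Ed d))) := by
    have := (hm.heatFlow t (s θ)).integrable_of_linear_growth hGθ (hGc θ)
    rw [heatFlow_eq_map, integrable_map_measure hGθ.aestronglyMeasurable (by fun_prop)] at this
    exact this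
  simp only
  rw [integral_heatFlow hGθ, integral_prod_symm _ hint']

lemma integral_valueDeriv (ht₁ : t₁ ∈ Icc 0 T) (ht : t ∈ Icc 0 t₁) (hm : MemP d 2 m)
    (hm' : MemP d 2 m') :
    ∫ x, valueDeriv FD ΨD t₁ t m x ∂m' =
      ∫ x, ΨD.δψ (heatFlow d t t₁ m) x ∂(heatFlow d t t₁ m') +
      (t₁ - t) * ∫ θ, (∫ x, FD.δF (interp t₁ t θ) (heatFlow d t (interp t₁ t θ) m) x
        ∂(heatFlow d t (interp t₁ t θ) m')) ∂volume := by
  have := hm'.1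
  obtain ⟨a, ha⟩ := FD.bddDeriv
  obtain ⟨b, hb⟩ := ΨD.derivGrowth
  have ha0 : 0 ≤ a := by
    exact (abs_nonneg _).trans (ha _ (interp_mem' ht₁ ht 0) m hm 0).1
  have hs : Continuous (interp t₁ t) := by unfold interp; fun_prop
  have h1 := integral_heatFlow_param (t := t) (R := √T)
    (G := fun _ => ΨD.δψ (heatFlow d t t₁ m)) (s := fun _ => t₁)
    hm' ((ΨD.smoothX _ (hm.heatFlow _ _)).continuous.comp continuous_snd) continuous_const
    (fun _ x => (hb _ (hm.heatFlow _ _) x).1)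
    (fun θ => Real.sqrt_le_sqrt (by linarith [ht.1, ht₁.2]))
  have h2 := integral_heatFlow_param (t := t) (R := √T) (c := a)
    (G := fun θ => FD.δF (interp t₁ t θ) (heatFlow d t (interp t₁ t θ) m)) (s := interp t₁ t)
    hm' ?_ hs
    (fun θ x => (ha _ (interp_mem' ht₁ ht θ) _ (hm.heatFlow _ _) x).1.trans
      (le_mul_of_one_le_right ha0 (by linarith [norm_nonneg x])))
    (fun θ => Real.sqrt_le_sqrt (by linarith [ht.1, (interp_mem' ht₁ ht θ).2]))
  · simp only [integral_const, probReal_univ, smul_eq_mul, one_mul] at h1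
    rw [← h1.2, ← h2.2, ← integral_const_mul, ← integral_add h1.1.integral_prod_left
      (h2.1.integral_prod_left.const_mul _)]
    refine integral_congr_ae ?_
    filter_upwards [h1.1.prod_right_ae, h2.1.prod_right_ae] with x hx1 hx2
    rw [← integral_const_mul, ← integral_add hx1 (hx2.const_mul _)]
    rfl
  · refine continuous_iff_continuousAt.2 fun q => ?_
    have hθ := (hs.tendsto q.1).comp (continuous_fst.tendsto q)
    exact (continuous_fst.tendsto _).comp (FD.tendsto_jet (interp_mem' ht₁ ht _)
      (hm.heatFlow _ _) hθ (Eventually.of_forall fun _ => interp_mem' ht₁ ht _)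
      ((mtendsto_const hm).heatFlow hm tendsto_const_nhds hθ) (continuous_snd.tendsto q))

lemma integral_valueDeriv_self (ht₁ : t₁ ∈ Icc 0 T) (ht : t ∈ Icc 0 t₁) (hm : MemP d 2 m) :
    ∫ x, valueDeriv FD ΨD t₁ t m x ∂m = 0 := by
  rw [integral_valueDeriv ht₁ ht hm hm, ΨD.normalized _ (hm.heatFlow _ _)]
  simp [FD.normalized _ (interp_mem' ht₁ ht _) _ (hm.heatFlow _ _)]

lemma tendsto_valueFn_mix (ht₁ : t₁ ∈ Icc 0 T) (ht : t ∈ Icc 0 t₁) (hm : MemP d 2 m)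
    (hm' : MemP d 2 m') :
    Tendsto (fun r => (valueFn FD ΨD t₁ t (mix r m m') - valueFn FD ΨD t₁ t m) / r) (𝓝[>] 0)
      (𝓝 (∫ x, valueDeriv FD ΨD t₁ t m x ∂m')) := by
  have := hm.1
  have := hm'.1
  rw [integral_valueDeriv ht₁ ht hm hm']
  obtain ⟨c, hc⟩ := FD.abs_sub_mix_le
  have h1 := ΨD.measDeriv _ (hm.heatFlow t t₁) _ (hm'.heatFlow t t₁)
  have hlim : Tendsto (fun r => ∫ θ : unitInterval, (FD.F (interp t₁ t θ)
      (mix r (heatFlow d t (interp t₁ t θ) m) (heatFlow d t (interp t₁ t θ) m')) -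
        FD.F (interp t₁ t θ) (heatFlow d t (interp t₁ t θ) m)) / r) (𝓝[>] 0)
      (𝓝 (∫ θ, (∫ x, FD.δF (interp t₁ t θ) (heatFlow d t (interp t₁ t θ) m) x
        ∂(heatFlow d t (interp t₁ t θ) m')) ∂volume)) := by
    refine tendsto_integral_filter_of_dominated_convergence (fun _ => c) ?_ ?_
      (integrable_const _) (ae_of_all _ fun θ => FD.measDeriv _ (interp_mem' ht₁ ht θ) _
        (hm.heatFlow _ _) _ (hm'.heatFlow _ _))
    · filter_upwards [Ioo_mem_nhdsGT one_pos] with r hr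
      have h3 := (continuous_source (FD := FD) ht₁ ht (hm.mix hm' hr.2.le))
      have h4 := (continuous_source (FD := FD) ht₁ ht hm)
      simp only [heatFlow_mix hr.2.le] at h3
      exact ((h3.sub h4).div_const r).aestronglyMeasurable
    · filter_upwards [Ioo_mem_nhdsGT one_pos] with r hr
      refine ae_of_all _ fun θ => ?_
      rw [norm_div, Real.norm_of_nonneg hr.1.le, div_le_iff₀ hr.1, mul_comm]
      exact hc _ (interp_mem' ht₁ ht θ) _ _ (hm.heatFlow _ _) (hm'.heatFlow _ _) r
        (Ioo_subset_Icc_self hr)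
  refine (h1.add (hlim.const_mul (t₁ - t))).congr' ?_
  filter_upwards [Ioo_mem_nhdsGT one_pos] with r hr
  have h3 := (continuous_source (FD := FD) ht₁ ht (hm.mix hm' hr.2.le))
  have h4 := (continuous_source (FD := FD) ht₁ ht hm)
  simp only [valueFn, heatFlow_mix hr.2.le] at h3 ⊢
  rw [integral_div, integral_sub (h3.integrable_of_hasCompactSupport
    (HasCompactSupport.of_compactSpace _)) (h4.integrable_of_hasCompactSupport
    (HasCompactSupport.of_compactSpace _))]
  simp only [mix]
  ring

end MeasureDerivative

section Dynkin

open ProbabilityTheory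

variable {d : ℕ} {m : Measure (Ed d)}

/-- Second order Taylor estimate along a segment. -/
lemma abs_taylor_two_le {f : Ed d → ℝ} (hf : ContDiff ℝ 2 f) {A : Hess d} {x v : Ed d} {ε : ℝ}
    (hA : ∀ θ ∈ Icc (0 : ℝ) 1, ‖fderiv ℝ (fderiv ℝ f) (x + θ • v) - A‖ ≤ ε) :
    |f (x + v) - f x - fderiv ℝ f x v - (1 / 2) * A v v| ≤ ε * ‖v‖ ^ 2 := by
  have hline : ∀ s : ℝ, HasDerivAt (fun s : ℝ => x + s • v) v s := fun s => by
    simpa using ((hasDerivAt_id s).smul_const v).const_add x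
  have hq : ∀ s ∈ Icc (0 : ℝ) 1,
      |fderiv ℝ f (x + s • v) v - fderiv ℝ f x v - s * A v v| ≤ ε * ‖v‖ ^ 2 := by
    intro s hs
    have := norm_image_sub_le_of_norm_deriv_le_segment_01' (C := ε * ‖v‖ ^ 2)
      (f := fun r : ℝ => fderiv ℝ f (x + (r * s) • v) v - (r * s) * A v v)
      (f' := fun r => s * ((fderiv ℝ (fderiv ℝ f) (x + (r * s) • v) - A) v v)) ?_ ?_
    · simp only [Real.norm_eq_abs, one_mul, zero_mul, zero_smul, add_zero, sub_zero] at this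
      convert this using 2
      ring
    · intro r _
      refine HasDerivAt.hasDerivWithinAt ?_
      have h1 : HasDerivAt (fun r : ℝ => x + (r * s) • v) (s • v) r := by
        simpa using (((hasDerivAt_id r).mul_const s).smul_const v).const_add x
      have h2 := ((hf.differentiable_fderiv _).hasFDerivAt.comp_hasDerivAt r h1).clm_apply
        (hasDerivAt_const r v)
      have h3 := ((hasDerivAt_id r).mul_const s).mul_const (A v v)
      refine (h2.sub h3).congr_deriv ?_
      simp only [map_smul, map_zero, add_zero, one_mul, sub_apply, smul_apply, smul_eq_mul]
      ring
    · intro r hr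
      have hrs : r * s ∈ Icc (0 : ℝ) 1 :=
        ⟨mul_nonneg hr.1 hs.1, mul_le_one₀ hr.2.le hs.1 hs.2⟩
      rw [norm_mul, Real.norm_of_nonneg hs.1]
      have h1 := ((fderiv ℝ (fderiv ℝ f) (x + (r * s) • v) - A).le_opNorm₂ v v)
      have h2 : ‖fderiv ℝ (fderiv ℝ f) (x + (r * s) • v) - A‖ * ‖v‖ * ‖v‖ ≤ ε * ‖v‖ ^ 2 := by
        rw [mul_assoc, ← sq]
        exact mul_le_mul_of_nonneg_right (hA _ hrs) (sq_nonneg _)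
      exact (mul_le_of_le_one_left (norm_nonneg _) hs.2).trans (h1.trans h2)
  have := norm_image_sub_le_of_norm_deriv_le_segment_01' (C := ε * ‖v‖ ^ 2)
    (f := fun s : ℝ => f (x + s • v) - s * fderiv ℝ f x v - s ^ 2 * ((1 / 2) * A v v))
    (f' := fun s => fderiv ℝ f (x + s • v) v - fderiv ℝ f x v - s * A v v) ?_
    (fun s hs => hq s (Ico_subset_Icc_self hs))
  · simp only [Real.norm_eq_abs, one_mul, one_smul, zero_mul, zero_smul, add_zero, sub_zero,
      one_pow, ne_eq, OfNat.ofNat_ne_zero, not_false_eq_true, zero_pow] at this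
    convert this using 2
    ring
  · intro s _
    refine HasDerivAt.hasDerivWithinAt ?_
    have h1 := (hf.differentiable (by norm_num) _).hasFDerivAt.comp_hasDerivAt s (hline s)
    have h2 := (hasDerivAt_id s).mul_const (fderiv ℝ f x v)
    have h3 := ((hasDerivAt_id s).pow 2).mul_const ((1 / 2) * A v v)
    refine ((h1.sub h2).sub h3).congr_deriv ?_
    simp only [id, Nat.cast_ofNat, Nat.add_one_sub_one, pow_one, one_mul, mul_one]
    ring

lemma integral_coord_mul_stdGaussian (i j : Fin d) :
    ∫ z, z i * z j ∂(stdGaussian (Ed d)) = if i = j then 1 else 0 := by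
  have h := covarianceBilin_apply (μ := stdGaussian (Ed d)) IsGaussian.memLp_two_id
    (EuclideanSpace.single i (1:ℝ)) (EuclideanSpace.single j (1:ℝ))
  have h0 : (stdGaussian (Ed d))[id] = 0 := integral_id_stdGaussian
  rw [covarianceBilin_stdGaussian, h0] at h
  simp only [sub_zero, EuclideanSpace.inner_single_left, map_one, one_mul] at h
  rw [← h]
  change inner ℝ (EuclideanSpace.single i (1 : ℝ)) (EuclideanSpace.single j (1 : ℝ)) = _
  rw [EuclideanSpace.inner_single_left]
  simp

lemma integral_bilin_stdGaussian (A : Hess d) :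
    ∫ z, A z z ∂(stdGaussian (Ed d)) = lap d A := by
  have hz : ∀ z : Ed d, A z z = ∑ i, ∑ j, z i * z j *
      A (EuclideanSpace.single i (1:ℝ)) (EuclideanSpace.single j (1:ℝ)) := by
    intro z
    have e : z = ∑ i, z i • EuclideanSpace.single i (1:ℝ) := by
      have := (EuclideanSpace.basisFun (Fin d) ℝ).sum_repr z
      simpa using this.symm
    conv_lhs => rw [e]
    simp only [map_sum, map_smul, sum_apply, smul_apply, smul_eq_mul, Finset.mul_sum]
    rw [Finset.sum_comm]
    exact Finset.sum_congr rfl fun i _ => Finset.sum_congr rfl fun j _ => by ring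
  have hi : ∀ i j : Fin d, Integrable (fun z : Ed d => z i * z j) (stdGaussian (Ed d)) := by
    intro i j
    refine (integrable_norm_pow_stdGaussian 2).mono' (by fun_prop) (ae_of_all _ fun z => ?_)
    rw [norm_mul, sq]
    exact mul_le_mul (PiLp.norm_apply_le z i) (PiLp.norm_apply_le z j) (norm_nonneg _)
      (norm_nonneg _)
  simp only [hz]
  rw [integral_finsetSum _ fun i _ => integrable_finsetSum _ fun j _ => (hi i j).mul_const _]
  refine Finset.sum_congr rfl fun i _ => ?_
  rw [integral_finsetSum _ fun j _ => (hi i j).mul_const _]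
  simp [integral_mul_const, integral_coord_mul_stdGaussian]

/-- Infinitesimal generator of the heat flow, tested against converging functions. -/
lemma tendsto_generator {ι : Type*} {l : Filter ι} [l.IsCountablyGenerated]
    {f : ι → Ed d → ℝ} {f₀ : Ed d → ℝ} {h : ι → ℝ} {C : ℝ} (hm : MemP d 2 m)
    (hf : ∀ᶠ i in l, ContDiff ℝ 2 (f i)) (hf₀ : ContDiff ℝ 2 f₀)
    (hC : ∀ᶠ i in l, ∀ x, ‖jet (f i) x‖ ≤ C * (1 + ‖x‖))
    (hC₀ : ∀ x, ‖jet f₀ x‖ ≤ C * (1 + ‖x‖))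
    (hlim : ∀ x, Tendsto (fun q : ι × Ed d => jet (f q.1) q.2) (l ×ˢ 𝓝 x) (𝓝 (jet f₀ x)))
    (hh : Tendsto h l (𝓝[>] 0)) :
    Tendsto (fun i => (∫ x, f i x ∂(heatFlow d 0 (h i) m) - ∫ x, f i x ∂m) / h i) l
      (𝓝 ((1 / 2) * ∫ x, lapl d f₀ x ∂m)) := by
  have := hm.1
  obtain ⟨hh0, hpos⟩ := tendsto_nhdsWithin_iff.1 hh
  have hCnn : 0 ≤ C := by simpa using (norm_nonneg _).trans (hC₀ 0)
  set P := m.prod (stdGaussian (Ed d))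
  set R : ι → Ed d × Ed d → ℝ := fun i q =>
    (f i (q.1 + √(h i) • q.2) - f i q.1 - fderiv ℝ (f i) q.1 (√(h i) • q.2)) / h i
  have hN1 := integrable_norm_pow_stdGaussian (d := d) 1
  have hN2 := integrable_norm_pow_stdGaussian (d := d) 2
  have hN3 := integrable_norm_pow_stdGaussian (d := d) 3
  have hx1 : Integrable (fun x => C * (1 + ‖x‖)) m :=
    ((integrable_const (1 : ℝ)).add hm.integrable_norm).const_mul C
  have hquot : (fun i => (∫ x, f i x ∂(heatFlow d 0 (h i) m) - ∫ x, f i x ∂m) / h i) =ᶠ[l]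
      fun i => ∫ q, R i q ∂P := by
    filter_upwards [hf, hC] with i hfi hCi
    have hfc := hfi.continuous
    have hgr : ∀ x, |f i x| ≤ C * (1 + ‖x‖) := fun x => (norm_jet_le_iff.1 (hCi x)).1
    have i1 : Integrable (fun q : Ed d × Ed d => f i (q.1 + √(h i) • q.2)) P := by
      have := (hm.heatFlow 0 (h i)).integrable_of_linear_growth hfc hgr
      rw [heatFlow_eq_map, integrable_map_measure hfc.aestronglyMeasurable (by fun_prop)] at this
      simpa only [Function.comp_def, sub_zero] using this
    have i2 : Integrable (fun q : Ed d × Ed d => f i q.1) P :=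
      (hm.integrable_of_linear_growth hfc hgr).comp_fst _
    have hd1 : Continuous (fderiv ℝ (f i)) := hfi.continuous_jet.snd.fst
    have i3 : Integrable (fun q : Ed d × Ed d => fderiv ℝ (f i) q.1 (√(h i) • q.2)) P := by
      refine ((hx1.mul_prod hN1).const_mul √(h i)).mono' ?_ (ae_of_all _ fun q => ?_)
      · exact ((hd1.comp continuous_fst).clm_apply (by fun_prop)).aestronglyMeasurable
      · rw [map_smul, norm_smul, Real.norm_of_nonneg (Real.sqrt_nonneg _), pow_one]
        refine mul_le_mul_of_nonneg_left (((fderiv ℝ (f i) q.1).le_opNorm q.2).trans ?_)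
          (Real.sqrt_nonneg _)
        exact mul_le_mul_of_nonneg_right (norm_jet_le_iff.1 (hCi q.1)).2.1 (norm_nonneg _)
    have z3 : ∫ q : Ed d × Ed d, fderiv ℝ (f i) q.1 (√(h i) • q.2) ∂P = 0 := by
      rw [integral_prod _ i3]
      refine integral_eq_zero_of_ae (ae_of_all _ fun x => ?_)
      simp only [map_smul, Pi.zero_apply]
      rw [integral_smul, ContinuousLinearMap.integral_comp_id_comm IsGaussian.integrable_id,
        integral_id_stdGaussian, map_zero, smul_zero]
    have i12 : Integrable (fun q : Ed d × Ed d => f i (q.1 + √(h i) • q.2) - f i q.1) P :=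
      i1.sub i2
    rw [integral_div, integral_sub i12 i3, integral_sub i1 i2, z3, sub_zero,
      integral_heatFlow hfc, sub_zero]
    congr 2
    exact (integral_fun_fst (μ := m) (ν := stdGaussian (Ed d)) (f i)).trans (by simp) |>.symm
  have hlap : (1 / 2) * ∫ x, lapl d f₀ x ∂m =
      ∫ q : Ed d × Ed d, (1 / 2) * fderiv ℝ (fderiv ℝ f₀) q.1 q.2 q.2 ∂P := by
    have hd2 : Continuous (fderiv ℝ (fderiv ℝ f₀)) := hf₀.continuous_jet.snd.snd
    have i4 : Integrable (fun q : Ed d × Ed d => fderiv ℝ (fderiv ℝ f₀) q.1 q.2 q.2) P := by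
      refine (hx1.mul_prod hN2).mono' ?_ (ae_of_all _ fun q => ?_)
      · exact (((hd2.comp continuous_fst).clm_apply continuous_snd).clm_apply
          continuous_snd).aestronglyMeasurable
      · refine ((fderiv ℝ (fderiv ℝ f₀) q.1).le_opNorm₂ q.2 q.2).trans ?_
        rw [mul_assoc, ← sq]
        exact mul_le_mul_of_nonneg_right ((norm_hess_le_jet _ _).trans (hC₀ q.1)) (sq_nonneg _)
    rw [integral_const_mul, integral_prod _ i4]
    simp only [integral_bilin_stdGaussian, lapl_eq, jet]
  rw [tendsto_congr' hquot, hlap]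
  refine tendsto_integral_filter_of_dominated_convergence
    (fun q => C * (1 + ‖q.1‖) * ‖q.2‖ ^ 2 + C * ‖q.2‖ ^ 3) ?_ ?_
    ((hx1.mul_prod hN2).add ((hN3.const_mul C).comp_snd m)) (ae_of_all _ fun q => ?_)
  · filter_upwards [hf] with i hfi
    have hfc := hfi.continuous
    have hd1 : Continuous (fderiv ℝ (f i)) := hfi.continuous_jet.snd.fst
    exact (((by fun_prop : Continuous fun q : Ed d × Ed d =>
      f i (q.1 + √(h i) • q.2) - f i q.1).sub
      ((hd1.comp continuous_fst).clm_apply (by fun_prop))).div_const _).aestronglyMeasurable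
  · filter_upwards [hf, hC, hpos, hh0.eventually_le_const (zero_lt_one' ℝ)] with i hfi hCi hi hi1
    refine ae_of_all _ fun q => ?_
    have hi : 0 < h i := hi
    have hsq : √(h i) ≤ 1 := Real.sqrt_le_one.2 hi1
    have key := abs_taylor_two_le hfi (A := 0) (x := q.1) (v := √(h i) • q.2)
      (ε := C * (1 + ‖q.1‖ + ‖q.2‖)) fun θ hθ => by
        rw [sub_zero]
        refine (norm_hess_le_jet _ _).trans ((hCi _).trans
          (mul_le_mul_of_nonneg_left ?_ hCnn))
        rw [add_assoc]
        refine add_le_add le_rfl ((norm_add_le _ _).trans (add_le_add le_rfl ?_))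
        rw [norm_smul, norm_smul, Real.norm_of_nonneg hθ.1,
          Real.norm_of_nonneg (Real.sqrt_nonneg _), ← mul_assoc]
        exact mul_le_of_le_one_left (norm_nonneg _) (mul_le_one₀ hθ.2 (Real.sqrt_nonneg _) hsq)
    simp only [zero_apply, mul_zero, sub_zero, norm_smul, mul_pow,
      Real.norm_eq_abs, sq_abs, Real.sq_sqrt hi.le] at key
    simp only [R, norm_div, Real.norm_eq_abs, abs_of_pos hi]
    rw [div_le_iff₀ hi]
    refine key.trans (le_of_eq ?_)
    ring
  · refine Metric.tendsto_nhds.2 fun ε hε => ?_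
    set A := fderiv ℝ (fderiv ℝ f₀) q.1
    set ε' := ε / (2 * (‖q.2‖ ^ 2 + 1))
    have hε' : 0 < ε' := by positivity
    obtain ⟨pa, hpa, pb, hpb, hab⟩ :=
      eventually_prod_iff.1 (Metric.tendsto_nhds.1 (hlim q.1) ε' hε')
    obtain ⟨ρ, hρ, hball⟩ := Metric.eventually_nhds_iff.1 hpb
    have hv : Tendsto (fun i => √(h i) * ‖q.2‖) l (𝓝 0) := by
      have := ((Real.continuous_sqrt.tendsto 0).comp hh0).mul_const ‖q.2‖
      simpa using this
    filter_upwards [hf, hpos, hpa, hv.eventually_lt_const hρ] with i hfi hi hpai hvi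
    have hi : 0 < h i := hi
    have key := abs_taylor_two_le hfi (A := A) (x := q.1) (v := √(h i) • q.2)
      (ε := ε') fun θ hθ => by
        have hy : pb (q.1 + θ • √(h i) • q.2) := hball (by
          rw [dist_eq_norm, add_sub_cancel_left, norm_smul, norm_smul, Real.norm_of_nonneg hθ.1,
            Real.norm_of_nonneg (Real.sqrt_nonneg _)]
          exact (mul_le_of_le_one_left (by positivity) hθ.2).trans_lt hvi)
        have h1 := hab hpai hy
        rw [dist_eq_norm] at h1
        exact (((norm_snd_le _).trans (norm_snd_le _)).trans h1.le)
    have e : R i q - 1 / 2 * A q.2 q.2 = (f i (q.1 + √(h i) • q.2) - f i q.1 -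
        fderiv ℝ (f i) q.1 (√(h i) • q.2) -
        1 / 2 * A (√(h i) • q.2) (√(h i) • q.2)) / h i := by
      simp only [R, map_smul, smul_apply, smul_eq_mul]
      field_simp
      rw [Real.sq_sqrt hi.le]
    rw [Real.dist_eq, e, abs_div, abs_of_pos hi, div_lt_iff₀ hi]
    refine key.trans_lt ?_
    rw [norm_smul, mul_pow, Real.norm_eq_abs, sq_abs, Real.sq_sqrt hi.le,
      show ε' * (h i * ‖q.2‖ ^ 2) = (ε' * ‖q.2‖ ^ 2) * h i by ring]
    refine mul_lt_mul_of_pos_right ?_ hi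
    have : ε' * (2 * (‖q.2‖ ^ 2 + 1)) = ε := by
      simp only [ε']; field_simp
    nlinarith [sq_nonneg ‖q.2‖, mul_nonneg hε'.le (sq_nonneg ‖q.2‖)]

end Dynkin

section TimeDerivative

variable {d : ℕ} {T t₁ : ℝ} {m : Measure (Ed d)} {ι : Type*} {l : Filter ι}
  {FD : A1Data d T} {ΨD : A2Data d} {t₀ : ℝ}

lemma abs_lapl_le (f : Ed d → ℝ) (x : Ed d) : |lapl d f x| ≤ d * ‖jet f x‖ := by
  rw [lapl_eq]
  exact (abs_lap_le _).trans (mul_le_mul_of_nonneg_left (norm_hess_le_jet _ _) (by positivity))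

/-- Increment of `valueFn` in the measure argument along the heat flow. -/
lemma tendsto_valueFn_heatFlow_sub_div [l.IsCountablyGenerated] {s h : ι → ℝ}
    (ht₁ : t₁ ∈ Icc 0 T) (ht₀ : t₀ ∈ Icc 0 t₁) (hm : MemP d 2 m) (hs : Tendsto s l (𝓝 t₀))
    (hsm : ∀ᶠ i in l, s i ∈ Icc 0 t₁) (hh : Tendsto h l (𝓝[>] 0)) :
    Tendsto (fun i => (valueFn FD ΨD t₁ (s i) (heatFlow d 0 (h i) m) -
      valueFn FD ΨD t₁ (s i) m) / h i) l
      (𝓝 ((1 / 2) * ∫ x, lapl d (valueDeriv FD ΨD t₁ t₀ m) x ∂m)) := by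
  have := hm.1
  obtain ⟨hh0, hpos⟩ := tendsto_nhdsWithin_iff.1 hh
  obtain ⟨C, hC0, hC⟩ := exists_valueDeriv_bound FD ΨD ht₁
  have hheat : MTendsto l (fun i => heatFlow d 0 (h i) m) m := by
    have := (mtendsto_const (l := l) hm).heatFlow hm (tendsto_const_nhds (x := (0 : ℝ))) hh0
    rwa [heatFlow_self] at this
  set l' := l ×ˢ 𝓟 (Ico (0 : ℝ) 1)
  have hfst : Tendsto Prod.fst l' l := tendsto_fst
  have hsnd : ∀ᶠ q in l', q.2 ∈ Ico (0 : ℝ) 1 := tendsto_snd.eventually (mem_principal_self _)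
  have hmixP : ∀ᶠ q in l', MemP d 2 (mix q.2 m (heatFlow d 0 (h q.1) m)) := by
    filter_upwards [hsnd] with q hq
    exact hm.mix (hm.heatFlow _ _) hq.2.le
  have hmix : MTendsto l' (fun q => mix q.2 m (heatFlow d 0 (h q.1) m)) m := by
    refine ⟨hmixP, squeeze_zero' (Eventually.of_forall fun _ => wdist_nonneg _) ?_
      (hheat.2.comp hfst)⟩
    filter_upwards [hsnd] with q hq
    exact (wdist_mix_le hm (hm.heatFlow _ _) (Ico_subset_Icc_self hq)).trans
      (mul_le_of_le_one_left (wdist_nonneg _) hq.2.le)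
  have hgen := tendsto_generator (l := l') (h := fun q => h q.1) (C := C)
    (f := fun q => valueDeriv FD ΨD t₁ (s q.1) (mix q.2 m (heatFlow d 0 (h q.1) m)))
    (f₀ := valueDeriv FD ΨD t₁ t₀ m) hm ?_ (contDiff_valueDeriv ht₁ ht₀ hm).1 ?_
    (hC t₀ ht₀ m hm) ?_ (hh.comp hfst)
  · refine Metric.tendsto_nhds.2 fun ε hε => ?_
    have h1 := eventually_prod_principal_iff.1 (Metric.tendsto_nhds.1 hgen (ε / 2) (half_pos hε))
    filter_upwards [h1, hpos, hsm] with i hi hi0 his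
    have hi0 : 0 < h i := hi0
    set L := (1 / 2) * ∫ x, lapl d (valueDeriv FD ΨD t₁ t₀ m) x ∂m
    have key := abs_sub_sub_le_of_segment (g := valueFn FD ΨD t₁ (s i))
      (δg := valueDeriv FD ΨD t₁ (s i)) (m := m) (m' := heatFlow d 0 (h i) m)
      (c := h i * L) (B := ε / 2 * h i)
      (fun M hM l μ hl hμ => tendsto_valueFn ht₁ his hM tendsto_const_nhds
        (Eventually.of_forall fun _ => his) hμ)
      (fun M hM M' hM' => tendsto_valueFn_mix ht₁ his hM hM')
      (fun M hM => integral_valueDeriv_self ht₁ his hM)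
      (fun M hM M' hM' => hM'.integrable_of_linear_growth
        (contDiff_valueDeriv ht₁ his hM).1.continuous
        fun x => (norm_jet_le_iff.1 (hC _ his M hM x)).1)
      hm (hm.heatFlow _ _) fun r hr => by
        have h2 := (hi r hr).le
        rw [Real.dist_eq, div_sub' hi0.ne', abs_div, abs_of_pos hi0, div_le_iff₀ hi0] at h2
        exact h2
    rw [Real.dist_eq, div_sub' hi0.ne', abs_div, abs_of_pos hi0, div_lt_iff₀ hi0]
    exact key.trans_lt (mul_lt_mul_of_pos_right (half_lt_self hε) hi0)
  · filter_upwards [hfst.eventually hsm, hmixP] with q h1 h2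
    exact (contDiff_valueDeriv ht₁ h1 h2).1
  · filter_upwards [hfst.eventually hsm, hmixP] with q h1 h2
    exact hC _ h1 _ h2
  · intro x
    exact tendsto_jet_valueDeriv ht₁ ht₀ hm (hs.comp (hfst.comp tendsto_fst))
      ((hfst.comp tendsto_fst).eventually hsm) (hmix.comp tendsto_fst) tendsto_snd

lemma continuousOn_source (FD : A1Data d T) (hm : MemP d 2 m) (t : ℝ) :
    ContinuousOn (fun r => FD.F r (heatFlow d t r m)) (Icc 0 T) := fun _ hr =>
  FD.contF.tendsto hr (hm.heatFlow _ _) (tendsto_id.mono_left nhdsWithin_le_nhds)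
    self_mem_nhdsWithin ((mtendsto_const hm).heatFlow hm tendsto_const_nhds
      (tendsto_id.mono_left nhdsWithin_le_nhds))

lemma intervalIntegrable_source (FD : A1Data d T) (hm : MemP d 2 m) (t : ℝ) {a b : ℝ}
    (ha : a ∈ Icc 0 T) (hb : b ∈ Icc 0 T) :
    IntervalIntegrable (fun r => FD.F r (heatFlow d t r m)) volume a b :=
  ((continuousOn_source FD hm t).mono (uIcc_subset_Icc ha hb)).intervalIntegrable

lemma intervalIntegral_eq_integral_unitInterval (f : ℝ → ℝ) (a b : ℝ) :
    ∫ r in a..b, f r = (b - a) * ∫ θ : unitInterval, f (interp b a θ) ∂volume := by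
  have h1 := intervalIntegral.smul_integral_comp_add_mul (a := 0) (b := 1) f (b - a) a
  rw [mul_zero, add_zero, mul_one, add_sub_cancel, smul_eq_mul] at h1
  rw [← h1, intervalIntegral.integral_of_le zero_le_one, ← integral_Icc_eq_integral_Ioc,
    ← unitInterval.measurePreserving_coe.integral_comp unitInterval.measurableEmbedding_coe]
  simp only [interp, mul_comm]

lemma valueFn_eq (t : ℝ) : valueFn FD ΨD t₁ t m =
    ΨD.ψ (heatFlow d t t₁ m) + ∫ r in t..t₁, FD.F r (heatFlow d t r m) := by
  rw [intervalIntegral_eq_integral_unitInterval]; rfl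

/-- Flow property of `valueFn`. -/
lemma valueFn_flow (ht₁ : t₁ ∈ Icc 0 T) (hm : MemP d 2 m) {a b : ℝ} (ha : 0 ≤ a) (hab : a ≤ b)
    (hb : b ≤ t₁) : valueFn FD ΨD t₁ a m =
      valueFn FD ΨD t₁ b (heatFlow d a b m) + ∫ r in a..b, FD.F r (heatFlow d a r m) := by
  have := hm.1
  have haT : a ∈ Icc 0 T := ⟨ha, hab.trans (hb.trans ht₁.2)⟩
  have hbT : b ∈ Icc 0 T := ⟨ha.trans hab, hb.trans ht₁.2⟩
  rw [valueFn_eq, valueFn_eq, heatFlow_heatFlow hab hb,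
    ← intervalIntegral.integral_add_adjacent_intervals
      (intervalIntegrable_source FD hm a haT hbT) (intervalIntegrable_source FD hm a hbT ht₁)]
  have : ∫ r in b..t₁, FD.F r (heatFlow d b r (heatFlow d a b m)) =
      ∫ r in b..t₁, FD.F r (heatFlow d a r m) := by
    refine intervalIntegral.integral_congr fun r hr => ?_
    rw [uIcc_of_le hb] at hr
    simp only [heatFlow_heatFlow hab hr.1]
  rw [this]
  ring

lemma tendsto_average_source (FD : A1Data d T) (ht₀ : t₀ ∈ Icc 0 T) (hm : MemP d 2 m)
    {a b : ι → ℝ} (ha : Tendsto a l (𝓝 t₀)) (hb : Tendsto b l (𝓝 t₀))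
    (ham : ∀ᶠ i in l, a i ∈ Icc 0 T) (hbm : ∀ᶠ i in l, b i ∈ Icc 0 T)
    (hab : ∀ᶠ i in l, a i < b i) :
    Tendsto (fun i => (∫ r in (a i)..(b i), FD.F r (heatFlow d (a i) r m)) / (b i - a i)) l
      (𝓝 (FD.F t₀ m)) := by
  have hba : Tendsto (fun i => b i - a i) l (𝓝 0) := by simpa using hb.sub ha
  set l' := l ×ˢ 𝓟 (Icc (0 : ℝ) 1)
  have hfst : Tendsto Prod.fst l' l := tendsto_fst
  have hsnd : ∀ᶠ q in l', q.2 ∈ Icc (0 : ℝ) 1 := tendsto_snd.eventually (mem_principal_self _)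
  have hmem : ∀ᶠ q in l', a q.1 + q.2 * (b q.1 - a q.1) ∈ Icc (a q.1) (b q.1) := by
    filter_upwards [hfst.eventually hab, hsnd] with q hq hq2
    have h0 : 0 ≤ b q.1 - a q.1 := (sub_pos.2 hq).le
    exact ⟨by linarith [mul_nonneg hq2.1 h0], by
      linarith [mul_le_mul_of_nonneg_right hq2.2 h0]⟩
  have hr : Tendsto (fun q : ι × ℝ => a q.1 + q.2 * (b q.1 - a q.1)) l' (𝓝 t₀) :=
    tendsto_of_tendsto_of_tendsto_of_le_of_le' (ha.comp hfst) (hb.comp hfst)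
      (hmem.mono fun _ h => h.1) (hmem.mono fun _ h => h.2)
  have hF := FD.contF.tendsto ht₀ hm hr
    (by filter_upwards [hmem, hfst.eventually ham, hfst.eventually hbm] with q h1 h2 h3
        exact ⟨h2.1.trans h1.1, h1.2.trans h3.2⟩)
    (by simpa only [heatFlow_self] using
      (mtendsto_const (l := l') hm).heatFlow hm (ha.comp hfst) hr)
  refine Metric.tendsto_nhds.2 fun ε hε => ?_
  have h1 := eventually_prod_principal_iff.1 (Metric.tendsto_nhds.1 hF (ε / 2) (half_pos hε))
  filter_upwards [h1, ham, hbm, hab] with i hi hai hbi habi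
  have hpos := sub_pos.2 habi
  have h2 := intervalIntegral.norm_integral_le_of_norm_le_const (a := a i) (b := b i)
    (f := fun r => FD.F r (heatFlow d (a i) r m) - FD.F t₀ m) (C := ε / 2) fun r hr => by
      rw [uIoc_of_le habi.le] at hr
      have h3 := hi ((r - a i) / (b i - a i)) ⟨div_nonneg (by linarith [hr.1]) hpos.le,
        (div_le_one hpos).2 (by linarith [hr.2])⟩
      rw [div_mul_cancel₀ _ hpos.ne', add_sub_cancel, Function.comp_apply] at h3
      exact h3.le
  rw [intervalIntegral.integral_sub (intervalIntegrable_source FD hm _ hai hbi)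
    intervalIntegrable_const, intervalIntegral.integral_const, smul_eq_mul,
    abs_of_pos hpos, Real.norm_eq_abs] at h2
  rw [Real.dist_eq, div_sub' hpos.ne', abs_div, abs_of_pos hpos, div_lt_iff₀ hpos]
  exact h2.trans_lt (mul_lt_mul_of_pos_right (half_lt_self hε) hpos)

variable (FD ΨD) in
/-- The time derivative of `valueFn`. -/
def valueTime (t₁ t : ℝ) (m : Measure (Ed d)) : ℝ :=
  -((1 / 2) * ∫ x, lapl d (valueDeriv FD ΨD t₁ t m) x ∂m) - FD.F t m

lemma hasDerivWithinAt_valueFn (ht₁ : t₁ ∈ Icc 0 T) (ht₀ : t₀ ∈ Icc 0 t₁) (hm : MemP d 2 m) :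
    HasDerivWithinAt (fun s => valueFn FD ΨD t₁ s m) (valueTime FD ΨD t₁ t₀ m)
      (Icc 0 t₁) t₀ := by
  have := hm.1
  rw [hasDerivWithinAt_iff_tendsto_slope]
  set l := 𝓝[Icc 0 t₁ \ {t₀}] t₀
  have hid : Tendsto (fun s : ℝ => s) l (𝓝 t₀) := tendsto_id.mono_left nhdsWithin_le_nhds
  have hmem : ∀ᶠ s in l, s ∈ Icc 0 t₁ \ {t₀} := self_mem_nhdsWithin
  have ha : Tendsto (fun s => min t₀ s) l (𝓝 t₀) := by
    simpa using (tendsto_const_nhds (x := t₀)).min hid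
  have hb : Tendsto (fun s => max t₀ s) l (𝓝 t₀) := by
    simpa using (tendsto_const_nhds (x := t₀)).max hid
  have ham : ∀ᶠ s in l, min t₀ s ∈ Icc 0 t₁ :=
    hmem.mono fun s hs => ⟨le_min ht₀.1 hs.1.1, (min_le_left _ _).trans ht₀.2⟩
  have hbm : ∀ᶠ s in l, max t₀ s ∈ Icc 0 t₁ :=
    hmem.mono fun s hs => ⟨ht₀.1.trans (le_max_left _ _), max_le ht₀.2 hs.1.2⟩
  have hab : ∀ᶠ s in l, min t₀ s < max t₀ s :=
    hmem.mono fun s hs => min_lt_max.2 (Ne.symm hs.2)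
  have hh : Tendsto (fun s => max t₀ s - min t₀ s) l (𝓝[>] 0) :=
    tendsto_nhdsWithin_iff.2 ⟨by simpa using hb.sub ha, hab.mono fun s hs => sub_pos.2 hs⟩
  have hT : Icc 0 t₁ ⊆ Icc 0 T := Icc_subset_Icc_right ht₁.2
  have h1 := tendsto_valueFn_heatFlow_sub_div (FD := FD) (ΨD := ΨD) ht₁ ht₀ hm hb hbm hh
  have h2 := tendsto_average_source FD (hT ht₀) hm ha hb (ham.mono fun _ h => hT h)
    (hbm.mono fun _ h => hT h) hab
  refine (h1.neg.sub h2).congr' ?_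
  filter_upwards [hab, ham, hbm, hmem] with s hs hsa hsb hsm
  have hflow := valueFn_flow (FD := FD) (ΨD := ΨD) ht₁ hm hsa.1 hs.le hsb.2
  rw [heatFlow_congr (m := m) (t := min t₀ s) (s := max t₀ s) (t' := 0)
    (s' := max t₀ s - min t₀ s) (by ring)] at hflow
  rw [← neg_div, ← sub_div]
  have e : -(valueFn FD ΨD t₁ (max t₀ s) (heatFlow d 0 (max t₀ s - min t₀ s) m) -
      valueFn FD ΨD t₁ (max t₀ s) m) -
      ∫ r in (min t₀ s)..(max t₀ s), FD.F r (heatFlow d (min t₀ s) r m) =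
      valueFn FD ΨD t₁ (max t₀ s) m - valueFn FD ΨD t₁ (min t₀ s) m := by
    rw [hflow]; ring
  rw [e, slope_def_field]
  rcases le_total t₀ s with h | h
  · simp only [max_eq_right h, min_eq_left h]
  · simp only [max_eq_left h, min_eq_right h]
    rw [← neg_div_neg_eq, neg_sub, neg_sub]

lemma tendsto_valueTime [l.IsCountablyGenerated] {t : ι → ℝ} {μ : ι → Measure (Ed d)}
    (ht₁ : t₁ ∈ Icc 0 T) (ht₀ : t₀ ∈ Icc 0 t₁) (hm : MemP d 2 m)
    (ht : Tendsto t l (𝓝 t₀)) (htm : ∀ᶠ i in l, t i ∈ Icc 0 t₁) (hμ : MTendsto l μ m) :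
    Tendsto (fun i => valueTime FD ΨD t₁ (t i) (μ i)) l (𝓝 (valueTime FD ΨD t₁ t₀ m)) := by
  obtain ⟨C, hC0, hC⟩ := exists_valueDeriv_bound FD ΨD ht₁
  have hT : Icc 0 t₁ ⊆ Icc 0 T := Icc_subset_Icc_right ht₁.2
  have hcl : ∀ {f : Ed d → ℝ}, ContDiff ℝ 2 f → Continuous (lapl d f) := fun hf => by
    simp only [funext (lapl_eq _)]
    exact continuous_lap.comp hf.continuous_jet.snd.snd
  have hgr : ∀ {f : Ed d → ℝ}, (∀ x, ‖jet f x‖ ≤ C * (1 + ‖x‖)) →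
      ∀ x, |lapl d f x| ≤ d * C * (1 + ‖x‖) := fun hf x => by
    rw [mul_assoc]
    exact (abs_lapl_le _ x).trans (mul_le_mul_of_nonneg_left (hf x) (by positivity))
  refine ((hμ.tendsto_integral hm ?_ (hcl (contDiff_valueDeriv ht₁ ht₀ hm).1) ?_
    (hgr (hC t₀ ht₀ m hm)) fun x => ?_).const_mul _).neg.sub
    (FD.contF.tendsto (hT ht₀) hm ht (htm.mono fun _ h => hT h) hμ)
  · filter_upwards [htm, hμ.1] with i h1 h2
    exact hcl (contDiff_valueDeriv ht₁ h1 h2).1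
  · filter_upwards [htm, hμ.1] with i h1 h2
    exact hgr (hC _ h1 _ h2)
  · simp only [lapl_eq]
    exact (continuous_lap.tendsto _).comp ((continuous_snd.snd.tendsto _).comp
      (tendsto_jet_valueDeriv ht₁ ht₀ hm (ht.comp tendsto_fst) (tendsto_fst.eventually htm)
        (hμ.comp tendsto_fst) tendsto_snd))

end TimeDerivative

section SecondMoment

variable {d : ℕ} {m : Measure (Ed d)} {ι : Type*} {l : Filter ι} {μ : ι → Measure (Ed d)}

/-- The second moment of a measure. -/
def secMom (m : Measure (Ed d)) : ℝ := ∫ x, ‖x‖ ^ 2 ∂m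

lemma secMom_nonneg : 0 ≤ secMom m := integral_nonneg fun _ => by positivity

lemma one_add_secMom_pos : 0 < 1 + secMom m := by linarith [secMom_nonneg (m := m)]

lemma secMom_mix {m' : Measure (Ed d)} (hm : MemP d 2 m) (hm' : MemP d 2 m') {r : ℝ}
    (hr : r ∈ Icc (0 : ℝ) 1) : secMom (mix r m m') = secMom m + r * (secMom m' - secMom m) := by
  have := integral_mix hm.integrable_norm_sq hm'.integrable_norm_sq hr
  simp only [secMom, this]
  ring

/-- The second moment is lower semicontinuous for `d₁`. -/
lemma MTendsto.eventually_lt_secMom [l.IsCountablyGenerated] (h : MTendsto l μ m)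
    (hm : MemP d 2 m) {c : ℝ} (hc : c < secMom m) : ∀ᶠ i in l, c < secMom (μ i) := by
  have hR : Tendsto (fun R : ℕ => ∫ x, min (‖x‖ ^ 2) R ∂m) atTop (𝓝 (secMom m)) := by
    refine tendsto_integral_of_dominated_convergence (fun x => ‖x‖ ^ 2)
      (fun R => (by fun_prop :
        Continuous fun x : Ed d => min (‖x‖ ^ 2) (R : ℝ)).aestronglyMeasurable)
      hm.integrable_norm_sq (fun R => ae_of_all _ fun x => ?_) (ae_of_all _ fun x => ?_)
    · rw [Real.norm_of_nonneg (le_min (by positivity) (by positivity))]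
      exact min_le_left _ _
    · refine tendsto_const_nhds.congr' ?_
      filter_upwards [eventually_ge_atTop ⌈‖x‖ ^ 2⌉₊] with R hR
      exact (min_eq_left (Nat.ceil_le.1 hR)).symm
  obtain ⟨R, hR⟩ := (hR.eventually_const_lt hc).exists
  have hcont : Continuous fun x : Ed d => min (‖x‖ ^ 2) (R : ℝ) := by fun_prop
  have hbd : ∀ x : Ed d, |min (‖x‖ ^ 2) (R : ℝ)| ≤ R * (1 + ‖x‖) := fun x => by
    rw [abs_of_nonneg (le_min (by positivity) (by positivity))]
    exact (min_le_right _ _).trans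
      (le_mul_of_one_le_right (by positivity) (by linarith [norm_nonneg x]))
  have hlim := h.tendsto_integral hm (f := fun _ x => min (‖x‖ ^ 2) (R : ℝ))
    (Eventually.of_forall fun _ => hcont) hcont (Eventually.of_forall fun _ => hbd) hbd
    fun x => (hcont.tendsto x).comp tendsto_snd
  filter_upwards [hlim.eventually_const_lt hR, h.1] with i hi him
  have := him.1
  exact hi.trans_le (integral_mono (him.integrable_of_linear_growth hcont hbd)
    him.integrable_norm_sq fun x => min_le_left _ _)

lemma MTendsto.eventually_lt_log_secMom [l.IsCountablyGenerated] (h : MTendsto l μ m)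
    (hm : MemP d 2 m) {c : ℝ} (hc : c < Real.log (1 + secMom m)) :
    ∀ᶠ i in l, c < Real.log (1 + secMom (μ i)) := by
  have h1 : Real.exp c - 1 < secMom m := by
    have := (Real.lt_log_iff_exp_lt one_add_secMom_pos).1 hc
    linarith
  filter_upwards [h.eventually_lt_secMom hm h1] with i hi
  exact (Real.lt_log_iff_exp_lt one_add_secMom_pos).2 (by linarith)

lemma abs_secMom_sub_le {m' : Measure (Ed d)} {π : Measure (Ed d × Ed d)} [IsProbabilityMeasure π]
    (h : IsCoupling d π m m') (hm : MemP d 2 m) (hm' : MemP d 2 m') {a : ℝ} (ha : 0 < a) :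
    |secMom m' - secMom m| ≤ a * secMom m + (1 + 1 / a) * ∫ q, ‖q.1 - q.2‖ ^ 2 ∂π := by
  have i1 : Integrable (fun q : Ed d × Ed d => ‖q.1‖ ^ 2) π :=
    h.integrable_fst hm.integrable_norm_sq
  have i2 : Integrable (fun q : Ed d × Ed d => ‖q.2‖ ^ 2) π :=
    h.integrable_snd hm'.integrable_norm_sq
  have i3 : Integrable (fun q : Ed d × Ed d => ‖q.1 - q.2‖ ^ 2) π := h.integrable_dist_sq hm hm'
  have e1 : ∫ q : Ed d × Ed d, ‖q.1‖ ^ 2 ∂π = secMom m := h.integral_fst hm.integrable_norm_sq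
  have e2 : ∫ q : Ed d × Ed d, ‖q.2‖ ^ 2 ∂π = secMom m' := h.integral_snd hm'.integrable_norm_sq
  have e3 : a * (∫ q : Ed d × Ed d, ‖q.1‖ ^ 2 ∂π) +
      (1 + 1 / a) * (∫ q : Ed d × Ed d, ‖q.1 - q.2‖ ^ 2 ∂π) =
      ∫ q : Ed d × Ed d, (a * ‖q.1‖ ^ 2 + (1 + 1 / a) * ‖q.1 - q.2‖ ^ 2) ∂π := by
    rw [integral_add (i1.const_mul _) (i3.const_mul _), integral_const_mul, integral_const_mul]
  rw [← e1, ← e2, e3, ← integral_sub i2 i1]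
  rw [← Real.norm_eq_abs]
  refine norm_integral_le_of_norm_le ((i1.const_mul _).add (i3.const_mul _))
    (ae_of_all _ fun q => ?_)
  set x := ‖q.1‖
  set y := ‖q.2‖
  set D := ‖q.1 - q.2‖
  have hx : 0 ≤ x := norm_nonneg _
  have hy : 0 ≤ y := norm_nonneg _
  have hD : 0 ≤ D := norm_nonneg _
  have h1 : |x - y| ≤ D := abs_norm_sub_norm_le _ _
  have h2 : 2 * x * D ≤ a * x ^ 2 + 1 / a * D ^ 2 := by
    have : 0 ≤ (a * x - D) ^ 2 / a := by positivity
    have e : (a * x - D) ^ 2 / a = a * x ^ 2 - 2 * x * D + 1 / a * D ^ 2 := by field_simp; ring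
    linarith
  rw [Real.norm_eq_abs, show y ^ 2 - x ^ 2 = (y - x) * (x + y) by ring, abs_mul, abs_sub_comm,
    abs_of_nonneg (add_nonneg hx hy)]
  have h3 : x + y ≤ 2 * x + D := by linarith [neg_abs_le (x - y)]
  calc |x - y| * (x + y) ≤ D * (2 * x + D) :=
        mul_le_mul h1 h3 (add_nonneg hx hy) hD
    _ ≤ _ := by linarith

end SecondMoment

section WassersteinFilter

variable {d : ℕ} {m : Measure (Ed d)}

/-- The filter of `d_p`-neighbourhoods of `m` in `𝒫₂`. -/
def wFilter (d : ℕ) (p : ℝ) (m : Measure (Ed d)) : Filter (Measure (Ed d)) :=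
  comap (wdist d p m) (𝓝 0) ⊓ 𝓟 {μ | MemP d 2 μ}

instance (p : ℝ) : (wFilter d p m).IsCountablyGenerated := by unfold wFilter; infer_instance

lemma eventually_memP_wFilter (p : ℝ) : ∀ᶠ μ in wFilter d p m, MemP d 2 μ :=
  mem_inf_of_right (mem_principal_self _)

lemma tendsto_wdist_wFilter (p : ℝ) : Tendsto (wdist d p m) (wFilter d p m) (𝓝 0) :=
  tendsto_comap.mono_left inf_le_left

lemma mtendsto_wFilter_one : MTendsto (wFilter d 1 m) (fun μ => μ) m :=
  ⟨eventually_memP_wFilter 1, tendsto_wdist_wFilter 1⟩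

lemma mtendsto_wFilter_two (hm : MemP d 2 m) : MTendsto (wFilter d 2 m) (fun μ => μ) m :=
  ⟨eventually_memP_wFilter 2, squeeze_zero' (Eventually.of_forall fun _ => wdist_nonneg _)
    ((eventually_memP_wFilter 2).mono fun _ h => wdist_one_le_two hm h)
    (tendsto_wdist_wFilter 2)⟩

lemma tendsto_secMom_wFilter_two (hm : MemP d 2 m) :
    Tendsto secMom (wFilter d 2 m) (𝓝 (secMom m)) := by
  have := hm.1
  refine Metric.tendsto_nhds.2 fun ε hε => ?_
  set a := ε / (2 * (1 + secMom m))
  have ha : 0 < a := div_pos hε (mul_pos two_pos one_add_secMom_pos)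
  have ha' : a * secMom m < ε / 2 := by
    have : a * (1 + secMom m) = ε / 2 := by
      have := (one_add_secMom_pos (m := m)).ne'
      simp only [a]; field_simp
    linarith
  have hη : 0 < √(ε / 2 / (1 + 1 / a)) := Real.sqrt_pos.2 (by positivity)
  filter_upwards [eventually_memP_wFilter 2, (tendsto_wdist_wFilter 2).eventually_lt_const hη]
    with μ hμ h1
  obtain ⟨π, hπ, h2, h3⟩ := exists_coupling_of_wdist_two_lt hm.1 hμ.1 h1
  have h4 : ∫ q, ‖q.1 - q.2‖ ^ 2 ∂π < ε / 2 / (1 + 1 / a) :=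
    (Real.sqrt_lt_sqrt_iff (integral_nonneg fun _ => by positivity)).1 h3
  rw [lt_div_iff₀ (by positivity)] at h4
  exact (abs_secMom_sub_le h2 hm hμ ha).trans_lt (by linarith)

lemma exists_radius_of_eventually {p t : ℝ} {S : Set ℝ} {x : Ed d}
    {P : ℝ → Measure (Ed d) → Ed d → Prop}
    (h : ∀ᶠ q in 𝓝[S] t ×ˢ wFilter d p m ×ˢ 𝓝 x, P q.1 q.2.1 q.2.2) :
    ∃ η > (0 : ℝ), ∀ t' ∈ S, ∀ m' : Measure (Ed d), MemP d 2 m' → ∀ x' : Ed d,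
      |t' - t| < η → wdist d p m m' < η → ‖x' - x‖ < η → P t' m' x' := by
  obtain ⟨pa, ha, pb, hb, hab⟩ := eventually_prod_iff.1 h
  obtain ⟨pc, hc, pd, hd, hcd⟩ := eventually_prod_iff.1 hb
  obtain ⟨η₁, h1, H1⟩ := Metric.eventually_nhds_iff.1 (eventually_nhdsWithin_iff.1 ha)
  obtain ⟨η₂, h2, H2⟩ := Metric.eventually_nhds_iff.1
    (eventually_comap.1 (eventually_inf_principal.1 hc))
  obtain ⟨η₃, h3, H3⟩ := Metric.eventually_nhds_iff.1 hd
  refine ⟨min η₁ (min η₂ η₃), by positivity, fun t' ht' m' hm' x' h4 h5 h6 => ?_⟩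
  refine hab (H1 (h4.trans_le (min_le_left _ _)) ht') (hcd (H2 ?_ m' rfl hm') (H3 ?_))
  · rw [Real.dist_0_eq_abs, abs_of_nonneg (wdist_nonneg _)]
    exact h5.trans_le ((min_le_right _ _).trans (min_le_left _ _))
  · rw [dist_eq_norm]
    exact h6.trans_le ((min_le_right _ _).trans (min_le_right _ _))

end WassersteinFilter

section Penalization

variable {d : ℕ} {T t₁ : ℝ} {m : Measure (Ed d)} {FD : A1Data d T} {ΨD : A2Data d}

lemma contDiff_norm_sq_sub (c : ℝ) : ContDiff ℝ 2 fun x : Ed d => ‖x‖ ^ 2 - c :=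
  (contDiff_norm_sq ℝ).sub contDiff_const

lemma jet_norm_sq_sub (c : ℝ) (x : Ed d) : jet (fun x : Ed d => ‖x‖ ^ 2 - c) x =
    (‖x‖ ^ 2 - c, (2 : ℝ) • innerSL ℝ x, (2 : ℝ) • innerSL ℝ) := by
  have e : fderiv ℝ (fun x : Ed d => ‖x‖ ^ 2 - c) = (2 : ℝ) • (innerSL ℝ) := by
    ext1 y
    rw [fderiv_sub_const, fderiv_norm_sq_apply]
    simp [ofNat_smul_eq_nsmul]
  have e2 : fderiv ℝ (fderiv ℝ (fun x : Ed d => ‖x‖ ^ 2 - c)) x = (2 : ℝ) • innerSL ℝ := by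
    rw [e]
    exact ((2 : ℝ) • (innerSL ℝ : Ed d →L[ℝ] Ed d →L[ℝ] ℝ)).fderiv
  simp only [jet, e2]
  rw [e]
  rfl

lemma lapl_norm_sq_sub (c : ℝ) (x : Ed d) : lapl d (fun x : Ed d => ‖x‖ ^ 2 - c) x = 2 * d := by
  rw [lapl_eq, jet_norm_sq_sub]
  have h : ∀ i : Fin d, ((2 : ℝ) • (innerSL ℝ : Hess d)) (EuclideanSpace.single i (1 : ℝ))
      (EuclideanSpace.single i (1 : ℝ)) = 2 := fun i => by
    change (2 : ℝ) * inner ℝ (EuclideanSpace.single i (1 : ℝ)) (EuclideanSpace.single i (1 : ℝ)) = 2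
    rw [EuclideanSpace.inner_single_left]
    simp
  simp only [lap]
  rw [Finset.sum_congr rfl fun i _ => h i]
  simp [mul_comm]

lemma norm_jet_norm_sq_sub_le {c : ℝ} (hc : 0 ≤ c) (x : Ed d) :
    ‖jet (fun x : Ed d => ‖x‖ ^ 2 - c) x‖ ≤ 2 * (1 + c) * (1 + ‖x‖ ^ 2) := by
  rw [jet_norm_sq_sub]
  have hx := norm_nonneg x
  have h1 : ‖(innerSL ℝ : Hess d)‖ ≤ 1 := norm_innerSL_le ℝ
  refine norm_prod_le_iff.2 ⟨?_, norm_prod_le_iff.2 ⟨?_, ?_⟩⟩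
  · rw [Real.norm_eq_abs]
    refine abs_le.2 ⟨?_, ?_⟩ <;> nlinarith [sq_nonneg ‖x‖, mul_nonneg hc (sq_nonneg ‖x‖)]
  · rw [norm_smul, innerSL_apply_norm, Real.norm_of_nonneg zero_le_two]
    nlinarith [sq_nonneg (‖x‖ - 1), mul_nonneg hc (sq_nonneg ‖x‖)]
  · have h2 : ∀ A : Hess d, ‖(2 : ℝ) • A‖ = 2 * ‖A‖ := fun A => by
      rw [norm_smul, Real.norm_of_nonneg zero_le_two]
    refine (h2 (innerSL ℝ)).trans_le ?_
    nlinarith [sq_nonneg ‖x‖, mul_nonneg hc (sq_nonneg ‖x‖)]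

variable (FD ΨD) in
/-- The value function penalized by a multiple of `log (1 + ∫ |x|² dm) + (d + 1) (t₁ - t)`. -/
def penFn (t₁ ε t : ℝ) (m : Measure (Ed d)) : ℝ :=
  valueFn FD ΨD t₁ t m + ε * (Real.log (1 + secMom m) + (d + 1) * (t₁ - t))

variable (FD ΨD) in
/-- The linear derivative of `penFn`. -/
def penDeriv (t₁ ε t : ℝ) (m : Measure (Ed d)) (x : Ed d) : ℝ :=
  valueDeriv FD ΨD t₁ t m x + ε / (1 + secMom m) * (‖x‖ ^ 2 - secMom m)

lemma contDiff_penDeriv (ht₁ : t₁ ∈ Icc 0 T) {t : ℝ} (ht : t ∈ Icc 0 t₁) (hm : MemP d 2 m)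
    (ε : ℝ) : ContDiff ℝ 2 (penDeriv FD ΨD t₁ ε t m) :=
  (contDiff_valueDeriv ht₁ ht hm).1.add (contDiff_const.mul (contDiff_norm_sq_sub _))

lemma jet_penDeriv (ht₁ : t₁ ∈ Icc 0 T) {t : ℝ} (ht : t ∈ Icc 0 t₁) (hm : MemP d 2 m)
    (ε : ℝ) (x : Ed d) : jet (penDeriv FD ΨD t₁ ε t m) x = jet (valueDeriv FD ΨD t₁ t m) x +
      (ε / (1 + secMom m)) • jet (fun x : Ed d => ‖x‖ ^ 2 - secMom m) x := by
  rw [← jet_const_mul (contDiff_norm_sq_sub _)]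
  exact jet_add (contDiff_valueDeriv ht₁ ht hm).1
    (contDiff_const.mul (contDiff_norm_sq_sub _)) x

lemma tendsto_log_secMom_mix {m' : Measure (Ed d)} (hm : MemP d 2 m) (hm' : MemP d 2 m') :
    Tendsto (fun r => (Real.log (1 + secMom (mix r m m')) - Real.log (1 + secMom m)) / r)
      (𝓝[>] 0) (𝓝 ((secMom m' - secMom m) / (1 + secMom m))) := by
  have h1 : HasDerivAt (fun r : ℝ => Real.log (1 + (secMom m + r * (secMom m' - secMom m))))
      ((secMom m' - secMom m) / (1 + secMom m)) 0 := by
    have h2 : HasDerivAt (fun r : ℝ => 1 + (secMom m + r * (secMom m' - secMom m)))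
        (secMom m' - secMom m) 0 := by
      simpa using (((hasDerivAt_id (0 : ℝ)).mul_const _).const_add (secMom m)).const_add 1
    have h3 := h2.log (by simpa using one_add_secMom_pos.ne')
    simpa using h3
  have h2 := (hasDerivAt_iff_tendsto_slope.1 h1).mono_left
    (nhdsWithin_mono (0 : ℝ) fun r (hr : 0 < r) => hr.ne')
  refine h2.congr' ?_
  filter_upwards [Ioo_mem_nhdsGT one_pos] with r hr
  rw [secMom_mix hm hm' (Ioo_subset_Icc_self hr), slope_def_field]
  simp

/-- The penalized value function as a test function. -/
def penTestFn (FD : A1Data d T) (ΨD : A2Data d) (ht₁ : t₁ ∈ Icc 0 T) {ε : ℝ} (hε : 0 < ε) :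
    TestFn d t₁ where
  φ := penFn FD ΨD t₁ ε
  φt := fun t m => valueTime FD ΨD t₁ t m - ε * (d + 1)
  δφ := penDeriv FD ΨD t₁ ε
  lsc := by
    intro t ht m hm δ hδ
    obtain ⟨η, hη, h⟩ := exists_radius_of_eventually (S := Icc 0 t₁) (p := 1) (t := t) (m := m)
      (x := 0) (P := fun t' m' _ => penFn FD ΨD t₁ ε t m - δ < penFn FD ΨD t₁ ε t' m') (by
        have hl : Tendsto (fun q : ℝ × Measure (Ed d) × Ed d => q.1)
          (𝓝[Icc 0 t₁] t ×ˢ wFilter d 1 m ×ˢ 𝓝 0) (𝓝[Icc 0 t₁] t) := tendsto_fst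
        obtain ⟨ht0, htm⟩ := tendsto_nhdsWithin_iff.1 hl
        have hμ := (mtendsto_wFilter_one (m := m)).comp (tendsto_fst.comp
          (tendsto_snd (f := 𝓝[Icc 0 t₁] t) (g := wFilter d 1 m ×ˢ 𝓝 (0 : Ed d))))
        have h1 := tendsto_valueFn (FD := FD) (ΨD := ΨD) ht₁ ht hm ht0 htm hμ
        have h2 := h1.add ((tendsto_const_nhds (x := t₁)).sub ht0 |>.const_mul
          (ε * ((d : ℝ) + 1)))
        have h3 := hμ.eventually_lt_log_secMom hm
          (sub_lt_self (Real.log (1 + secMom m)) (show 0 < δ / (2 * ε) by positivity))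
        filter_upwards [h3, h2.eventually_const_lt (sub_lt_self _ (half_pos hδ))] with q h4 h5
        have h6 := mul_lt_mul_of_pos_left h4 hε
        have h7 : ε * (δ / (2 * ε)) = δ / 2 := by field_simp
        simp only [Function.comp_apply] at h5 h6
        simp only [penFn]
        linarith)
    exact ⟨η, hη, fun t' ht' m' hm' h1 h2 => h t' ht' m' hm' 0 h1 h2 (by simpa using hη)⟩
  d2cont := by
    intro t ht m hm δ hδ
    obtain ⟨η, hη, h⟩ := exists_radius_of_eventually (S := Icc 0 t₁) (p := 2) (t := t) (m := m)
      (x := 0) (P := fun t' m' _ => |penFn FD ΨD t₁ ε t' m' - penFn FD ΨD t₁ ε t m| < δ) (by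
        have hl : Tendsto (fun q : ℝ × Measure (Ed d) × Ed d => q.1)
          (𝓝[Icc 0 t₁] t ×ˢ wFilter d 2 m ×ˢ 𝓝 0) (𝓝[Icc 0 t₁] t) := tendsto_fst
        obtain ⟨ht0, htm⟩ := tendsto_nhdsWithin_iff.1 hl
        have hsnd := tendsto_fst.comp
          (tendsto_snd (f := 𝓝[Icc 0 t₁] t) (g := wFilter d 2 m ×ˢ 𝓝 (0 : Ed d)))
        have hs := (tendsto_secMom_wFilter_two hm).comp hsnd
        exact Metric.tendsto_nhds.1 ((tendsto_valueFn (FD := FD) (ΨD := ΨD) ht₁ ht hm ht0 htm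
          ((mtendsto_wFilter_two hm).comp hsnd)).add (((((tendsto_const_nhds (x := (1 : ℝ))).add
          hs).log one_add_secMom_pos.ne').add ((tendsto_const_nhds.sub ht0).const_mul
          ((d : ℝ) + 1))).const_mul ε)) δ hδ)
    exact ⟨η, hη, fun t' ht' m' hm' h1 h2 => h t' ht' m' hm' 0 h1 h2 (by simpa using hη)⟩
  timeDeriv := by
    intro m hm t ht
    have h1 := hasDerivWithinAt_valueFn (FD := FD) (ΨD := ΨD) ht₁ (Ico_subset_Icc_self ht) hm
    have h2 := (((hasDerivWithinAt_id t (Icc 0 t₁)).const_sub t₁).const_mul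
      ((d : ℝ) + 1)).const_add (Real.log (1 + secMom m)) |>.const_mul ε
    exact (h1.add h2).congr_deriv (by ring)
  measDeriv := by
    intro t ht m hm m' hm'
    have := hm'.1
    have ht := Ico_subset_Icc_self ht
    obtain ⟨C, hC0, hC⟩ := exists_valueDeriv_bound FD ΨD ht₁
    have h1 := tendsto_valueFn_mix (FD := FD) (ΨD := ΨD) ht₁ ht hm hm'
    have h2 := (tendsto_log_secMom_mix hm hm').const_mul ε
    have e : ∫ x, penDeriv FD ΨD t₁ ε t m x ∂m' = ∫ x, valueDeriv FD ΨD t₁ t m x ∂m' +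
        ε * ((secMom m' - secMom m) / (1 + secMom m)) := by
      have hq : Integrable (fun x : Ed d => ‖x‖ ^ 2 - secMom m) m' :=
        hm'.integrable_norm_sq.sub (integrable_const _)
      simp only [penDeriv]
      rw [integral_add (hm'.integrable_of_linear_growth
        (contDiff_valueDeriv ht₁ ht hm).1.continuous
        fun x => (norm_jet_le_iff.1 (hC _ ht m hm x)).1)
        (hq.const_mul _), integral_const_mul,
        integral_sub hm'.integrable_norm_sq (integrable_const _)]
      simp [secMom]
      ring
    rw [e]
    refine (h1.add h2).congr fun r => ?_
    simp only [penFn, mix]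
    ring
  normalized := by
    intro t ht m hm
    have := hm.1
    have ht := Ico_subset_Icc_self ht
    obtain ⟨C, hC0, hC⟩ := exists_valueDeriv_bound FD ΨD ht₁
    have hq : Integrable (fun x : Ed d => ‖x‖ ^ 2 - secMom m) m :=
      hm.integrable_norm_sq.sub (integrable_const _)
    simp only [penDeriv]
    rw [integral_add (hm.integrable_of_linear_growth
      (contDiff_valueDeriv ht₁ ht hm).1.continuous
      fun x => (norm_jet_le_iff.1 (hC _ ht m hm x)).1)
      (hq.const_mul _), integral_const_mul,
      integral_sub hm.integrable_norm_sq (integrable_const _), integral_valueDeriv_self ht₁ ht hm]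
    simp [secMom]
  smoothX := fun t ht m hm => contDiff_penDeriv ht₁ (Ico_subset_Icc_self ht) hm ε
  quadGrowth := by
    obtain ⟨C, hC0, hC⟩ := exists_valueDeriv_bound FD ΨD ht₁
    refine ⟨2 * C + 2 * ε, fun t ht m hm x => norm_jet_le_iff.1 ?_⟩
    have ht := Ico_subset_Icc_self ht
    rw [jet_penDeriv ht₁ ht hm]
    refine (norm_add_le _ _).trans ?_
    rw [norm_smul, Real.norm_of_nonneg (div_nonneg hε.le one_add_secMom_pos.le), add_mul]
    refine add_le_add ((hC t ht m hm x).trans ?_) ?_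
    · nlinarith [mul_nonneg hC0 (sq_nonneg (‖x‖ - 1))]
    · refine (mul_le_mul_of_nonneg_left (norm_jet_norm_sq_sub_le secMom_nonneg x)
        (div_nonneg hε.le one_add_secMom_pos.le)).trans_eq ?_
      have := (one_add_secMom_pos (m := m)).ne'
      field_simp
  d2contDeriv := by
    intro t ht m hm x δ hδ
    have ht' := Ico_subset_Icc_self ht
    obtain ⟨η, hη, h⟩ := exists_radius_of_eventually (S := Ico 0 t₁) (p := 2) (t := t) (m := m)
      (x := x) (P := fun t' m' x' => |(valueTime FD ΨD t₁ t' m' - ε * (d + 1)) -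
        (valueTime FD ΨD t₁ t m - ε * (d + 1))| < δ ∧
        dist (jet (penDeriv FD ΨD t₁ ε t' m') x') (jet (penDeriv FD ΨD t₁ ε t m) x) < δ) (by
        have hl : Tendsto (fun q : ℝ × Measure (Ed d) × Ed d => q.1)
          (𝓝[Ico 0 t₁] t ×ˢ wFilter d 2 m ×ˢ 𝓝 x) (𝓝[Ico 0 t₁] t) := tendsto_fst
        obtain ⟨ht0, htm⟩ := tendsto_nhdsWithin_iff.1 hl
        have htm := htm.mono fun _ h => Ico_subset_Icc_self h
        have hsnd := tendsto_fst.comp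
          (tendsto_snd (f := 𝓝[Ico 0 t₁] t) (g := wFilter d 2 m ×ˢ 𝓝 x))
        have hx := tendsto_snd.comp
          (tendsto_snd (f := 𝓝[Ico 0 t₁] t) (g := wFilter d 2 m ×ˢ 𝓝 x))
        have hs := (tendsto_secMom_wFilter_two hm).comp hsnd
        have hμ := (mtendsto_wFilter_two hm).comp hsnd
        have h1 := (tendsto_valueTime (FD := FD) (ΨD := ΨD) ht₁ ht' hm ht0 htm hμ).sub
          (tendsto_const_nhds (x := ε * ((d : ℝ) + 1)))
        have hinn : Tendsto (fun q : ℝ × Measure (Ed d) × Ed d => innerSL ℝ q.2.2)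
            (𝓝[Ico 0 t₁] t ×ˢ wFilter d 2 m ×ˢ 𝓝 x) (𝓝 (innerSL ℝ x)) :=
          ((innerSL ℝ).continuous.tendsto x).comp hx
        have h2 : Tendsto (fun q : ℝ × Measure (Ed d) × Ed d =>
            jet (fun y : Ed d => ‖y‖ ^ 2 - secMom q.2.1) q.2.2)
            (𝓝[Ico 0 t₁] t ×ˢ wFilter d 2 m ×ˢ 𝓝 x)
            (𝓝 (jet (fun y : Ed d => ‖y‖ ^ 2 - secMom m) x)) := by
          simp only [jet_norm_sq_sub]
          exact ((hx.norm.pow 2).sub hs).prodMk_nhds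
            ((hinn.const_smul (2 : ℝ)).prodMk_nhds tendsto_const_nhds)
        have h3 := (tendsto_jet_valueDeriv (FD := FD) (ΨD := ΨD) ht₁ ht' hm ht0 htm hμ hx).add
          (((tendsto_const_nhds (x := ε)).div ((tendsto_const_nhds (x := (1 : ℝ))).add hs)
            one_add_secMom_pos.ne').smul h2)
        filter_upwards [Metric.tendsto_nhds.1 h1 δ hδ, Metric.tendsto_nhds.1 h3 δ hδ, htm, hμ.1]
          with q h4 h5 h6 h7
        have h7 : MemP d 2 q.2.1 := h7
        refine ⟨h4, ?_⟩
        rw [jet_penDeriv ht₁ ht' hm, jet_penDeriv ht₁ h6 h7]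
        exact h5)
    refine ⟨η, hη, fun t' ht' m' hm' x' h1 h2 h3 => ?_⟩
    obtain ⟨h4, h5⟩ := h t' ht' m' hm' x' h1 h2 h3
    exact ⟨h4, dist_jet_lt_iff.1 h5⟩

/-- The penalized value function is a strict supersolution. -/
lemma penTestFn_operator_lt_zero (ht₁ : t₁ ∈ Icc 0 T) {ε : ℝ} (hε : 0 < ε) {t : ℝ}
    (ht : t ∈ Icc 0 t₁) (hm : MemP d 2 m) :
    (penTestFn FD ΨD ht₁ hε).φt t m +
      (1 / 2) * (∫ x, lapl d ((penTestFn FD ΨD ht₁ hε).δφ t m) x ∂m) + FD.F t m < 0 := by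
  have := hm.1
  obtain ⟨C, hC0, hC⟩ := exists_valueDeriv_bound FD ΨD ht₁
  have e : ∀ x, lapl d (penDeriv FD ΨD t₁ ε t m) x = lapl d (valueDeriv FD ΨD t₁ t m) x +
      ε / (1 + secMom m) * (2 * d) := fun x => by
    have h1 := lapl_norm_sq_sub (secMom m) x
    rw [lapl_eq] at h1
    rw [lapl_eq, lapl_eq, jet_penDeriv ht₁ ht hm, ← h1]
    simp [lap, Finset.sum_add_distrib, Finset.mul_sum]
  have hi : Integrable (lapl d (valueDeriv FD ΨD t₁ t m)) m := by
    refine hm.integrable_of_linear_growth (c := d * C) ?_ fun x => ?_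
    · simp only [funext (lapl_eq _)]
      exact continuous_lap.comp (contDiff_valueDeriv ht₁ ht hm).1.continuous_jet.snd.snd
    · rw [mul_assoc]
      exact (abs_lapl_le _ x).trans (mul_le_mul_of_nonneg_left (hC t ht m hm x) (by positivity))
  change valueTime FD ΨD t₁ t m - ε * (d + 1) +
    (1 / 2) * (∫ x, lapl d (penDeriv FD ΨD t₁ ε t m) x ∂m) + FD.F t m < 0
  simp only [e]
  rw [integral_add hi (integrable_const _), valueTime]
  simp only [integral_const, probReal_univ, one_smul]
  have h2 : ε / (1 + secMom m) * d ≤ ε * d :=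
    mul_le_mul_of_nonneg_right (div_le_self hε.le (by linarith [secMom_nonneg (m := m)]))
      (by positivity)
  linarith

end Penalization

section DensityCoupling

variable {d : ℕ} {m m' : Measure (Ed d)} [IsProbabilityMeasure m] [IsProbabilityMeasure m']
  {w : Ed d × Ed d → ℝ}

lemma isCoupling_withDensity (hw : Continuous w) (hw0 : ∀ q, 0 ≤ w q) {C : ℝ}
    (hC : ∀ q, |w q| ≤ C) (h1 : ∀ x, ∫ y, w (x, y) ∂m' = 1) (h2 : ∀ y, ∫ x, w (x, y) ∂m = 1) :
    IsCoupling d ((m.prod m').withDensity fun q => ENNReal.ofReal (w q)) m m' := by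
  have hmeas : Measurable fun q => ENNReal.ofReal (w q) := hw.measurable.ennreal_ofReal
  have e1 : ∀ x, ∫⁻ y, ENNReal.ofReal (w (x, y)) ∂m' = 1 := fun x => by
    have hi : Integrable (fun y => w (x, y)) m' :=
      (integrable_const C).mono' (by fun_prop) (ae_of_all _ fun y => hC _)
    rw [← ofReal_integral_eq_lintegral_ofReal hi (ae_of_all _ fun y => hw0 _), h1]
    simp
  have e2 : ∀ y, ∫⁻ x, ENNReal.ofReal (w (x, y)) ∂m = 1 := fun y => by
    have hi : Integrable (fun x => w (x, y)) m :=
      (integrable_const C).mono' (by fun_prop) (ae_of_all _ fun x => hC _)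
    rw [← ofReal_integral_eq_lintegral_ofReal hi (ae_of_all _ fun x => hw0 _), h2]
    simp
  constructor
  · ext s hs
    rw [Measure.map_apply measurable_fst hs, withDensity_apply _ (measurable_fst hs),
      ← prod_univ, ← Measure.prod_restrict, Measure.restrict_univ,
      lintegral_prod _ hmeas.aemeasurable]
    simp [e1]
  · ext s hs
    rw [Measure.map_apply measurable_snd hs, withDensity_apply _ (measurable_snd hs),
      ← univ_prod, ← Measure.prod_restrict, Measure.restrict_univ,
      lintegral_prod_symm _ hmeas.aemeasurable]
    simp [e2]

lemma wdist_one_le_integral_density (hw : Continuous w) (hw0 : ∀ q, 0 ≤ w q) {C : ℝ}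
    (hC : ∀ q, |w q| ≤ C) (h1 : ∀ x, ∫ y, w (x, y) ∂m' = 1) (h2 : ∀ y, ∫ x, w (x, y) ∂m = 1) :
    wdist d 1 m m' ≤ ∫ q : Ed d × Ed d, w q * ‖q.1 - q.2‖ ∂m.prod m' := by
  have h := isCoupling_withDensity hw hw0 hC h1 h2
  have hp : IsProbabilityMeasure ((m.prod m').withDensity fun q => ENNReal.ofReal (w q)) := by
    refine ⟨?_⟩
    have := congrArg (fun μ => μ univ) h.1
    rw [Measure.map_apply measurable_fst .univ] at this
    simpa using this
  refine (wdist_one_le h).trans_eq ?_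
  rw [integral_withDensity_eq_integral_toReal_smul hw.measurable.ennreal_ofReal
    (ae_of_all _ fun q => ENNReal.ofReal_lt_top)]
  simp [ENNReal.toReal_ofReal (hw0 _)]

end DensityCoupling

section PartitionCoupling

variable {d : ℕ} {m m' : Measure (Ed d)} {ι : Type*}

lemma wdist_one_le_of_partition [Fintype ι] (hm : MemP d 2 m) (hm' : MemP d 2 m')
    {χ : ι → Ed d → ℝ} (hχ : ∀ i, Continuous (χ i)) (hχ0 : ∀ i x, 0 ≤ χ i x)
    (hχ1 : ∀ x, ∑ i, χ i x ≤ 1) {ε : ℝ} (hε : 0 ≤ ε)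
    (hsupp : ∀ i x y, χ i x ≠ 0 → χ i y ≠ 0 → ‖x - y‖ ≤ ε)
    {κ R : ℝ} (hκ : 0 < κ) (hκ1 : κ ≤ 1) (hR : 0 < R) :
    wdist d 1 m m' ≤ ε +
      2 * R * (1 - (1 - κ) * ∑ i, min (∫ x, χ i x ∂m) (∫ x, χ i x ∂m')) +
      (secMom m + secMom m') / R := by
  have := hm.1
  have := hm'.1
  have hle : ∀ i x, χ i x ≤ 1 := fun i x =>
    (Finset.single_le_sum (fun j _ => hχ0 j x) (Finset.mem_univ i)).trans (hχ1 x)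
  have hint : ∀ (μ : Measure (Ed d)) [IsProbabilityMeasure μ] i, Integrable (χ i) μ :=
    fun μ _ i => (integrable_const (1 : ℝ)).mono' (hχ i).aestronglyMeasurable
      (ae_of_all _ fun x => by rw [Real.norm_of_nonneg (hχ0 i x)]; exact hle i x)
  set a : ι → ℝ := fun i => ∫ x, χ i x ∂m with ha
  set b : ι → ℝ := fun i => ∫ x, χ i x ∂m' with hb
  have ha0 : ∀ i, 0 ≤ a i := fun i => integral_nonneg (hχ0 i)
  have hb0 : ∀ i, 0 ≤ b i := fun i => integral_nonneg (hχ0 i)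
  have hk : 0 ≤ 1 - κ := by linarith
  set σ : ι → ℝ := fun i => (1 - κ) * min (a i) (b i) with hσ
  have hmin0 : ∀ i, 0 ≤ min (a i) (b i) := fun i => le_min (ha0 i) (hb0 i)
  have hσ0 : ∀ i, 0 ≤ σ i := fun i => mul_nonneg hk (hmin0 i)
  have hσa : ∀ i, σ i ≤ (1 - κ) * a i := fun i => mul_le_mul_of_nonneg_left (min_le_left _ _) hk
  have hσa' : ∀ i, σ i ≤ a i := fun i => (hσa i).trans (by nlinarith [ha0 i])
  have hσb' : ∀ i, σ i ≤ b i := fun i =>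
    (mul_le_mul_of_nonneg_left (min_le_right _ _) hk).trans (by nlinarith [hb0 i])
  have hσ_a : ∀ i, a i = 0 → σ i = 0 := fun i h => le_antisymm (h ▸ hσa' i) (hσ0 i)
  have hσ_b : ∀ i, b i = 0 → σ i = 0 := fun i h => le_antisymm (h ▸ hσb' i) (hσ0 i)
  set α : ι → ℝ := fun i => σ i / a i with hα
  set β : ι → ℝ := fun i => σ i / b i with hβ
  set γ : ι → ℝ := fun i => σ i / (a i * b i) with hγ
  have hα0 : ∀ i, 0 ≤ α i := fun i => div_nonneg (hσ0 i) (ha0 i)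
  have hβ0 : ∀ i, 0 ≤ β i := fun i => div_nonneg (hσ0 i) (hb0 i)
  have hγ0 : ∀ i, 0 ≤ γ i := fun i => div_nonneg (hσ0 i) (mul_nonneg (ha0 i) (hb0 i))
  have hα1 : ∀ i, α i ≤ 1 := fun i => div_le_one_of_le₀ (hσa' i) (ha0 i)
  have hβ1 : ∀ i, β i ≤ 1 := fun i => div_le_one_of_le₀ (hσb' i) (hb0 i)
  have hαa : ∀ i, α i * a i = σ i := fun i => by
    by_cases h : a i = 0
    · rw [h, mul_zero, hσ_a i h]
    · exact div_mul_cancel₀ _ h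
  have hβb : ∀ i, β i * b i = σ i := fun i => by
    by_cases h : b i = 0
    · rw [h, mul_zero, hσ_b i h]
    · exact div_mul_cancel₀ _ h
  have hγb : ∀ i, γ i * b i = α i := fun i => by
    by_cases h : b i = 0
    · simp [hα, h, hσ_b i h]
    · simp only [hγ, hα]
      rw [div_mul_eq_mul_div, mul_div_mul_right _ _ h]
  have hγa : ∀ i, γ i * a i = β i := fun i => by
    by_cases h : a i = 0
    · simp [hβ, h, hσ_a i h]
    · simp only [hγ, hβ]
      rw [div_mul_eq_mul_div, mul_comm (a i), mul_div_mul_right _ _ h]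
  have hsum_a : ∑ i, a i ≤ 1 := by
    simp only [ha]
    rw [← integral_finsetSum _ fun i _ => hint m i]
    refine (integral_mono (integrable_finsetSum _ fun i _ => hint m i)
      (integrable_const (1 : ℝ)) hχ1).trans_eq (by simp)
  set ρ : ℝ := 1 - ∑ i, σ i with hρdef
  have hρ : 0 < ρ := by
    have : ∑ i, σ i ≤ (1 - κ) * ∑ i, a i := by
      rw [Finset.mul_sum]
      exact Finset.sum_le_sum fun i _ => hσa i
    nlinarith
  set U : Ed d → ℝ := fun x => 1 - ∑ i, α i * χ i x with hU
  set V : Ed d → ℝ := fun x => 1 - ∑ i, β i * χ i x with hV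
  have hU1 : ∀ x, U x ≤ 1 := fun x => by
    have := Finset.sum_nonneg fun i (_ : i ∈ Finset.univ) => mul_nonneg (hα0 i) (hχ0 i x)
    simp only [hU]; linarith
  have hV1 : ∀ x, V x ≤ 1 := fun x => by
    have := Finset.sum_nonneg fun i (_ : i ∈ Finset.univ) => mul_nonneg (hβ0 i) (hχ0 i x)
    simp only [hV]; linarith
  have hU0 : ∀ x, 0 ≤ U x := fun x => by
    have : ∑ i, α i * χ i x ≤ ∑ i, χ i x := Finset.sum_le_sum fun i _ =>
      mul_le_of_le_one_left (hχ0 i x) (hα1 i)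
    simp only [hU]; linarith [hχ1 x]
  have hV0 : ∀ x, 0 ≤ V x := fun x => by
    have : ∑ i, β i * χ i x ≤ ∑ i, χ i x := Finset.sum_le_sum fun i _ =>
      mul_le_of_le_one_left (hχ0 i x) (hβ1 i)
    simp only [hV]; linarith [hχ1 x]
  have hUc : Continuous U := by simp only [hU]; fun_prop
  have hVc : Continuous V := by simp only [hV]; fun_prop
  have hUi : Integrable U m := (integrable_const (1 : ℝ)).mono' hUc.aestronglyMeasurable
    (ae_of_all _ fun x => by rw [Real.norm_of_nonneg (hU0 x)]; exact hU1 x)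
  have hVi : Integrable V m' := (integrable_const (1 : ℝ)).mono' hVc.aestronglyMeasurable
    (ae_of_all _ fun x => by rw [Real.norm_of_nonneg (hV0 x)]; exact hV1 x)
  have hUint : ∫ x, U x ∂m = ρ := by
    simp only [hU]
    rw [integral_sub (integrable_const _) (integrable_finsetSum _ fun i _ =>
      (hint m i).const_mul _), integral_finsetSum _ fun i _ => (hint m i).const_mul _]
    simp only [integral_const_mul]
    rw [Finset.sum_congr rfl fun i _ => hαa i]
    simp [hρdef]
  have hVint : ∫ x, V x ∂m' = ρ := by
    simp only [hV]
    rw [integral_sub (integrable_const _) (integrable_finsetSum _ fun i _ =>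
      (hint m' i).const_mul _), integral_finsetSum _ fun i _ => (hint m' i).const_mul _]
    simp only [integral_const_mul]
    rw [Finset.sum_congr rfl fun i _ => hβb i]
    simp [hρdef]
  set P : Ed d × Ed d → ℝ := fun q => ∑ i, γ i * (χ i q.1 * χ i q.2) with hP
  set w : Ed d × Ed d → ℝ := fun q => P q + U q.1 * V q.2 / ρ with hw
  have hP0 : ∀ q, 0 ≤ P q := fun q => Finset.sum_nonneg fun i _ =>
    mul_nonneg (hγ0 i) (mul_nonneg (hχ0 i _) (hχ0 i _))
  have hUV0 : ∀ q : Ed d × Ed d, 0 ≤ U q.1 * V q.2 / ρ := fun q =>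
    div_nonneg (mul_nonneg (hU0 _) (hV0 _)) hρ.le
  have hw0 : ∀ q, 0 ≤ w q := fun q => add_nonneg (hP0 q) (hUV0 q)
  have hwc : Continuous w := by simp only [hw, hP]; fun_prop
  have hwC : ∀ q, |w q| ≤ ∑ i, γ i + 1 / ρ := fun q => by
    rw [abs_of_nonneg (hw0 q)]
    refine add_le_add (Finset.sum_le_sum fun i _ => mul_le_of_le_one_right (hγ0 i)
      (mul_le_one₀ (hle i _) (hχ0 i _) (hle i _))) ?_
    exact div_le_div_of_nonneg_right (mul_le_one₀ (hU1 _) (hV0 _) (hV1 _)) hρ.le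
  have h1 : ∀ x, ∫ y, w (x, y) ∂m' = 1 := fun x => by
    simp only [hw, hP]
    rw [integral_add (integrable_finsetSum _ fun i _ => ((hint m' i).const_mul _).const_mul _)
      ((hVi.const_mul _).div_const _), integral_finsetSum _ fun i _ =>
      ((hint m' i).const_mul _).const_mul _, integral_div, integral_const_mul, hVint]
    simp only [integral_const_mul]
    rw [mul_div_cancel_right₀ _ hρ.ne', Finset.sum_congr rfl fun i _ =>
      show γ i * (χ i x * b i) = α i * χ i x by rw [← hγb i]; ring]
    simp [hU]
  have h2 : ∀ y, ∫ x, w (x, y) ∂m = 1 := fun y => by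
    simp only [hw, hP]
    rw [integral_add (integrable_finsetSum _ fun i _ => ((hint m i).mul_const _).const_mul _)
      ((hUi.mul_const _).div_const _), integral_finsetSum _ fun i _ =>
      ((hint m i).mul_const _).const_mul _, integral_div, integral_mul_const, hUint]
    simp only [integral_const_mul, integral_mul_const]
    rw [mul_div_cancel_left₀ _ hρ.ne', Finset.sum_congr rfl fun i _ =>
      show γ i * (a i * χ i y) = β i * χ i y by rw [← hγa i]; ring]
    simp [hV]
  have hwi : Integrable w (m.prod m') := (integrable_const (∑ i, γ i + 1 / ρ)).mono'
    hwc.aestronglyMeasurable (ae_of_all _ hwC)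
  have hwint : ∫ q, w q ∂m.prod m' = 1 := by
    rw [integral_prod _ hwi]
    simp [h1]
  have hUi2 : Integrable (fun x => ‖x‖ ^ 2 * U x) m := hm.integrable_norm_sq.mono'
    (by fun_prop) (ae_of_all _ fun x => by
      rw [Real.norm_of_nonneg (mul_nonneg (by positivity) (hU0 x))]
      exact mul_le_of_le_one_right (by positivity) (hU1 x))
  have hVi2 : Integrable (fun x => ‖x‖ ^ 2 * V x) m' := hm'.integrable_norm_sq.mono'
    (by fun_prop) (ae_of_all _ fun x => by
      rw [Real.norm_of_nonneg (mul_nonneg (by positivity) (hV0 x))]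
      exact mul_le_of_le_one_right (by positivity) (hV1 x))
  have hUle : ∫ x, ‖x‖ ^ 2 * U x ∂m ≤ secMom m := integral_mono hUi2 hm.integrable_norm_sq
    fun x => mul_le_of_le_one_right (by positivity) (hU1 x)
  have hVle : ∫ x, ‖x‖ ^ 2 * V x ∂m' ≤ secMom m' := integral_mono hVi2 hm'.integrable_norm_sq
    fun x => mul_le_of_le_one_right (by positivity) (hV1 x)
  have g1 := hwi.const_mul ε
  have g2 := (hUi.mul_prod hVi).const_mul (2 * R / ρ)
  have g3 := (hUi2.mul_prod hVi).const_mul (1 / (R * ρ))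
  have g4 := (hUi.mul_prod hVi2).const_mul (1 / (R * ρ))
  have key : ∀ q : Ed d × Ed d, ‖w q * ‖q.1 - q.2‖‖ ≤ ε * w q + 2 * R / ρ * (U q.1 * V q.2) +
      1 / (R * ρ) * (‖q.1‖ ^ 2 * U q.1 * V q.2) + 1 / (R * ρ) * (U q.1 * (‖q.2‖ ^ 2 * V q.2)) := by
    intro q
    rw [Real.norm_of_nonneg (mul_nonneg (hw0 q) (norm_nonneg _))]
    have k1 : P q * ‖q.1 - q.2‖ ≤ ε * P q := by
      simp only [hP]
      rw [Finset.sum_mul, Finset.mul_sum]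
      refine Finset.sum_le_sum fun i _ => ?_
      by_cases hz : χ i q.1 * χ i q.2 = 0
      · simp [hz]
      · rw [mul_comm]
        exact mul_le_mul_of_nonneg_right
          (hsupp i _ _ (left_ne_zero_of_mul hz) (right_ne_zero_of_mul hz))
          (mul_nonneg (hγ0 i) (mul_nonneg (hχ0 i _) (hχ0 i _)))
    have k2 : ∀ x : Ed d, ‖x‖ ≤ R + ‖x‖ ^ 2 / R := fun x => by
      have e : R + ‖x‖ ^ 2 / R - ‖x‖ = ((R - ‖x‖) ^ 2 + R * ‖x‖) / R := by field_simp; ring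
      have : 0 ≤ ((R - ‖x‖) ^ 2 + R * ‖x‖) / R := by positivity
      linarith
    have k3 : ‖q.1 - q.2‖ ≤ 2 * R + (‖q.1‖ ^ 2 + ‖q.2‖ ^ 2) / R := by
      have := norm_sub_le q.1 q.2
      rw [add_div]
      linarith [k2 q.1, k2 q.2]
    calc w q * ‖q.1 - q.2‖ = P q * ‖q.1 - q.2‖ + U q.1 * V q.2 / ρ * ‖q.1 - q.2‖ := by
          simp only [hw]; ring
      _ ≤ ε * w q + U q.1 * V q.2 / ρ * (2 * R + (‖q.1‖ ^ 2 + ‖q.2‖ ^ 2) / R) := by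
          refine add_le_add (k1.trans (mul_le_mul_of_nonneg_left ?_ hε))
            (mul_le_mul_of_nonneg_left k3 (hUV0 q))
          exact le_add_of_nonneg_right (hUV0 q)
      _ = _ := by field_simp; ring
  have hfin := norm_integral_le_of_norm_le (((g1.add g2).add g3).add g4) (ae_of_all _ key)
  refine (wdist_one_le_integral_density hwc hw0 hwC h1 h2).trans
    ((le_abs_self _).trans (hfin.trans ?_))
  rw [integral_add' ((g1.add g2).add g3) g4, integral_add' (g1.add g2) g3, integral_add' g1 g2]
  simp only [integral_const_mul]
  rw [integral_prod_mul U V, integral_prod_mul (fun x => ‖x‖ ^ 2 * U x) V,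
    integral_prod_mul U (fun y => ‖y‖ ^ 2 * V y), hwint, hUint, hVint]
  have hρe : 1 - (1 - κ) * ∑ i, min (a i) (b i) = ρ := by
    simp only [hρdef, hσ, Finset.mul_sum]
  rw [hρe]
  set A := ∫ x, ‖x‖ ^ 2 * U x ∂m
  set B := ∫ x, ‖x‖ ^ 2 * V x ∂m'
  have : ε * 1 + 2 * R / ρ * (ρ * ρ) + 1 / (R * ρ) * (A * ρ) + 1 / (R * ρ) * (ρ * B) =
      ε + 2 * R * ρ + (A + B) / R := by
    field_simp
    ring
  rw [this]
  gcongr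

end PartitionCoupling

section Compactness

variable {d : ℕ}

lemma exists_partition (d : ℕ) {R ε : ℝ} (hε : 0 < ε) :
    ∃ (t : Finset (Ed d)) (χ : t → Ed d → ℝ), (∀ i, Continuous (χ i)) ∧ (∀ i x, 0 ≤ χ i x) ∧
      (∀ x, ∑ i, χ i x ≤ 1) ∧ (∀ i x y, χ i x ≠ 0 → χ i y ≠ 0 → ‖x - y‖ ≤ ε) ∧
      ∀ x, ‖x‖ ≤ R → ∑ i, χ i x = 1 := by
  obtain ⟨t₀, -, hfin, hcov⟩ := finite_cover_balls_of_compact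
    (isCompact_closedBall (0 : Ed d) R) (show 0 < ε / 4 by positivity)
  set t := hfin.toFinset
  set η : t → Ed d → ℝ := fun c x => max 0 (ε / 2 - ‖x - c‖) with hη
  have hη0 : ∀ c x, 0 ≤ η c x := fun c x => le_max_left _ _
  set S : Ed d → ℝ := fun x => ∑ c, η c x with hS
  have hSc : Continuous S := by simp only [hS, hη]; fun_prop
  have hpos : ∀ x, 0 < max (S x) (ε / 4) := fun x => lt_max_of_lt_right (by positivity)
  have hsum : ∀ x, ∑ c, η c x / max (S x) (ε / 4) = S x / max (S x) (ε / 4) := fun x => by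
    rw [← Finset.sum_div]
  have hsupp : ∀ c x, η c x / max (S x) (ε / 4) ≠ 0 → ‖x - c‖ ≤ ε / 2 := fun c x h => by
    by_contra! hc
    refine h ?_
    simp only [hη]
    rw [max_eq_left (by linarith), zero_div]
  refine ⟨t, fun c x => η c x / max (S x) (ε / 4), fun c => ?_,
    fun c x => div_nonneg (hη0 c x) (hpos x).le, fun x => ?_, fun c x y hx hy => ?_,
    fun x hx => ?_⟩
  · refine Continuous.div (by simp only [hη]; fun_prop) (by fun_prop) fun x => (hpos x).ne'
  · rw [hsum]
    exact div_le_one_of_le₀ (le_max_left _ _) (hpos x).le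
  · have h1 := hsupp c x hx
    have h2 := hsupp c y hy
    rw [show x - y = (x - c) - (y - c) by abel]
    linarith [norm_sub_le (x - c) (y - c)]
  · rw [hsum]
    have hx' := hcov (mem_closedBall_zero_iff.2 hx)
    simp only [mem_iUnion, Metric.mem_ball, dist_eq_norm] at hx'
    obtain ⟨c, hc, hxc⟩ := hx'
    have : η ⟨c, hfin.mem_toFinset.2 hc⟩ x ≤ S x :=
      Finset.single_le_sum (fun j _ => hη0 j x) (Finset.mem_univ _)
    have h2 : ε / 2 - ‖x - c‖ ≤ η ⟨c, hfin.mem_toFinset.2 hc⟩ x := le_max_right _ _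
    have h3 : ε / 4 ≤ S x := by linarith
    rw [max_eq_left h3, div_self (by linarith)]

lemma mtendsto_of_tendsto_probabilityMeasure {ι : Type*} {l : Filter ι}
    {μ : ι → ProbabilityMeasure (Ed d)} {m : ProbabilityMeasure (Ed d)} (h : Tendsto μ l (𝓝 m))
    (hm : MemP d 2 m) (hμ : ∀ i, MemP d 2 (μ i)) {K : ℝ}
    (hK : ∀ i, secMom (μ i : Measure (Ed d)) ≤ K)
    (hmK : secMom (m : Measure (Ed d)) ≤ K) :
    MTendsto l (fun i => (μ i : Measure (Ed d))) m := by
  refine ⟨Eventually.of_forall hμ, ?_⟩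
  rw [Metric.tendsto_nhds]
  intro δ hδ
  have hK0 : 0 ≤ K := secMom_nonneg.trans hmK
  set R : ℝ := 1 + 4 * (2 + 4 * K) / δ with hR
  have hR1 : 1 ≤ R := le_add_of_nonneg_right (by positivity)
  have hR0 : 0 < R := by linarith
  have hRδ : (2 + 4 * K) / R < δ / 4 := by
    rw [div_lt_iff₀ hR0, hR]
    have : δ / 4 * (4 * (2 + 4 * K) / δ) = 2 + 4 * K := by field_simp
    nlinarith
  obtain ⟨t, χ, hχ, hχ0, hχ1, hsupp, hχR⟩ := exists_partition d (R := R) (half_pos hδ)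
  have hle : ∀ i x, χ i x ≤ 1 := fun i x =>
    (Finset.single_le_sum (fun j _ => hχ0 j x) (Finset.mem_univ i)).trans (hχ1 x)
  have hb : ∀ i x, ‖χ i x‖ ≤ 1 := fun i x => by
    rw [Real.norm_of_nonneg (hχ0 i x)]; exact hle i x
  have hint : ∀ i, Integrable (χ i) (m : Measure (Ed d)) := fun i =>
    (integrable_const (1 : ℝ)).mono' (hχ i).aestronglyMeasurable (ae_of_all _ (hb i))
  have hlim : ∀ i, Tendsto (fun n => ∫ x, χ i x ∂(μ n : Measure (Ed d))) l
      (𝓝 (∫ x, χ i x ∂(m : Measure (Ed d)))) := fun i =>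
    ProbabilityMeasure.tendsto_iff_forall_integral_tendsto.1 h
      (BoundedContinuousFunction.ofNormedAddCommGroup (χ i) (hχ i) 1 (hb i))
  set κ : ℝ := 1 / R ^ 2 with hκ
  have hκ0 : 0 < κ := by positivity
  have hκ1 : κ ≤ 1 := div_le_one_of_le₀ (one_le_pow₀ hR1) (by positivity)
  have hlim2 : Tendsto (fun n => δ / 2 + 2 * R * (1 - (1 - κ) * ∑ i,
      min (∫ x, χ i x ∂(m : Measure (Ed d))) (∫ x, χ i x ∂(μ n : Measure (Ed d)))) + (K + K) / R) l
      (𝓝 (δ / 2 + 2 * R * (1 - (1 - κ) * ∑ i,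
      min (∫ x, χ i x ∂(m : Measure (Ed d))) (∫ x, χ i x ∂(m : Measure (Ed d)))) + (K + K) / R)) :=
    (((tendsto_finsetSum _ fun i _ => tendsto_const_nhds.min (hlim i)).const_mul _
      |>.const_sub _ |>.const_mul _).const_add _).add_const _
  have hmass : 1 - K / R ^ 2 ≤ ∑ i, ∫ x, χ i x ∂(m : Measure (Ed d)) := by
    rw [← integral_finsetSum _ fun i _ => hint i]
    have h1 : ∀ x : Ed d, 1 - ‖x‖ ^ 2 / R ^ 2 ≤ ∑ i, χ i x := fun x => by
      rcases le_or_gt ‖x‖ R with hx | hx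
      · rw [hχR x hx]
        linarith [show 0 ≤ ‖x‖ ^ 2 / R ^ 2 by positivity]
      · have : 1 ≤ ‖x‖ ^ 2 / R ^ 2 := by
          rw [one_le_div (by positivity)]
          exact pow_le_pow_left₀ hR0.le hx.le 2
        linarith [Finset.sum_nonneg fun i (_ : i ∈ Finset.univ) => hχ0 i x]
    have h2 := integral_mono ((integrable_const (1 : ℝ)).sub
      (hm.integrable_norm_sq.div_const (R ^ 2))) (integrable_finsetSum _ fun i _ => hint i) h1
    rw [integral_sub' (integrable_const _) (hm.integrable_norm_sq.div_const _), integral_div] at h2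
    have h3 : (∫ x, ‖x‖ ^ 2 ∂(m : Measure (Ed d))) / R ^ 2 ≤ K / R ^ 2 :=
      div_le_div_of_nonneg_right hmK (by positivity)
    simp only [integral_const, probReal_univ, smul_eq_mul, one_mul] at h2
    linarith
  have hval : δ / 2 + 2 * R * (1 - (1 - κ) * ∑ i,
      min (∫ x, χ i x ∂(m : Measure (Ed d))) (∫ x, χ i x ∂(m : Measure (Ed d)))) + (K + K) / R
      < δ := by
    simp only [min_self]
    set A := ∑ i, ∫ x, χ i x ∂(m : Measure (Ed d))
    have h1 : 1 - (1 - κ) * A ≤ κ + K / R ^ 2 := by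
      have := mul_le_mul_of_nonneg_left hmass (sub_nonneg.2 hκ1)
      have h0 : 0 ≤ κ * (K / R ^ 2) := by positivity
      nlinarith
    have h2 : 2 * R * (κ + K / R ^ 2) + (K + K) / R = (2 + 4 * K) / R := by
      rw [hκ]; field_simp; ring
    have h3 := mul_le_mul_of_nonneg_left h1 (show 0 ≤ 2 * R by positivity)
    linarith
  filter_upwards [hlim2.eventually_lt_const hval] with n hn
  rw [Real.dist_eq, sub_zero, abs_of_nonneg (wdist_nonneg 1)]
  refine lt_of_le_of_lt ?_ hn
  refine (wdist_one_le_of_partition hm (hμ n) hχ hχ0 hχ1 (half_pos hδ).le hsupp hκ0 hκ1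
    hR0).trans ?_
  gcongr
  exact hK n

lemma measure_norm_gt_le {m : Measure (Ed d)} (hm : MemP d 2 m) {K : ℝ} (hK : secMom m ≤ K)
    {r : ℝ} (hr : 0 < r) : m {x | r < ‖x‖} ≤ ENNReal.ofReal (K / r ^ 2) := by
  have := hm.1
  have h1 := mul_meas_ge_le_integral_of_nonneg (μ := m) (f := fun x : Ed d => ‖x‖ ^ 2)
    (ae_of_all _ fun x => by positivity) hm.integrable_norm_sq (r ^ 2)
  rw [← ofReal_measureReal]
  refine ENNReal.ofReal_le_ofReal ?_
  rw [le_div_iff₀ (by positivity), mul_comm]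
  refine (mul_le_mul_of_nonneg_left (measureReal_mono fun x hx => ?_) (by positivity)).trans
    (h1.trans hK)
  exact pow_le_pow_left₀ hr.le (le_of_lt hx) 2

lemma exists_subseq_mtendsto {μ : ℕ → Measure (Ed d)} (hμ : ∀ n, MemP d 2 (μ n)) {K : ℝ}
    (hK : ∀ n, secMom (μ n) ≤ K) :
    ∃ m, MemP d 2 m ∧ ∃ φ : ℕ → ℕ, StrictMono φ ∧ MTendsto atTop (fun n => μ (φ n)) m := by
  set P : ℕ → ProbabilityMeasure (Ed d) := fun n => ⟨μ n, (hμ n).1⟩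
  have hK0 : 0 ≤ K := secMom_nonneg.trans (hK 0)
  have htight : IsTightMeasureSet {((ν : ProbabilityMeasure (Ed d)) : Measure (Ed d)) |
      ν ∈ range P} := by
    refine isTightMeasureSet_of_tendsto_measure_norm_gt ?_
    have hlim : Tendsto (fun r : ℝ => ENNReal.ofReal (K / r ^ 2)) atTop (𝓝 0) := by
      rw [← ENNReal.ofReal_zero]
      exact ENNReal.tendsto_ofReal (tendsto_const_nhds.div_atTop (tendsto_pow_atTop two_ne_zero))
    refine tendsto_of_tendsto_of_tendsto_of_le_of_le' tendsto_const_nhds hlim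
      (Eventually.of_forall fun _ => zero_le) ?_
    filter_upwards [eventually_gt_atTop 0] with r hr
    refine iSup₂_le ?_
    rintro _ ⟨_, ⟨n, rfl⟩, rfl⟩
    exact measure_norm_gt_le (hμ n) (hK n) hr
  obtain ⟨m, -, φ, hφ, hlim⟩ := (isCompact_closure_of_isTightMeasureSet htight).tendsto_subseq
    (x := P) fun n => subset_closure (mem_range_self n)
  have hlsc : ∫⁻ x, ENNReal.ofReal (‖x‖ ^ 2) ∂(m : Measure (Ed d)) ≤ ENNReal.ofReal K := by
    refine (lintegral_le_liminf_lintegral_of_forall_isOpen_measure_le_liminf_measure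
      (μs := fun n => μ (φ n)) (by fun_prop) (fun x => by positivity) fun G hG =>
      ProbabilityMeasure.le_liminf_measure_open_of_tendsto hlim hG).trans ?_
    refine (liminf_le_liminf (Eventually.of_forall fun n => ?_)).trans_eq (liminf_const _)
    rw [← ofReal_integral_eq_lintegral_ofReal (hμ _).integrable_norm_sq
      (ae_of_all _ fun x => by positivity)]
    exact ENNReal.ofReal_le_ofReal (hK _)
  have hm : MemP d 2 m := by
    refine memP_two_iff.2 ⟨inferInstance, by fun_prop, ?_⟩
    rw [hasFiniteIntegral_iff_ofReal (ae_of_all _ fun x => by positivity)]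
    exact hlsc.trans_lt ENNReal.ofReal_lt_top
  refine ⟨m, hm, φ, hφ, ?_⟩
  refine mtendsto_of_tendsto_probabilityMeasure (μ := P ∘ φ) hlim hm (fun n => hμ _)
    (fun n => hK _) ?_
  rw [← ofReal_integral_eq_lintegral_ofReal hm.integrable_norm_sq
      (ae_of_all _ fun x => by positivity)] at hlsc
  exact (ENNReal.ofReal_le_ofReal_iff hK0).1 hlsc

end Compactness

section Comparison

variable {d : ℕ} {T t₁ : ℝ} {m : Measure (Ed d)} {FD : A1Data d T} {ΨD : A2Data d}

lemma log_one_add_secMom_nonneg : 0 ≤ Real.log (1 + secMom m) :=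
  Real.log_nonneg (le_add_of_nonneg_right secMom_nonneg)

lemma valueFn_self (t₁ : ℝ) (m : Measure (Ed d)) : valueFn FD ΨD t₁ t₁ m = ΨD.ψ m := by
  simp [valueFn, heatFlow_self]

lemma exists_le_valueFn (FD : A1Data d T) (ht₁ : t₁ ∈ Icc 0 T) {B : ℝ}
    (hB : ∀ m : Measure (Ed d), MemP d 2 m → B ≤ ΨD.ψ m) :
    ∃ D, ∀ t ∈ Icc 0 t₁, ∀ m : Measure (Ed d), MemP d 2 m → D ≤ valueFn FD ΨD t₁ t m := by
  obtain ⟨c, hc⟩ := FD.bddF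
  refine ⟨B - |c| * t₁, fun t ht m hm => ?_⟩
  rw [valueFn_eq]
  have h1 : ‖∫ r in t..t₁, FD.F r (heatFlow d t r m)‖ ≤ |c| * |t₁ - t| := by
    refine intervalIntegral.norm_integral_le_of_norm_le_const fun r hr => ?_
    rw [uIoc_of_le ht.2] at hr
    exact (hc r ⟨ht.1.trans hr.1.le, hr.2.trans ht₁.2⟩ _ (hm.heatFlow _ _)).trans (le_abs_self c)
  rw [abs_of_nonneg (sub_nonneg.2 ht.2), Real.norm_eq_abs] at h1
  have h2 := hB _ (hm.heatFlow t t₁)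
  have h3 := mul_nonneg (abs_nonneg c) ht.1
  linarith [(abs_le.1 h1).1]

/-- The penalization makes `penFn - u` coercive, hence its minimum is attained. -/
lemma exists_isMin_penFn_sub (ht₁ : t₁ ∈ Icc 0 T) {u : ℝ → Measure (Ed d) → ℝ}
    (hbdd : BddD1 d t₁ u) (hcont : ContD1 d t₁ u) {D : ℝ}
    (hD : ∀ t ∈ Icc 0 t₁, ∀ m : Measure (Ed d), MemP d 2 m → D ≤ valueFn FD ΨD t₁ t m)
    {ε : ℝ} (hε : 0 < ε) {t₀ : ℝ} (ht₀ : t₀ ∈ Icc 0 t₁) (hm : MemP d 2 m) :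
    ∃ t ∈ Icc 0 t₁, ∃ m : Measure (Ed d), MemP d 2 m ∧ ∀ t' ∈ Icc 0 t₁, ∀ m' : Measure (Ed d),
      MemP d 2 m' → penFn FD ΨD t₁ ε t m - u t m ≤ penFn FD ΨD t₁ ε t' m' - u t' m' := by
  obtain ⟨B, hB⟩ := hbdd
  have hlow : ∀ t ∈ Icc 0 t₁, ∀ m : Measure (Ed d), MemP d 2 m →
      ε * Real.log (1 + secMom m) + (D - B) ≤ penFn FD ΨD t₁ ε t m - u t m := by
    intro t ht m hm
    have h1 := hD t ht m hm
    have h2 := (abs_le.1 (hB t ht m hm)).2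
    have h3 : 0 ≤ ε * (((d : ℝ) + 1) * (t₁ - t)) :=
      mul_nonneg hε.le (mul_nonneg (by positivity) (sub_nonneg.2 ht.2))
    simp only [penFn]
    linarith
  set S : Set ℝ := {j | ∃ t ∈ Icc 0 t₁, ∃ m : Measure (Ed d), MemP d 2 m ∧
    j = penFn FD ΨD t₁ ε t m - u t m} with hS
  have hne : S.Nonempty := ⟨_, t₀, ht₀, m, hm, rfl⟩
  have hbelow : BddBelow S := by
    refine ⟨D - B, ?_⟩
    rintro _ ⟨t, ht, m, hm, rfl⟩
    exact (le_add_of_nonneg_left (mul_nonneg hε.le log_one_add_secMom_nonneg)).trans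
      (hlow t ht m hm)
  obtain ⟨j, -, hj, hjS⟩ := exists_seq_tendsto_sInf hne hbelow
  obtain ⟨N, hN⟩ := eventually_atTop.1 (hj.eventually_lt_const (lt_add_one (sInf S)))
  choose t ht μ hμ hjJ using fun n => hjS (n + N)
  have hbd : ∀ n, secMom (μ n) ≤ Real.exp ((sInf S + 1 - (D - B)) / ε) := fun n => by
    have h1 := hlow (t n) (ht n) (μ n) (hμ n)
    have h2 := hN (n + N) (Nat.le_add_left _ _)
    rw [hjJ n] at h2
    have h3 : Real.log (1 + secMom (μ n)) ≤ (sInf S + 1 - (D - B)) / ε := by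
      rw [le_div_iff₀ hε]
      linarith
    have h4 := (Real.log_le_iff_le_exp one_add_secMom_pos).1 h3
    linarith
  obtain ⟨ts, hts, φ, hφ, hlimt⟩ := isCompact_Icc.tendsto_subseq ht
  obtain ⟨ms, hms, φ', hφ', hlimm⟩ := exists_subseq_mtendsto (fun n => hμ (φ n)) fun n => hbd (φ n)
  have hmon := hφ.comp hφ'
  have hlimt' : Tendsto (fun n => t (φ (φ' n))) atTop (𝓝 ts) := hlimt.comp hφ'.tendsto_atTop
  have htm : ∀ᶠ n in atTop, t (φ (φ' n)) ∈ Icc 0 t₁ := Eventually.of_forall fun n => ht _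
  have hlimj : Tendsto (fun n => penFn FD ΨD t₁ ε (t (φ (φ' n))) (μ (φ (φ' n))) -
      u (t (φ (φ' n))) (μ (φ (φ' n)))) atTop (𝓝 (sInf S)) := by
    have := ((tendsto_add_atTop_iff_nat N).2 hj).comp hmon.tendsto_atTop
    exact this.congr fun n => hjJ _
  have hle : penFn FD ΨD t₁ ε ts ms - u ts ms ≤ sInf S := by
    refine le_of_forall_pos_le_add fun δ hδ => ?_
    have h1 := hlimm.eventually_lt_log_secMom hms
      (sub_lt_self (Real.log (1 + secMom ms)) (div_pos hδ hε))
    have h2 := ((tendsto_valueFn (FD := FD) (ΨD := ΨD) ht₁ hts hms hlimt' htm hlimm).add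
      (((hlimt'.const_sub t₁).const_mul ((d : ℝ) + 1)).const_add
        (Real.log (1 + secMom ms) - δ / ε) |>.const_mul ε)).sub
      (hcont.tendsto hts hms hlimt' htm hlimm)
    have h3 := le_of_tendsto_of_tendsto h2 hlimj (h1.mono fun n hn => by
      have := mul_le_mul_of_nonneg_left hn.le hε.le
      simp only [penFn]
      linarith)
    have h4 : ε * (δ / ε) = δ := mul_div_cancel₀ _ hε.ne'
    simp only [penFn]
    linarith
  exact ⟨ts, hts, ms, hms, fun t' ht' m' hm' =>
    hle.trans (csInf_le hbelow ⟨t', ht', m', hm', rfl⟩)⟩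

end Comparison

/-- **comparison.** Let `F` satisfy (A1), `ψ` satisfy (A2), `t₁ ∈ [0,T]`,
and set `φ(t,m) = ψ(p^{t,m}_{t₁}) + ∫_t^{t₁} F(r,p^{t,m}_r) dr`. Let `u` be a bounded,
continuous subsolution on `[0,t₁) × 𝒫₂` of
`∂_t u + ½ ∫ div[D_m u](t,m,x) dm(x) + F(t,m) = 0` such that `u(t₁,m) ≤ ψ(m)` for all
`m ∈ 𝒫₂`. Then `u ≤ φ` on `[0,t₁] × 𝒫₂`. -/
theorem comparison_principle (d : ℕ) (T : ℝ) (hT : 0 ≤ T)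
    (FD : A1Data d T) (ΨD : A2Data d) (t₁ : ℝ) (ht₁ : t₁ ∈ Set.Icc 0 T)
    (u : ℝ → Measure (Ed d) → ℝ)
    (hbdd : BddD1 d t₁ u) (hcont : ContD1 d t₁ u)
    (hsub : IsSubsolution d t₁ FD.F u)
    (hterm : ∀ m : Measure (Ed d), MemP d 2 m → u t₁ m ≤ ΨD.ψ m) :
    ∀ t ∈ Set.Icc 0 t₁, ∀ m : Measure (Ed d), MemP d 2 m →
      u t m ≤ ΨD.ψ (heatFlow d t t₁ m) + ∫ r in t..t₁, FD.F r (heatFlow d t r m) := by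
  intro t ht m hm
  rw [← valueFn_eq (FD := FD) (ΨD := ΨD)]
  by_contra! hlt
  obtain ⟨B, hB⟩ := id hbdd
  obtain ⟨D, hD⟩ := exists_le_valueFn (ΨD := ΨD) FD ht₁ (B := -B) fun m hm =>
    (abs_le.1 (hB t₁ (right_mem_Icc.2 ht₁.1) m hm)).1.trans (hterm m hm)
  set L : ℝ := Real.log (1 + secMom m) + (d + 1) * (t₁ - t)
  have hL : 0 ≤ L := add_nonneg log_one_add_secMom_nonneg
    (mul_nonneg (by positivity) (sub_nonneg.2 ht.2))
  set ε : ℝ := (u t m - valueFn FD ΨD t₁ t m) / (1 + L)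
  have hε : 0 < ε := div_pos (sub_pos.2 hlt) (by linarith)
  have hneg : penFn FD ΨD t₁ ε t m - u t m < 0 := by
    have h1 : ε * (1 + L) = u t m - valueFn FD ΨD t₁ t m :=
      div_mul_cancel₀ _ (by linarith)
    have h2 : penFn FD ΨD t₁ ε t m = valueFn FD ΨD t₁ t m + ε * L := rfl
    rw [h2]
    linarith
  obtain ⟨ts, hts, ms, hms, hmin⟩ := exists_isMin_penFn_sub ht₁ hbdd hcont hD hε ht hm
  have hlt₁ : ts < t₁ := by
    refine lt_of_le_of_ne hts.2 fun h => ?_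
    have h1 := (hmin t ht m hm).trans_lt hneg
    have h2 := hterm ms hms
    have h3 := mul_nonneg hε.le (log_one_add_secMom_nonneg (m := ms))
    simp only [penFn, h, valueFn_self] at h1
    linarith
  have hge := hsub ts ⟨hts.1, hlt₁⟩ ms hms (penTestFn FD ΨD ht₁ hε)
    ⟨1, one_pos, fun t' ht' m' hm' _ _ => hmin t' ht' m' hm'⟩
  exact absurd (penTestFn_operator_lt_zero ht₁ hε hts hms) (not_lt.2 hge)

end
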